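/- arXiv:2409.12168 — 2 statements merged into one kernel-verified Lean document; each statement's English description precedes it below -/
import Mathlib

section
/- Let T be a weakly mixing symmetric interval exchange transformation on I = [0,1) and let f(x) = a(x - 1/2) for some real a ≠ 0. Then the skew product T_f : I × ℝ → I × ℝ, T_f(x,r) = (T(x), r + f(x)), has infinite ergodic index: for every n ≥ 1, the n-fold Cartesian product T_f^{×n} acting on (I × ℝ)^n is ergodic with respect to the n-fold product of the measure λ_I ⊗ λ_ℝ. -/
open MeasureTheory Set
open scoped Classical

/-- An interval exchange transformation (IET) on the interval `[a, b)`: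
an alphabet `Fin d`, bijections `perm0`, `perm1 : Fin d ≃ Fin d` describing the order of
the exchanged intervals before and after applying the map, and a positive length vector
`len` summing up to `b - a`.  The permutation datum is assumed non-reducible. -/
structure IET where
  d : ℕ
  hd : 0 < d
  a : ℝ
  b : ℝ
  hab : a < b
  perm0 : Fin d ≃ Fin d
  perm1 : Fin d ≃ Fin d
  len : Fin d → ℝ
  len_pos : ∀ α, 0 < len α
  len_sum : ∑ α, len α = b - a
  irred : ∀ k : ℕ, 0 < k → k < d → ¬ (∀ α, (perm0 α : ℕ) < k ↔ (perm1 α : ℕ) < k)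

namespace IET

variable (T : IET)

/-- The left endpoint `∂I_α` of the exchanged interval `I_α`. -/
noncomputable def lep (α : Fin T.d) : ℝ :=
  T.a + ∑ β ∈ Finset.univ.filter (fun β => T.perm0 β < T.perm0 α), T.len β

/-- The left endpoint of the image interval `T(I_α)`. -/
noncomputable def lepImg (α : Fin T.d) : ℝ :=
  T.a + ∑ β ∈ Finset.univ.filter (fun β => T.perm1 β < T.perm1 α), T.len β

/-- The translation amount on `I_α`. -/
noncomputable def transl (α : Fin T.d) : ℝ := T.lepImg α - T.lep α

/-- The exchanged interval `I_α`. -/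
noncomputable def interval (α : Fin T.d) : Set ℝ :=
  Set.Ico (T.lep α) (T.lep α + T.len α)

/-- The image interval `T(I_α)`. -/
noncomputable def intervalImg (α : Fin T.d) : Set ℝ :=
  Set.Ico (T.lepImg α) (T.lepImg α + T.len α)

/-- The IET as a self-map of `ℝ`: it translates each `I_α` onto its image and is
the identity outside `[a, b)`. -/
noncomputable def toFun (x : ℝ) : ℝ :=
  x + ∑ α, if x ∈ T.interval α then T.transl α else 0

/-- The inverse IET `T⁻¹` as a self-map of `ℝ`. -/
noncomputable def invFun (x : ℝ) : ℝ :=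
  x + ∑ α, if x ∈ T.intervalImg α then -T.transl α else 0

/-- The iterate `T^n`, `n : ℤ` (negative iterates via `invFun`). -/
noncomputable def iter (n : ℤ) (x : ℝ) : ℝ :=
  if 0 ≤ n then T.toFun^[n.toNat] x else T.invFun^[(-n).toNat] x

/-- `M(β) = min {n ≥ 1 | T^{-n}(∂I_β) = ∂I_α for some α with π₁ α ≠ 1}`, with the
convention `M(π₀⁻¹ 1) = 1`, and `∞` if no such `n` exists. -/
noncomputable def M (β : Fin T.d) : ℕ∞ :=
  if (T.perm0 β : ℕ) = 0 then 1
  else sInf {e : ℕ∞ | ∃ n : ℕ, e = (n : ℕ∞) ∧ 1 ≤ n ∧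
    ∃ α : Fin T.d, (T.perm1 α : ℕ) ≠ 0 ∧ T.invFun^[n] (T.lep β) = T.lep α}

/-- `N(β) = min {n ≥ 1 | T^{n}(∂I_β) = ∂I_α for some α with π₀ α ≠ 1}`, with the
convention `N(π₁⁻¹ 1) = 1`, and `∞` if no such `n` exists. -/
noncomputable def N (β : Fin T.d) : ℕ∞ :=
  if (T.perm1 β : ℕ) = 0 then 1
  else sInf {e : ℕ∞ | ∃ n : ℕ, e = (n : ℕ∞) ∧ 1 ≤ n ∧
    ∃ α : Fin T.d, (T.perm0 α : ℕ) ≠ 0 ∧ T.toFun^[n] (T.lep β) = T.lep α}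

/-- `s` is a (non-trivial) connection of `T`: the orbit segment
`{T^{-k}(∂I_β) | 0 ≤ k ≤ n}` where `π₀ β ≠ 1`, `π₁ α ≠ 1`, `n ≥ 1` and
`T^{-n}(∂I_β) = ∂I_α`. -/
def IsConnection (s : Set ℝ) : Prop :=
  ∃ (β α : Fin T.d) (n : ℕ), (T.perm0 β : ℕ) ≠ 0 ∧ (T.perm1 α : ℕ) ≠ 0 ∧ 1 ≤ n ∧
    T.invFun^[n] (T.lep β) = T.lep α ∧
    s = (fun k : ℕ => T.invFun^[k] (T.lep β)) '' {k : ℕ | k ≤ n}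

/-- `T` is symmetric: `π₁ ∘ π₀⁻¹ (i) = d + 1 - i` (here with `Fin d` indexing:
`perm1 α + perm0 α + 1 = d`). -/
def IsSymm : Prop := ∀ α, (T.perm1 α : ℕ) + (T.perm0 α : ℕ) + 1 = T.d

/-- The midpoint `c_α` of the exchanged interval `I_α`. -/
noncomputable def center (α : Fin T.d) : ℝ := T.lep α + T.len α / 2

/-- The midpoint `c_{1/2}` of the interval `I = [a, b)`. -/
noncomputable def centerHalf : ℝ := (T.a + T.b) / 2

/-- Midpoints indexed by `𝒜 ∪ {1/2}`; `none` plays the role of `1/2`. -/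
noncomputable def centerOpt (β : Option (Fin T.d)) : ℝ :=
  match β with
  | none => T.centerHalf
  | some α => T.center α

/-- `δ_{1/2}`. -/
def deltaHalf (β : Option (Fin T.d)) : ℕ :=
  match β with
  | none => 1
  | some _ => 0

/-- The symmetric reflection `𝓘_I (x) = a + b - x` of `I = [a, b)`. -/
noncomputable def refl (x : ℝ) : ℝ := T.a + T.b - x

/-- The first return time `r_J(x) = min {n ≥ 1 | T^n x ∈ J}`. -/
noncomputable def returnTime (J : Set ℝ) (x : ℝ) : ℕ :=
  sInf {n : ℕ | 1 ≤ n ∧ T.toFun^[n] x ∈ J}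

/-- The first return map `T_J`. -/
noncomputable def firstReturn (J : Set ℝ) (x : ℝ) : ℝ := T.toFun^[T.returnTime J x] x

/-- The first backward return time `b_J(x) = min {n ≥ 1 | T^{-n} x ∈ J}`. -/
noncomputable def backTime (J : Set ℝ) (x : ℝ) : ℕ :=
  sInf {n : ℕ | 1 ≤ n ∧ T.invFun^[n] x ∈ J}

/-- The first backward return map `p_J` (the inverse of the first return map `T_J`). -/
noncomputable def backReturn (J : Set ℝ) (x : ℝ) : ℝ := T.invFun^[T.backTime J x] x

/-- `m_{J,α} = inf {n ≥ 0 | T^{-n}(∂I_α) ∈ interior J}`. -/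
noncomputable def mJ (J : Set ℝ) (α : Fin T.d) : ℕ :=
  sInf {n : ℕ | T.invFun^[n] (T.lep α) ∈ interior J}

/-- `J` is of form (★): a subinterval `[a_J, b_J) ⊆ I` whose endpoints are iterates
`T^{m₀}(∂I_{α_J})`, `T^{n₀}(∂I_{β_J})` of left endpoints which do not visit `J` at any
earlier time between `0` and `m₀` (resp. `n₀`). -/
def IsStarForm (J : Set ℝ) : Prop :=
  ∃ (aJ bJ : ℝ) (αJ βJ : Fin T.d) (m₀ n₀ : ℤ),
    aJ < bJ ∧ J = Set.Ico aJ bJ ∧ J ⊆ Set.Ico T.a T.b ∧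
    aJ = T.iter m₀ (T.lep αJ) ∧ bJ = T.iter n₀ (T.lep βJ) ∧
    (∀ m : ℤ, (0 ≤ m ∧ m ≤ m₀ ∨ m₀ ≤ m ∧ m ≤ 0) → m ≠ m₀ → T.iter m (T.lep αJ) ∉ J) ∧
    (∀ n : ℤ, (0 ≤ n ∧ n ≤ n₀ ∨ n₀ ≤ n ∧ n ≤ 0) → n ≠ n₀ → T.iter n (T.lep βJ) ∉ J)

/-- `J` is a `β`-symmetric interval (`β : Option (Fin T.d)`, `none` = `1/2`-symmetric):
`J = [c_β - Δ, c_β + Δ)` with `Δ > 0`, contained in `I_β` (resp. in `I`). -/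
def IsSymmetricInterval (J : Set ℝ) (β : Option (Fin T.d)) : Prop :=
  ∃ Δ : ℝ, 0 < Δ ∧ J = Set.Ico (T.centerOpt β - Δ) (T.centerOpt β + Δ) ∧
    (match β with
      | some γ => J ⊆ T.interval γ
      | none => J ⊆ Set.Ico T.a T.b)

/-- `x` is a left endpoint of one of the intervals exchanged by the first return map
`T_J`, where `J = [aJ, bJ)`: either `x = aJ`, or the forward orbit of `x` before its
first return to `J` meets a left endpoint `∂I_α` of `T` or the right endpoint `bJ`. -/
def IsExchLeftEndpoint (J : Set ℝ) (aJ bJ : ℝ) (x : ℝ) : Prop :=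
  x = aJ ∨ ∃ k : ℕ, k < T.returnTime J x ∧
    ((∃ α : Fin T.d, T.toFun^[k] x = T.lep α) ∨ (1 ≤ k ∧ T.toFun^[k] x = bJ))

/-- A Rokhlin tower decomposition of `I = [a, b)` over `J = [aJ, bJ)` associated with the
first return map `T_J`: the bases `[base γ, base γ + blen γ)` partition `J`, the return
time on the base `γ` is constantly `h γ`, each `T^i` (`i ≤ h γ`) acts as a translation on
the base `γ`, and the tower levels `T^i([base γ, base γ + blen γ))`, `i < h γ`, are
pairwise disjoint and partition `I`. -/
def IsTowerDecomp (aJ bJ : ℝ) {k : ℕ} (base blen : Fin k → ℝ) (h : Fin k → ℕ) : Prop :=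
  (∀ γ, 0 < blen γ) ∧ (∀ γ, 1 ≤ h γ) ∧
  Pairwise (Function.onFun Disjoint fun γ => Set.Ico (base γ) (base γ + blen γ)) ∧
  (⋃ γ, Set.Ico (base γ) (base γ + blen γ)) = Set.Ico aJ bJ ∧
  (∀ γ, ∀ i ≤ h γ, ∀ x ∈ Set.Ico (base γ) (base γ + blen γ),
    T.toFun^[i] x - T.toFun^[i] (base γ) = x - base γ) ∧
  (∀ γ, ∀ x ∈ Set.Ico (base γ) (base γ + blen γ), T.returnTime (Set.Ico aJ bJ) x = h γ) ∧
  (⋃ γ, ⋃ i ∈ Finset.range (h γ), T.toFun^[i] '' Set.Ico (base γ) (base γ + blen γ))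
    = Set.Ico T.a T.b ∧
  (∀ γ γ' : Fin k, ∀ i i' : ℕ, i < h γ → i' < h γ' → (γ, i) ≠ (γ', i') →
    Disjoint (T.toFun^[i] '' Set.Ico (base γ) (base γ + blen γ))
      (T.toFun^[i'] '' Set.Ico (base γ') (base γ' + blen γ')))

/-- Replace the length data of an IET, keeping the combinatorial data. -/
noncomputable abbrev replaceLen (len' : Fin T.d → ℝ) (h1 : ∀ α, 0 < len' α)
    (h2 : ∑ α, len' α = T.b - T.a) : IET :=
  { T with len := len', len_pos := h1, len_sum := h2 }

end IET

open IET

namespace SkewIET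
open Filter Topology Metric
open scoped ENNReal NNReal

section WeakMixing

variable {α : Type*} [MeasurableSpace α] {μ : Measure α} [IsProbabilityMeasure μ]

lemma tendsto_birkhoffAverage_inter {S : α → α} (hS : Ergodic S μ) {P Q : Set α}
    (hP : MeasurableSet P) (hQ : MeasurableSet Q) :
    Tendsto (fun N : ℕ => (N : ℝ)⁻¹ * ∑ k ∈ Finset.range N, μ.real (S^[k] ⁻¹' P ∩ Q)) atTop
      (𝓝 (μ.real P * μ.real Q)) := by
  set U := Lp.compMeasurePreservingₗᵢ (E := ℝ) (p := 2) ℝ S hS.toMeasurePreserving with hU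
  have hUk : ∀ k : ℕ, (U.toContinuousLinearMap)^[k]
      (indicatorConstLp 2 hP (measure_ne_top μ P) (1 : ℝ)) =
      indicatorConstLp 2 ((hS.measurable.iterate k) hP) (measure_ne_top μ _) (1:ℝ) := by
    intro k
    induction k with
    | zero => rfl
    | succ k ih =>
      rw [Function.iterate_succ_apply', ih]
      change Lp.compMeasurePreserving S _ _ = _
      rw [Lp.indicatorConstLp_compMeasurePreserving]
      congr 1
  have hlim := ContinuousLinearMap.tendsto_birkhoffAverage_orthogonalProjection
    U.toContinuousLinearMap U.norm_toContinuousLinearMap_le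
    (indicatorConstLp 2 hP (measure_ne_top μ P) (1:ℝ))
  set y : Lp ℝ 2 μ := ↑((LinearMap.eqLocus (U.toContinuousLinearMap : Lp ℝ 2 μ →ₗ[ℝ] Lp ℝ 2 μ)
    ((1 : Lp ℝ 2 μ →L[ℝ] Lp ℝ 2 μ) : Lp ℝ 2 μ →ₗ[ℝ] Lp ℝ 2 μ)).orthogonalProjectionOnto
      (indicatorConstLp 2 hP (measure_ne_top μ P) (1:ℝ))) with hy
  have hUy : Lp.compMeasurePreserving S hS.toMeasurePreserving y = y := by
    have := (((LinearMap.eqLocus (U.toContinuousLinearMap : Lp ℝ 2 μ →ₗ[ℝ] Lp ℝ 2 μ)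
      ((1 : Lp ℝ 2 μ →L[ℝ] Lp ℝ 2 μ) : Lp ℝ 2 μ →ₗ[ℝ] Lp ℝ 2 μ)).orthogonalProjectionOnto
      (indicatorConstLp 2 hP (measure_ne_top μ P) (1:ℝ)))).2
    exact this
  obtain ⟨c, hc⟩ := hS.eq_const_of_compMeasurePreserving_eq (g := (y : α →ₘ[μ] ℝ))
    (congrArg Subtype.val hUy)
  have hyc : y =ᵐ[μ] fun _ => c := by
    rw [hc]; exact AEEqFun.coeFn_const α c
  have key : ∀ Q : Set α, MeasurableSet Q →
      Tendsto (fun N : ℕ => (N : ℝ)⁻¹ * ∑ k ∈ Finset.range N, μ.real (S^[k] ⁻¹' P ∩ Q)) atTop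
      (𝓝 (c * μ.real Q)) := by
    intro Q hQ
    have h1 := Filter.Tendsto.inner (𝕜 := ℝ) (tendsto_const_nhds
      (x := indicatorConstLp 2 hQ (measure_ne_top μ Q) (1:ℝ))) hlim
    have h2 : inner ℝ (indicatorConstLp 2 hQ (measure_ne_top μ Q) (1:ℝ)) y = c * μ.real Q := by
      rw [L2.inner_indicatorConstLp_one, setIntegral_congr_ae (g := fun _ => c) hQ
        (hyc.mono fun x hx _ => hx)]
      simp [mul_comm]
    refine (h2 ▸ h1).congr fun N => ?_
    simp only [birkhoffAverage, birkhoffSum, id, inner_smul_right, inner_sum]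
    congr 1
    refine Finset.sum_congr rfl fun k _ => ?_
    rw [hUk, L2.real_inner_indicatorConstLp_one_indicatorConstLp_one, inter_comm]
  have hcP : c = μ.real P := by
    have h1 := key univ MeasurableSet.univ
    simp only [inter_univ, probReal_univ, mul_one] at h1
    refine tendsto_nhds_unique h1 (tendsto_const_nhds.congr' ?_)
    filter_upwards [eventually_gt_atTop 0] with N hN
    have : ∀ k, μ.real (S^[k] ⁻¹' P) = μ.real P := fun k =>
      (hS.toMeasurePreserving.iterate k).measureReal_preimage hP.nullMeasurableSet
    simp only [this, Finset.sum_const, Finset.card_range, nsmul_eq_mul]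
    field_simp
  rw [← hcP]; exact key Q hQ

/-- First factor of an ergodic square. -/
lemma ergodic_of_ergodic_prod {T : α → α} (hT : Measurable T)
    (h : Ergodic (fun p : α × α => (T p.1, T p.2)) (μ.prod μ)) : Ergodic T μ := by
  have hmp : MeasurePreserving T μ μ := by
    refine ⟨hT, ?_⟩
    ext A hA
    have := h.toMeasurePreserving.measure_preimage (hA.prod MeasurableSet.univ).nullMeasurableSet
    rw [Measure.map_apply hT hA]
    have e : (fun p : α × α => (T p.1, T p.2)) ⁻¹' (A ×ˢ univ) = (T ⁻¹' A) ×ˢ univ := by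
      ext; simp
    rw [e] at this
    simpa using this
  refine ⟨hmp, ⟨fun s hs hsT => ?_⟩⟩
  have h2 := h.toPreErgodic.measure_self_or_compl_eq_zero (s := s ×ˢ (univ : Set α))
    (hs.prod MeasurableSet.univ) (by
      ext p; simp only [mem_preimage, mem_prod, mem_univ, and_true]
      exact Set.ext_iff.1 hsT p.1)
  rw [eventuallyConst_set']
  rcases h2 with h2 | h2
  · left; rw [ae_eq_empty]; simpa using h2
  · right; rw [ae_eq_univ]
    have e : (s ×ˢ (univ : Set α))ᶜ = sᶜ ×ˢ univ := by ext; simp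
    rw [e] at h2; simpa using h2

lemma tendsto_average_abs {T : α → α} (hT : Measurable T)
    (h : Ergodic (fun p : α × α => (T p.1, T p.2)) (μ.prod μ)) {A B : Set α}
    (hA : MeasurableSet A) (hB : MeasurableSet B) :
    Tendsto (fun N : ℕ => (N : ℝ)⁻¹ * ∑ k ∈ Finset.range N,
      |μ.real (T^[k] ⁻¹' A ∩ B) - μ.real A * μ.real B|) atTop (𝓝 0) := by
  have h1 := tendsto_birkhoffAverage_inter (ergodic_of_ergodic_prod hT h) hA hB
  have h2 := tendsto_birkhoffAverage_inter h (hA.prod hA) (hB.prod hB)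
  have e : ∀ k : ℕ, (μ.prod μ).real ((fun p : α × α => (T p.1, T p.2))^[k] ⁻¹' (A ×ˢ A) ∩ B ×ˢ B)
      = μ.real (T^[k] ⁻¹' A ∩ B) ^ 2 := by
    intro k
    have : (fun p : α × α => (T p.1, T p.2))^[k] = Prod.map T^[k] T^[k] :=
      Prod.map_iterate T T k
    rw [this]
    have : Prod.map T^[k] T^[k] ⁻¹' (A ×ˢ A) ∩ B ×ˢ B
      = (T^[k] ⁻¹' A ∩ B) ×ˢ (T^[k] ⁻¹' A ∩ B) := by
      ext; simp; tauto
    rw [this, measureReal_prod_prod, sq]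
  simp only [e, measureReal_prod_prod] at h2
  set m := μ.real A * μ.real B
  have h3 : Tendsto (fun N : ℕ => (N : ℝ)⁻¹ * ∑ k ∈ Finset.range N,
      (μ.real (T^[k] ⁻¹' A ∩ B) - m)^2) atTop (𝓝 0) := by
    have : Tendsto (fun N : ℕ => ((N : ℝ)⁻¹ * ∑ k ∈ Finset.range N,
      μ.real (T^[k] ⁻¹' A ∩ B) ^ 2) - 2 * m * ((N : ℝ)⁻¹ * ∑ k ∈ Finset.range N,
      μ.real (T^[k] ⁻¹' A ∩ B)) + m ^ 2) atTop (𝓝 (m*m - 2 * m * m + m ^ 2)) := by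
      refine (Tendsto.sub ?_ (h1.const_mul _)).add_const _
      convert h2 using 2; ring
    rw [show m*m - 2 * m * m + m ^ 2 = 0 by ring] at this
    refine this.congr' ?_
    filter_upwards [eventually_gt_atTop 0] with N hN
    have : ∀ k, (μ.real (T^[k] ⁻¹' A ∩ B) - m)^2 = μ.real (T^[k] ⁻¹' A ∩ B)^2
      - 2 * m * μ.real (T^[k] ⁻¹' A ∩ B) + m ^2 := fun k => by ring
    simp only [this, Finset.sum_add_distrib, Finset.sum_sub_distrib, ← Finset.mul_sum,
      Finset.sum_const, Finset.card_range, nsmul_eq_mul]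
    field_simp
  have h4 := h3.sqrt
  rw [Real.sqrt_zero] at h4
  refine squeeze_zero (fun N => by positivity) (fun N => ?_) h4
  refine Real.le_sqrt_of_sq_le ?_
  rcases Nat.eq_zero_or_pos N with rfl | hN
  · simp
  have := sq_sum_le_card_mul_sum_sq (s := Finset.range N)
    (f := fun k => |μ.real (T^[k] ⁻¹' A ∩ B) - m|)
  simp only [sq_abs, Finset.card_range] at this
  rw [mul_pow]
  calc ((N:ℝ)⁻¹)^2 * _ ≤ ((N:ℝ)⁻¹)^2 * (N * _) := by gcongr
    _ = _ := by field_simp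

lemma abs_prod_sub_prod_le {ι : Type*} (s : Finset ι) (a b : ι → ℝ) (ha : ∀ i, |a i| ≤ 1)
    (hb : ∀ i, |b i| ≤ 1) : |∏ i ∈ s, a i - ∏ i ∈ s, b i| ≤ ∑ i ∈ s, |a i - b i| := by
  induction s using Finset.induction_on with
  | empty => simp
  | insert i s hi ih =>
    rw [Finset.prod_insert hi, Finset.prod_insert hi, Finset.sum_insert hi]
    have hp : |∏ i ∈ s, a i| ≤ 1 := by
      rw [Finset.abs_prod]; exact Finset.prod_le_one (fun _ _ => abs_nonneg _) fun i _ => ha i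
    calc |a i * ∏ i ∈ s, a i - b i * ∏ i ∈ s, b i|
        = |(a i - b i) * ∏ i ∈ s, a i + b i * (∏ i ∈ s, a i - ∏ i ∈ s, b i)| := by ring_nf
      _ ≤ |a i - b i| * |∏ i ∈ s, a i| + |b i| * |∏ i ∈ s, a i - ∏ i ∈ s, b i| := by
        rw [← abs_mul, ← abs_mul]; exact abs_add_le _ _
      _ ≤ |a i - b i| * 1 + 1 * ∑ i ∈ s, |a i - b i| := by
        gcongr; exact hb i
      _ = _ := by ring

/-- A weakly mixing map has ergodic Cartesian powers of every order. -/
theorem ergodic_pi_of_ergodic_prod {ι : Type*} [Fintype ι] {T : α → α} (hT : Measurable T)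
    (h : Ergodic (fun p : α × α => (T p.1, T p.2)) (μ.prod μ)) :
    Ergodic (fun x : ι → α => fun i => T (x i)) (Measure.pi fun _ => μ) := by
  have hE := ergodic_of_ergodic_prod hT h
  set G := fun x : ι → α => fun i => T (x i) with hG
  set ν : Measure (ι → α) := Measure.pi fun _ => μ with hν
  have hmp : MeasurePreserving G ν ν := measurePreserving_pi _ _ fun _ => hE.toMeasurePreserving
  have hit : ∀ k : ℕ, G^[k] = fun x i => T^[k] (x i) := by
    intro k
    induction k with
    | zero => rfl
    | succ k ih => rw [Function.iterate_succ', ih]; ext x i; simp [hG, Function.iterate_succ_apply']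
  have box : ∀ s t : ι → Set α, (∀ i, MeasurableSet (s i)) → (∀ i, MeasurableSet (t i)) →
      Tendsto (fun N : ℕ => (N : ℝ)⁻¹ * ∑ k ∈ Finset.range N,
        ν.real (G^[k] ⁻¹' (univ.pi s) ∩ univ.pi t)) atTop
        (𝓝 (ν.real (univ.pi s) * ν.real (univ.pi t))) := by
    intro s t hs ht
    have hb : ∀ u : ι → Set α, ν.real (univ.pi u) = ∏ i, μ.real (u i) := by
      intro u; simp [Measure.real, hν, Measure.pi_pi, ENNReal.toReal_prod]
    have hk : ∀ k : ℕ, ν.real (G^[k] ⁻¹' (univ.pi s) ∩ univ.pi t) =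
        ∏ i, μ.real (T^[k] ⁻¹' (s i) ∩ t i) := by
      intro k
      rw [← hb]; congr 1; ext x; simp only [hit]; simp [forall_and]
    rw [hb, hb, ← Finset.prod_mul_distrib]
    simp only [hk]
    rw [tendsto_iff_norm_sub_tendsto_zero]
    have h0 : Tendsto (fun N : ℕ => ∑ i, (N : ℝ)⁻¹ * ∑ k ∈ Finset.range N,
      |μ.real (T^[k] ⁻¹' (s i) ∩ t i) - μ.real (s i) * μ.real (t i)|) atTop (𝓝 0) := by
      rw [← Finset.sum_const_zero (s := (Finset.univ : Finset ι))]
      exact tendsto_finsetSum _ fun i _ => tendsto_average_abs hT h (hs i) (ht i)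
    refine squeeze_zero' (Eventually.of_forall fun N => norm_nonneg _) ?_ h0
    filter_upwards [eventually_gt_atTop 0] with N hN
    have e : (N : ℝ)⁻¹ * ∑ k ∈ Finset.range N, ∏ i, μ.real (T^[k] ⁻¹' (s i) ∩ t i)
        - ∏ i, (μ.real (s i) * μ.real (t i)) = (N : ℝ)⁻¹ * ∑ k ∈ Finset.range N,
        (∏ i, μ.real (T^[k] ⁻¹' (s i) ∩ t i) - ∏ i, (μ.real (s i) * μ.real (t i))) := by
      simp only [Finset.sum_sub_distrib, Finset.sum_const, Finset.card_range, nsmul_eq_mul]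
      field_simp
    rw [e, Real.norm_eq_abs, abs_mul, abs_of_nonneg (by positivity : (0:ℝ) ≤ (N:ℝ)⁻¹),
      ← Finset.mul_sum]
    gcongr
    rw [Finset.sum_comm]
    refine (Finset.abs_sum_le_sum_abs _ _).trans (Finset.sum_le_sum fun k _ => ?_)
    refine abs_prod_sub_prod_le _ _ _ (fun i => ?_) (fun i => ?_)
    · rw [abs_of_nonneg measureReal_nonneg]; exact measureReal_le_one
    · rw [abs_of_nonneg (by positivity)]
      exact mul_le_one₀ measureReal_le_one measureReal_nonneg measureReal_le_one
  have gen : ∀ s : ι → Set α, (∀ i, MeasurableSet (s i)) → ∀ Q : Set (ι → α), MeasurableSet Q →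
      Tendsto (fun N : ℕ => (N : ℝ)⁻¹ * ∑ k ∈ Finset.range N,
        ν.real (G^[k] ⁻¹' (univ.pi s) ∩ Q)) atTop (𝓝 (ν.real (univ.pi s) * ν.real Q)) := by
    intro s hs Q hQ
    have hPm : MeasurableSet (univ.pi s) := MeasurableSet.univ_pi hs
    have hGk : ∀ k, MeasurableSet (G^[k] ⁻¹' (univ.pi s)) := fun k =>
      (hmp.measurable.iterate k) hPm
    have tot : Tendsto (fun N : ℕ => (N : ℝ)⁻¹ * ∑ k ∈ Finset.range N,
        ν.real (G^[k] ⁻¹' (univ.pi s))) atTop (𝓝 (ν.real (univ.pi s))) := by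
      refine tendsto_const_nhds.congr' ?_
      filter_upwards [eventually_gt_atTop 0] with N hN
      have : ∀ k, ν.real (G^[k] ⁻¹' (univ.pi s)) = ν.real (univ.pi s) := fun k =>
        (hmp.iterate k).measureReal_preimage hPm.nullMeasurableSet
      simp only [this, Finset.sum_const, Finset.card_range, nsmul_eq_mul]
      field_simp
    refine MeasurableSpace.induction_on_inter (C := fun Q _ => Tendsto (fun N : ℕ => (N : ℝ)⁻¹ *
        ∑ k ∈ Finset.range N, ν.real (G^[k] ⁻¹' (univ.pi s) ∩ Q)) atTop
        (𝓝 (ν.real (univ.pi s) * ν.real Q))) generateFrom_pi.symm isPiSystem_pi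
        ?_ ?_ ?_ ?_ Q hQ
    · simp
    · intro t ht
      obtain ⟨t, ht, rfl⟩ := ht
      exact box s t hs (fun i => ht i (mem_univ i))
    · intro t ht ih
      have := tot.sub ih
      rw [show ν.real (univ.pi s) - ν.real (univ.pi s) * ν.real t =
        ν.real (univ.pi s) * ν.real tᶜ by rw [probReal_compl_eq_one_sub ht]; ring] at this
      refine this.congr fun N => ?_
      rw [← mul_sub, ← Finset.sum_sub_distrib]
      congr 1
      refine Finset.sum_congr rfl fun k _ => ?_
      rw [← measureReal_inter_add_sdiff (s := G^[k] ⁻¹' (univ.pi s)) ht, sdiff_eq]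
      ring
    · intro f hd hf ih
      have hs1 : HasSum (fun j => ν.real (f j)) (ν.real (⋃ j, f j)) := by
        have := measure_iUnion hd hf (μ := ν)
        have h2 : ∑' j, ν (f j) ≠ ⊤ := by rw [← this]; exact measure_ne_top _ _
        rw [Measure.real, this, ENNReal.tsum_toReal_eq fun j => measure_ne_top _ _]
        exact ENNReal.hasSum_toReal h2
      have hs2 : ∀ k, HasSum (fun j => ν.real (G^[k] ⁻¹' (univ.pi s) ∩ f j))
          (ν.real (G^[k] ⁻¹' (univ.pi s) ∩ ⋃ j, f j)) := by
        intro k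
        rw [inter_iUnion]
        have := measure_iUnion (μ := ν) (f := fun j => G^[k] ⁻¹' (univ.pi s) ∩ f j)
          (fun i j hij => (hd hij).mono inter_subset_right inter_subset_right)
          (fun j => (hGk k).inter (hf j))
        have h2 : ∑' j, ν (G^[k] ⁻¹' (univ.pi s) ∩ f j) ≠ ⊤ := by
          rw [← this]; exact measure_ne_top _ _
        rw [Measure.real, this, ENNReal.tsum_toReal_eq fun j => measure_ne_top _ _]
        exact ENNReal.hasSum_toReal h2
      have := tendsto_tsum_of_dominated_convergence (𝓕 := atTop)
        (f := fun (N : ℕ) (j : ℕ) => (N : ℝ)⁻¹ * ∑ k ∈ Finset.range N,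
          ν.real (G^[k] ⁻¹' (univ.pi s) ∩ f j)) hs1.summable ih ?_
      · rw [tsum_mul_left, hs1.tsum_eq] at this
        refine this.congr fun N => ?_
        exact ((hasSum_sum fun k _ => hs2 k).mul_left _).tsum_eq
      · refine Eventually.of_forall fun N j => ?_
        rw [Real.norm_eq_abs, abs_of_nonneg (by positivity)]
        calc (N : ℝ)⁻¹ * ∑ k ∈ Finset.range N, ν.real (G^[k] ⁻¹' (univ.pi s) ∩ f j)
            ≤ (N : ℝ)⁻¹ * ∑ k ∈ Finset.range N, ν.real (f j) := by
              gcongr; exacts [measure_ne_top _ _, inter_subset_right]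
          _ ≤ ν.real (f j) := by
              rw [Finset.sum_const, Finset.card_range, nsmul_eq_mul, ← mul_assoc]
              refine mul_le_of_le_one_left measureReal_nonneg ?_
              rw [inv_mul_eq_div]; exact div_self_le_one _
  refine ⟨hmp, ⟨fun E hEm hEG => ?_⟩⟩
  have hinv : ∀ k, G^[k] ⁻¹' E = E := by
    intro k
    induction k with
    | zero => rfl
    | succ k ih => rw [Function.iterate_succ, preimage_comp, ih, hEG]
  have hPE : ∀ s : ι → Set α, (∀ i, MeasurableSet (s i)) →
      ν.real (univ.pi s ∩ E) = ν.real (univ.pi s) * ν.real E := by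
    intro s hs
    refine tendsto_nhds_unique ?_ (gen s hs E hEm)
    refine tendsto_const_nhds.congr' ?_
    filter_upwards [eventually_gt_atTop 0] with N hN
    have : ∀ k, ν.real (G^[k] ⁻¹' (univ.pi s) ∩ E) = ν.real (univ.pi s ∩ E) := by
      intro k
      conv_lhs => rw [← hinv k, ← preimage_inter]
      exact (hmp.iterate k).measureReal_preimage
        ((MeasurableSet.univ_pi hs).inter hEm).nullMeasurableSet
    simp only [this, Finset.sum_const, Finset.card_range, nsmul_eq_mul]
    field_simp
  rw [eventuallyConst_set']
  by_cases h0 : ν E = 0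
  · left; rwa [ae_eq_empty]
  right
  have hpi : Measure.pi (fun _ : ι => μ) = (ν E)⁻¹ • ν.restrict E := by
    refine Measure.pi_eq fun s hs => ?_
    rw [Measure.smul_apply, Measure.restrict_apply (MeasurableSet.univ_pi hs), smul_eq_mul]
    have := hPE s hs
    have h2 : ν (univ.pi s ∩ E) = ν (univ.pi s) * ν E := by
      rw [← ENNReal.toReal_eq_toReal_iff' (measure_ne_top _ _)
        (ENNReal.mul_ne_top (measure_ne_top _ _) (measure_ne_top _ _)), ENNReal.toReal_mul]
      exact this
    rw [h2, mul_comm (ν _), ← mul_assoc, ENNReal.inv_mul_cancel h0 (measure_ne_top _ _), one_mul,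
      hν, Measure.pi_pi]
  rw [ae_eq_univ]
  have : ν Eᶜ = ((ν E)⁻¹ • ν.restrict E) Eᶜ := by rw [← hpi]
  rw [this, Measure.smul_apply, Measure.restrict_apply hEm.compl]; simp

end WeakMixing

section Stabilizer

set_option linter.unusedSectionVars false

variable {V : Type*} [NormedAddCommGroup V] [NormedSpace ℝ V] [FiniteDimensional ℝ V]
  [MeasurableSpace V] [BorelSpace V] {μ : Measure V} [μ.IsAddHaarMeasure]

/-- Translations preserving a set up to a null set. -/
def stab (μ : Measure V) (S : Set V) : Set V := {t | ∀ᵐ r ∂μ, (r + t ∈ S ↔ r ∈ S)}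

/-- The measure, inside a ball, of the set of points distinguishing `S` from a translate. -/
noncomputable def defect (μ : Measure V) (S : Set V) (N : ℕ) (t : V) : ℝ≥0∞ :=
  μ (closedBall 0 N ∩ {r | ¬ (r + t ∈ S ↔ r ∈ S)})

lemma defect_mono (S : Set V) {N N' : ℕ} (h : N ≤ N') (t : V) :
    defect μ S N t ≤ defect μ S N' t :=
  measure_mono (inter_subset_inter_left _ (closedBall_subset_closedBall (by exact_mod_cast h)))

lemma mem_stab_iff (S : Set V) (t : V) : t ∈ stab μ S ↔ ∀ N, defect μ S N t = 0 := by
  constructor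
  · intro h N
    exact measure_mono_null inter_subset_right h
  · intro h
    refine measure_mono_null ?_ (measure_iUnion_null h)
    intro r hr
    obtain ⟨N, hN⟩ := exists_nat_ge ‖r‖
    exact mem_iUnion.2 ⟨N, by simpa using hN, hr⟩

lemma zero_mem_stab (S : Set V) : (0 : V) ∈ stab μ S := by simp [stab]

lemma add_mem_stab {S : Set V} {s t : V} (hs : s ∈ stab μ S) (ht : t ∈ stab μ S) :
    s + t ∈ stab μ S := by
  have h1 := (measurePreserving_add_right μ s).quasiMeasurePreserving.ae ht
  change ∀ᵐ r ∂μ, _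
  filter_upwards [h1, hs] with r h1 h2
  rw [← add_assoc, h1, h2]

lemma neg_mem_stab {S : Set V} {s : V} (hs : s ∈ stab μ S) : -s ∈ stab μ S := by
  have h1 := (measurePreserving_add_right μ (-s)).quasiMeasurePreserving.ae hs
  filter_upwards [h1] with r h1
  simpa using h1.symm

lemma stab_translate (S S' : Set V) (c : V) (h : ∀ r, r ∈ S ↔ r + c ∈ S') :
    stab μ S = stab μ S' := by
  ext t
  constructor
  · intro ht
    have h1 := (measurePreserving_add_right μ (-c)).quasiMeasurePreserving.ae ht
    filter_upwards [h1] with r h1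
    rw [h, h] at h1
    convert h1 using 2 <;> abel
  · intro ht
    have h1 := (measurePreserving_add_right μ c).quasiMeasurePreserving.ae ht
    filter_upwards [h1] with r h1
    rw [h, h, ← h1, add_right_comm]

lemma continuous_defect {S : Set V} (hS : MeasurableSet S) (N : ℕ) :
    Continuous (defect μ S N) := by
  have hfin : ∀ t, defect μ S N t ≠ ∞ := fun t =>
    ((measure_mono inter_subset_left).trans_lt measure_closedBall_lt_top).ne
  have key : Continuous fun t => (defect μ S N t).toReal := by
    rw [continuous_iff_continuousAt]
    intro s
    set S' := S ∩ closedBall 0 (N + ‖s‖ + 1)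
    have hS' : μ S' ≠ ∞ := ((measure_mono inter_subset_right).trans_lt measure_closedBall_lt_top).ne
    have hT : Tendsto (fun t : V => (⟨fun r => r + t, by fun_prop⟩ : C(V, V))) (𝓝 s)
        (𝓝 ⟨fun r => r + s, by fun_prop⟩) := by
      have : Continuous fun t : V => (⟨fun r => r + t, by fun_prop⟩ : C(V, V)) :=
        ContinuousMap.continuous_of_continuous_uncurry _ (by
          simp only [Function.uncurry_def, ContinuousMap.coe_mk]; fun_prop)
      exact this.tendsto s
    have h0 := tendsto_measure_symmDiff_preimage_nhds_zero hT
      (Eventually.of_forall fun t => measurePreserving_add_right μ t)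
      (measurePreserving_add_right μ s)
      (hS.inter measurableSet_closedBall : MeasurableSet S').nullMeasurableSet hS'
    have h1 := (ENNReal.tendsto_toReal ENNReal.zero_ne_top).comp h0
    rw [ENNReal.toReal_zero] at h1
    rw [ContinuousAt, tendsto_iff_norm_sub_tendsto_zero]
    refine squeeze_zero' (Eventually.of_forall fun _ => norm_nonneg _) ?_ h1
    filter_upwards [ball_mem_nhds s one_pos,
      h0.eventually (gt_mem_nhds ENNReal.zero_lt_top)] with t ht hlt
    set e := μ (symmDiff ((fun r => r + t) ⁻¹' S') ((fun r => r + s) ⁻¹' S')) with he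
    have hts : ‖t‖ ≤ ‖s‖ + 1 := by
      have := norm_le_norm_add_norm_sub' t s
      rw [mem_ball, dist_eq_norm] at ht
      linarith
    have hmem : ∀ r ∈ closedBall (0:V) N, ∀ u : V, ‖u‖ ≤ ‖s‖ + 1 → (r + u ∈ S ↔ r + u ∈ S') := by
      intro r hr u hu
      have : r + u ∈ closedBall (0:V) (N + ‖s‖ + 1) := by
        rw [mem_closedBall_zero_iff] at hr ⊢
        linarith [norm_add_le r u]
      simp [S', this]
    have sub : ∀ u v : V, ‖u‖ ≤ ‖s‖ + 1 → ‖v‖ ≤ ‖s‖ + 1 → defect μ S N u ≤ defect μ S N v +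
        μ (symmDiff ((fun r => r + u) ⁻¹' S') ((fun r => r + v) ⁻¹' S')) := by
      intro u v hu hv
      refine (measure_mono ?_).trans (measure_union_le _ _)
      rintro r ⟨hr, hr2⟩
      by_cases hc : (r + v ∈ S ↔ r ∈ S)
      · right
        simp only [mem_ofPred_eq] at hr2
        rw [mem_symmDiff, mem_preimage, mem_preimage, ← hmem r hr u hu, ← hmem r hr v hv]
        tauto
      · left; exact ⟨hr, hc⟩
    have a1 := sub t s hts (by linarith)
    have a2 := sub s t (by linarith) hts
    rw [symmDiff_comm] at a2
    have hlt' : e ≠ ∞ := hlt.ne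
    have b1 := ENNReal.toReal_mono (ENNReal.add_ne_top.2 ⟨hfin _, hlt'⟩) a1
    have b2 := ENNReal.toReal_mono (ENNReal.add_ne_top.2 ⟨hfin _, hlt'⟩) a2
    rw [ENNReal.toReal_add (hfin _) hlt'] at b1 b2
    rw [Real.norm_eq_abs, abs_le]
    change _ ≤ _ ∧ _ ≤ e.toReal
    constructor
    · change -e.toReal ≤ _
      linarith
    · linarith
  have : defect μ S N = fun t => ENNReal.ofReal (defect μ S N t).toReal :=
    funext fun t => (ENNReal.ofReal_toReal (hfin t)).symm
  rw [this]
  exact ENNReal.continuous_ofReal.comp key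

lemma isClosed_stab {S : Set V} (hS : MeasurableSet S) : IsClosed (stab μ S) := by
  have : stab μ S = ⋂ N, (defect μ S N) ⁻¹' {0} := by
    ext t; simp [mem_stab_iff]
  rw [this]
  exact isClosed_iInter fun N => isClosed_singleton.preimage (continuous_defect hS N)

lemma exists_le_defect {S M : Set V} (hS : MeasurableSet S) (hM : IsCompact M)
    (h : ∀ t ∈ M, t ∉ stab μ S) : ∃ N : ℕ, ∀ t ∈ M, ((N : ℝ≥0∞) + 1)⁻¹ ≤ defect μ S N t := by
  have hinv : ∀ {N N' : ℕ}, N ≤ N' → ((N' : ℝ≥0∞) + 1)⁻¹ ≤ ((N : ℝ≥0∞) + 1)⁻¹ := by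
    intro N N' hN
    apply ENNReal.inv_le_inv.2; gcongr
  obtain ⟨N, hN⟩ := hM.elim_directed_cover
    (fun N : ℕ => {t | ((N : ℝ≥0∞) + 1)⁻¹ < defect μ S N t})
    (fun N => isOpen_lt continuous_const (continuous_defect hS N))
    (fun t ht => by
      have h1 := h t ht
      rw [mem_stab_iff] at h1
      push Not at h1
      obtain ⟨N, hN⟩ := h1
      obtain ⟨k, hk⟩ := ENNReal.exists_inv_nat_lt hN
      refine mem_iUnion.2 ⟨max N k, ?_⟩
      calc ((max N k : ℕ) + 1 : ℝ≥0∞)⁻¹ ≤ (k : ℝ≥0∞)⁻¹ := by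
            apply ENNReal.inv_le_inv.2
            refine le_trans ?_ (le_self_add)
            exact_mod_cast le_max_right N k
        _ < defect μ S N t := hk
        _ ≤ _ := defect_mono S (le_max_left _ _) t)
    (directed_of_isDirected_le fun N N' hN t ht =>
      lt_of_lt_of_le (lt_of_le_of_lt (hinv hN) ht) (defect_mono S hN t))
  exact ⟨N, fun t ht => (hN ht).le⟩

lemma stab_eq_univ {S : Set V} (hS : MeasurableSet S) (h : μ (stab μ S) ≠ 0) :
    stab μ S = univ := by
  have h0 : stab μ S ∈ 𝓝 (0:V) := by
    have := Measure.sub_mem_nhds_zero_of_addHaar_pos μ (stab μ S) (isClosed_stab hS).measurableSet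
      (pos_iff_ne_zero.2 h)
    refine mem_of_superset this ?_
    rintro _ ⟨x, hx, y, hy, rfl⟩
    simpa [sub_eq_add_neg] using add_mem_stab hx (neg_mem_stab hy)
  refine eq_univ_of_forall fun t => ?_
  have h1 : Tendsto (fun k : ℕ => ((k : ℝ) + 1)⁻¹ • t) atTop (𝓝 0) := by
    have := (tendsto_one_div_add_atTop_nhds_zero_nat (𝕜 := ℝ)).smul_const t
    simpa using this
  obtain ⟨k, hk⟩ := (h1.eventually h0).exists
  have h2 : ∀ m : ℕ, (m : ℝ) • (((k : ℝ) + 1)⁻¹ • t) ∈ stab μ S := by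
    intro m
    induction m with
    | zero => simpa using zero_mem_stab S
    | succ m ih =>
      rw [Nat.cast_succ, add_smul, one_smul]
      exact add_mem_stab ih hk
  have h3 := h2 (k + 1)
  rwa [smul_smul, Nat.cast_succ, mul_inv_cancel₀ (by positivity), one_smul] at h3

lemma null_or_conull_of_stab {S : Set V} (hS : MeasurableSet S) (h : stab μ S = univ) :
    μ S = 0 ∨ μ Sᶜ = 0 := by
  have := ErgodicVAdd.aeconst_of_forall_preimage_vadd_ae_eq (G := V) (α := V) (μ := μ) hS (by
    intro t
    have ht : t ∈ stab μ S := h ▸ mem_univ t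
    rw [eventuallyEq_set]
    filter_upwards [ht] with r hr
    rw [← hr, mem_preimage, vadd_eq_add, add_comm])
  rw [eventuallyConst_set'] at this
  rcases this with h | h
  · left; rwa [ae_eq_empty] at h
  · right; rwa [ae_eq_univ] at h

end Stabilizer

section Skew

set_option linter.unusedSectionVars false

variable {ι : Type*} [Fintype ι]

local notation "V" => ι → ℝ

lemma mem_section_iterate {G F : V → V} {E : Set (V × V)}
    (hE : (fun p : V × V => (G p.1, p.2 + F p.1)) ⁻¹' E = E) (h : ℕ) (x r : V) :
    (x, r) ∈ E ↔ (G^[h] x, r + birkhoffSum G F h x) ∈ E := by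
  have h1 : ∀ x r, (x, r) ∈ E ↔ (G x, r + F x) ∈ E := fun x r => by
    conv_lhs => rw [← hE]
    rfl
  induction h with
  | zero => simp
  | succ h ih =>
    refine ih.trans ?_
    rw [h1, birkhoffSum_succ, Function.iterate_succ_apply', add_assoc]

/-- The displacement lemma: if `G^h` is close to the identity on `D` and the cocycle is bounded
there, then the fibres of an invariant set are almost invariant under translation by the cocycle. -/
lemma exists_lintegral_defect_le {ν : Measure V} [IsProbabilityMeasure ν] {G F : V → V}
    (hG : MeasurePreserving G ν ν) {E : Set (V × V)} (hEm : MeasurableSet E)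
    (hE : (fun p : V × V => (G p.1, p.2 + F p.1)) ⁻¹' E = E) (C : ℝ) (N : ℕ) {η : ℝ≥0∞}
    (hη : η ≠ 0) : ∃ δ > 0, ∀ (h : ℕ) (D : Set V), MeasurableSet D →
      (∀ x ∈ D, dist (G^[h] x) x ≤ δ ∧ ‖birkhoffSum G F h x‖ ≤ C) →
      ∫⁻ x in D, defect volume (Prod.mk x ⁻¹' E) N (birkhoffSum G F h x) ∂ν ≤ η := by
  set B : Set V := closedBall 0 (N + C)
  have hB : MeasurableSet B := measurableSet_closedBall
  have hBfin : volume B ≠ ∞ := measure_closedBall_lt_top.ne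
  have : IsFiniteMeasure (volume.restrict B : Measure V) :=
    ⟨by rw [Measure.restrict_apply_univ]; exact hBfin.lt_top⟩
  set f : V × V → ℝ := E.indicator 1
  have hfm : Measurable f := measurable_one.indicator hEm
  have hfi : Integrable f (ν.prod (volume.restrict B)) := (integrable_const 1).indicator hEm
  have hη3 : η / 3 ≠ 0 := by simp [hη]
  obtain ⟨g, hgc, hgi, hgcont, -⟩ := hfi.exists_hasCompactSupport_lintegral_sub_le hη3
  have hgu : UniformContinuous g :=
    hgc.uniformContinuous_of_continuous hgcont
  set Θ : V → ℝ≥0∞ := fun x => ∫⁻ p in B, ‖f (x, p) - g (x, p)‖ₑ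
  have hΘm : Measurable Θ := by
    refine Measurable.lintegral_prod_right' (f := fun z : V × V => ‖f z - g z‖ₑ) ?_
    exact (hfm.sub hgcont.measurable).enorm
  have hΘi : ∫⁻ x, Θ x ∂ν ≤ η / 3 := by
    rw [← lintegral_prod (fun z : V × V => ‖f z - g z‖ₑ)
      (hfm.sub hgcont.measurable).enorm.aemeasurable]
    exact hgi
  obtain ⟨e, he0, heB⟩ : ∃ e : ℝ, 0 < e ∧ ENNReal.ofReal e * volume B ≤ η / 3 := by
    have h1 : Tendsto (fun e : ℝ => ENNReal.ofReal e * volume B) (𝓝[>] 0) (𝓝 0) := by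
      have : Tendsto (fun e : ℝ => ENNReal.ofReal e * volume B) (𝓝 0)
        (𝓝 (ENNReal.ofReal 0 * volume B)) :=
        ENNReal.Tendsto.mul_const (ENNReal.continuous_ofReal.tendsto 0) (Or.inr hBfin)
      rw [ENNReal.ofReal_zero, zero_mul] at this
      exact this.mono_left nhdsWithin_le_nhds
    obtain ⟨e, h2, h3⟩ := ((h1.eventually (ge_mem_nhds (pos_iff_ne_zero.2 hη3))).and
      self_mem_nhdsWithin).exists
    exact ⟨e, h3, h2⟩
  obtain ⟨δ, hδ, hgδ⟩ := Metric.uniformContinuous_iff.1 hgu e he0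
  refine ⟨δ / 2, half_pos hδ, fun h D hD hprop => ?_⟩
  have main : ∀ x ∈ D, defect volume (Prod.mk x ⁻¹' E) N (birkhoffSum G F h x) ≤
      Θ x + ENNReal.ofReal e * volume B + Θ (G^[h] x) := by
    intro x hx
    obtain ⟨hd, hC⟩ := hprop x hx
    set y := G^[h] x
    set t := birkhoffSum G F h x
    set A : Set V := B ∩ {p | ¬ ((x, p) ∈ E ↔ (y, p) ∈ E)}
    have hAm : MeasurableSet {p : V | ¬ ((x, p) ∈ E ↔ (y, p) ∈ E)} := by
      have m1 : MeasurableSet {p : V | (x, p) ∈ E} := measurable_prodMk_left hEm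
      have m2 : MeasurableSet {p : V | (y, p) ∈ E} := measurable_prodMk_left hEm
      exact (m1.iff m2).compl
    calc defect volume (Prod.mk x ⁻¹' E) N t ≤ volume ((fun r => r + t) ⁻¹' A) := by
          refine measure_mono ?_
          rintro r ⟨hr, hr2⟩
          refine ⟨?_, ?_⟩
          · rw [mem_closedBall_zero_iff] at hr ⊢
            linarith [norm_add_le r t]
          · simp only [mem_ofPred_eq, mem_preimage] at hr2 ⊢
            rwa [← mem_section_iterate hE h x r]
      _ = volume A := measure_preimage_add_right _ _ _
      _ = ∫⁻ p in B, {p | ¬ ((x, p) ∈ E ↔ (y, p) ∈ E)}.indicator 1 p := by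
          rw [lintegral_indicator_one hAm, Measure.restrict_apply hAm, inter_comm]
      _ ≤ ∫⁻ p in B, (‖f (x, p) - g (x, p)‖ₑ + ENNReal.ofReal e + ‖f (y, p) - g (y, p)‖ₑ) := by
          refine lintegral_mono fun p => ?_
          have hg : ‖g (x, p) - g (y, p)‖ₑ ≤ ENNReal.ofReal e := by
            rw [← ofReal_norm, ← dist_eq_norm]
            refine ENNReal.ofReal_le_ofReal (hgδ ?_).le
            rw [dist_comm] at hd
            rw [Prod.dist_eq, dist_self, max_eq_left dist_nonneg]
            linarith
          have h2 : {p | ¬ ((x, p) ∈ E ↔ (y, p) ∈ E)}.indicator (1 : V → ℝ≥0∞) p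
              ≤ ‖f (x, p) - f (y, p)‖ₑ := by
            by_cases h1 : (x, p) ∈ E <;> by_cases h2 : (y, p) ∈ E <;> simp [f, indicator, h1, h2]
          have h3 : f (x, p) - f (y, p) = (f (x, p) - g (x, p)) + (g (x, p) - g (y, p)) -
            (f (y, p) - g (y, p)) := by ring
          refine h2.trans ?_
          rw [h3]
          refine (enorm_sub_le).trans ?_
          gcongr
          refine (enorm_add_le _ _).trans ?_
          gcongr
      _ = _ := by
          rw [lintegral_add_left, lintegral_add_right, lintegral_const,
            Measure.restrict_apply_univ]
          · exact measurable_const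
          · exact ((((hfm.sub hgcont.measurable).enorm).comp measurable_prodMk_left).add
              measurable_const)
  calc ∫⁻ x in D, defect volume (Prod.mk x ⁻¹' E) N (birkhoffSum G F h x) ∂ν
      ≤ ∫⁻ x in D, (Θ x + ENNReal.ofReal e * volume B + Θ (G^[h] x)) ∂ν :=
        setLIntegral_mono' hD main
    _ ≤ ∫⁻ x, (Θ x + ENNReal.ofReal e * volume B + Θ (G^[h] x)) ∂ν := setLIntegral_le_lintegral _ _
    _ = ∫⁻ x, Θ x ∂ν + ENNReal.ofReal e * volume B + ∫⁻ x, Θ (G^[h] x) ∂ν := by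
        rw [lintegral_add_left (hΘm.add_const _), lintegral_add_left hΘm, lintegral_const,
          measure_univ, mul_one]
    _ = ∫⁻ x, Θ x ∂ν + ENNReal.ofReal e * volume B + ∫⁻ x, Θ x ∂ν := by
        rw [(hG.iterate h).lintegral_comp hΘm]
    _ ≤ η / 3 + η / 3 + η / 3 := by gcongr
    _ = η := ENNReal.add_thirds η

lemma measurable_defect_section {E : Set (V × V)} (hEm : MeasurableSet E) (N : ℕ) {t : V → V}
    (ht : Measurable t) :
    Measurable fun x => defect volume (Prod.mk x ⁻¹' E) N (t x) := by
  have hm : MeasurableSet {z : V × V | z.2 ∈ closedBall (0 : V) N ∧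
      ¬ ((z.1, z.2 + t z.1) ∈ E ↔ z ∈ E)} := by
    refine (measurable_snd measurableSet_closedBall).inter ?_
    have m1 : MeasurableSet {z : V × V | (z.1, z.2 + t z.1) ∈ E} :=
      (measurable_fst.prodMk (measurable_snd.add (ht.comp measurable_fst))) hEm
    exact (m1.iff hEm).compl
  exact measurable_measure_prodMk_left hm

/-- For compact `M`, the set of points whose fibre has no stabiliser in `M` is an increasing
union of measurable sets on which the defect is bounded below. -/
lemma exists_measurable_exhaustion {E : Set (V × V)} (hEm : MeasurableSet E) {M : Set V}
    (hM : IsCompact M) : ∃ A : ℕ → Set V, Monotone A ∧ (∀ N, MeasurableSet (A N)) ∧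
      (∀ N, ∀ x ∈ A N, ∀ t ∈ M, ((N : ℝ≥0∞) + 1)⁻¹ ≤ defect volume (Prod.mk x ⁻¹' E) N t) ∧
      ⋃ N, A N = {x | ∀ t ∈ M, t ∉ stab volume (Prod.mk x ⁻¹' E)} := by
  refine ⟨fun N => {x | ∀ t ∈ M, ((N : ℝ≥0∞) + 1)⁻¹ ≤ defect volume (Prod.mk x ⁻¹' E) N t},
    ?_, ?_, fun N x hx => hx, ?_⟩
  · intro N N' h x hx t ht
    refine le_trans ?_ ((hx t ht).trans (defect_mono _ h t))
    apply ENNReal.inv_le_inv.2; gcongr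
  · intro N
    obtain ⟨Q, hQM, hQc, hQd⟩ :=
      (TopologicalSpace.IsSeparable.of_separableSpace M).exists_countable_dense_subset
    have : {x | ∀ t ∈ M, ((N : ℝ≥0∞) + 1)⁻¹ ≤ defect volume (Prod.mk x ⁻¹' E) N t} =
        ⋂ t ∈ Q, {x | ((N : ℝ≥0∞) + 1)⁻¹ ≤ defect volume (Prod.mk x ⁻¹' E) N t} := by
      ext x
      simp only [mem_iInter, mem_ofPred_eq]
      constructor
      · exact fun h t ht => h t (hQM ht)
      · intro h t ht
        have hc : IsClosed {t | ((N : ℝ≥0∞) + 1)⁻¹ ≤ defect volume (Prod.mk x ⁻¹' E) N t} :=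
          isClosed_le continuous_const (continuous_defect (measurable_prodMk_left hEm) N)
        exact closure_minimal h hc (hQd ht)
    change MeasurableSet {x | ∀ t ∈ M, ((N : ℝ≥0∞) + 1)⁻¹ ≤ defect volume (Prod.mk x ⁻¹' E) N t}
    rw [this]
    exact MeasurableSet.biInter hQc fun t _ => measurableSet_le measurable_const
      (measurable_defect_section hEm N measurable_const)
  · ext x
    simp only [mem_iUnion, mem_ofPred_eq]
    constructor
    · rintro ⟨N, hN⟩ t ht hst
      have := hN t ht
      rw [(mem_stab_iff _ _).1 hst N] at this
      simp at this
    · intro h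
      exact exists_le_defect (measurable_prodMk_left hEm) hM h


lemma exists_measure_mem_le {ν : Measure V} [IsProbabilityMeasure ν] {G F : V → V}
    (hG : MeasurePreserving G ν ν) (hF : Measurable F) {E : Set (V × V)} (hEm : MeasurableSet E)
    (hE : (fun p : V × V => (G p.1, p.2 + F p.1)) ⁻¹' E = E) (C : ℝ) {M : Set V}
    (hM : IsCompact M) (hMae : ∀ᵐ x ∂ν, ∀ t ∈ M, t ∉ stab volume (Prod.mk x ⁻¹' E)) {η : ℝ≥0∞}
    (hη : η ≠ 0) : ∃ δ > 0, ∀ (h : ℕ) (D : Set V), MeasurableSet D →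
      (∀ x ∈ D, dist (G^[h] x) x ≤ δ ∧ ‖birkhoffSum G F h x‖ ≤ C) →
      ν (D ∩ {x | birkhoffSum G F h x ∈ M}) ≤ η := by
  obtain ⟨A, hAmono, hAm, hA, hAU⟩ := exists_measurable_exhaustion hEm hM
  have hη2 : η / 2 ≠ 0 := by simp [hη]
  obtain ⟨N, hN⟩ : ∃ N, ν (A N)ᶜ ≤ η / 2 := by
    have h1 : Tendsto (fun N => ν (A N)ᶜ) atTop (𝓝 (ν (⋂ N, (A N)ᶜ))) :=
      tendsto_measure_iInter_atTop (fun N => (hAm N).compl.nullMeasurableSet)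
        (fun i j hij => compl_subset_compl.2 (hAmono hij)) ⟨0, measure_ne_top _ _⟩
    have h2 : ν (⋂ N, (A N)ᶜ) = 0 := by
      rw [← compl_iUnion, hAU]; exact hMae
    rw [h2] at h1
    exact (h1.eventually (ge_mem_nhds (pos_iff_ne_zero.2 hη2))).exists
  have hN0 : ((N : ℝ≥0∞) + 1)⁻¹ ≠ 0 := by simp
  have hNt : ((N : ℝ≥0∞) + 1)⁻¹ ≠ ∞ := by simp
  obtain ⟨δ, hδ, H⟩ := exists_lintegral_defect_le hG hEm hE C N
    (mul_ne_zero hN0 hη2 : ((N : ℝ≥0∞) + 1)⁻¹ * (η / 2) ≠ 0)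
  refine ⟨δ, hδ, fun h D hD hprop => ?_⟩
  have hFh : Measurable (birkhoffSum G F h) := by
    have : birkhoffSum G F h = fun x => ∑ k ∈ Finset.range h, F (G^[k] x) := rfl
    rw [this]
    exact Finset.measurable_fun_sum _ fun k _ => hF.comp (hG.measurable.iterate k)
  set ω := fun x => defect volume (Prod.mk x ⁻¹' E) N (birkhoffSum G F h x)
  have hωm : Measurable ω := measurable_defect_section hEm N hFh
  have h3 : ν (D ∩ {x | ((N : ℝ≥0∞) + 1)⁻¹ ≤ ω x}) ≤ η / 2 := by
    have h4 := mul_meas_ge_le_lintegral (μ := ν.restrict D) hωm ((N : ℝ≥0∞) + 1)⁻¹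
    have h5 := h4.trans (H h D hD hprop)
    rw [ENNReal.mul_le_mul_iff_right hN0 hNt,
      Measure.restrict_apply (measurableSet_le measurable_const hωm), inter_comm] at h5
    exact h5
  calc ν (D ∩ {x | birkhoffSum G F h x ∈ M})
      ≤ ν ((A N)ᶜ ∪ (D ∩ {x | ((N : ℝ≥0∞) + 1)⁻¹ ≤ ω x})) := by
        refine measure_mono ?_
        rintro x ⟨hxD, hxM⟩
        by_cases hx : x ∈ A N
        · exact Or.inr ⟨hxD, hA N x hx _ hxM⟩
        · exact Or.inl hx
    _ ≤ η / 2 + η / 2 := (measure_union_le _ _).trans (add_le_add hN h3)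
    _ = η := ENNReal.add_halves η

/-- An ergodicity criterion for skew products over a probability measure preserving map: there are
partial rigidity times along which the cocycle stays bounded while its distribution remains
uniformly absolutely continuous. -/
theorem ergodic_skew_of_partial_rigidity {ν : Measure V} [IsProbabilityMeasure ν] {G F : V → V}
    (hG : Ergodic G ν) (hF : Measurable F) {c : ℝ≥0∞} (hc : c ≠ 0) {C : ℝ} {K : ℝ≥0∞} (hK : K ≠ ∞)
    (H : ∀ ε > 0, ∃ (h : ℕ) (D : Set V), MeasurableSet D ∧ c ≤ ν D ∧
      (∀ x ∈ D, dist (G^[h] x) x ≤ ε ∧ ‖birkhoffSum G F h x‖ ≤ C) ∧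
      ∀ W, MeasurableSet W → ν (birkhoffSum G F h ⁻¹' W) ≤ K * volume W) :
    Ergodic (fun p : V × V => (G p.1, p.2 + F p.1)) (ν.prod volume) := by
  refine ⟨hG.toMeasurePreserving.skew_product (g := fun x r => r + F x)
    (measurable_snd.add (hF.comp measurable_fst))
    (Eventually.of_forall fun x => (measurePreserving_add_right volume (F x)).map_eq), ⟨?_⟩⟩
  intro E hEm hE
  have hsec : ∀ x, MeasurableSet (Prod.mk x ⁻¹' E) := fun x => measurable_prodMk_left hEm
  have hstabG : ∀ x, stab volume (Prod.mk x ⁻¹' E) = stab volume (Prod.mk (G x) ⁻¹' E) := by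
    intro x
    refine stab_translate _ _ (F x) fun r => ?_
    have := mem_section_iterate hE 1 x r
    simpa using this
  have zero_one : ∀ M : Set V, IsCompact M →
      (∀ᵐ x ∂ν, ∀ t ∈ M, t ∉ stab volume (Prod.mk x ⁻¹' E)) ∨
      (∀ᵐ x ∂ν, ¬ ∀ t ∈ M, t ∉ stab volume (Prod.mk x ⁻¹' E)) := by
    intro M hM
    obtain ⟨A, -, hAm, -, hAU⟩ := exists_measurable_exhaustion hEm hM
    have hm : MeasurableSet {x | ∀ t ∈ M, t ∉ stab volume (Prod.mk x ⁻¹' E)} :=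
      hAU ▸ MeasurableSet.iUnion hAm
    refine hG.toPreErgodic.ae_mem_or_ae_notMem hm ?_
    ext x
    change (∀ t ∈ M, t ∉ stab volume (Prod.mk (G x) ⁻¹' E)) ↔
      ∀ t ∈ M, t ∉ stab volume (Prod.mk x ⁻¹' E)
    rw [hstabG x]
  set ball : ℕ × ℕ → Set V := fun q =>
    closedBall (TopologicalSpace.denseSeq V q.1) (1 / ((q.2 : ℝ) + 1)) with hball
  have hballc : ∀ q, IsCompact (ball q) := fun q => isCompact_closedBall _ _
  have exists_ball : ∀ (t : V) (O : Set V), O ∈ 𝓝 t → ∃ q, ball q ∈ 𝓝 t ∧ ball q ⊆ O := by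
    intro t O hO
    obtain ⟨r, hr, hrO⟩ := Metric.mem_nhds_iff.1 hO
    obtain ⟨k, hk⟩ := exists_nat_one_div_lt (half_pos hr)
    have hk0 : (0 : ℝ) < 1 / ((k : ℝ) + 1) := by positivity
    obtain ⟨i, hi⟩ := (TopologicalSpace.denseRange_denseSeq V).exists_dist_lt t hk0
    refine ⟨(i, k), mem_of_superset (isOpen_ball.mem_nhds hi) ball_subset_closedBall, ?_⟩
    intro s hs
    apply hrO
    have hs' : dist s (TopologicalSpace.denseSeq V i) ≤ 1 / ((k : ℝ) + 1) := hs
    rw [mem_ball]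
    rw [dist_comm] at hi
    linarith [dist_triangle s (TopologicalSpace.denseSeq V i) t]
  -- a fibre which is generic for every ball of the family
  obtain ⟨x₀, hx₀⟩ : ∃ x₀, ∀ q, (∀ t ∈ ball q, t ∉ stab volume (Prod.mk x₀ ⁻¹' E)) ↔
      ∀ᵐ x ∂ν, ∀ t ∈ ball q, t ∉ stab volume (Prod.mk x ⁻¹' E) := by
    have : ∀ᵐ x₀ ∂ν, ∀ q, (∀ t ∈ ball q, t ∉ stab volume (Prod.mk x₀ ⁻¹' E)) ↔
        ∀ᵐ x ∂ν, ∀ t ∈ ball q, t ∉ stab volume (Prod.mk x ⁻¹' E) := by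
      rw [ae_all_iff]
      intro q
      rcases zero_one (ball q) (hballc q) with h | h
      · filter_upwards [h] with x hx
        exact ⟨fun _ => h, fun _ => hx⟩
      · filter_upwards [h] with x hx
        refine ⟨fun h' => absurd h' hx, fun h' => ?_⟩
        obtain ⟨y, hy1, hy2⟩ := (h.and h').exists
        exact absurd hy2 hy1
    exact this.exists
  have hZ : volume (stab volume (Prod.mk x₀ ⁻¹' E) : Set V) ≠ 0 := by
    intro h0
    set Z : Set V := stab volume (Prod.mk x₀ ⁻¹' E) with hZdef
    have hZc : IsClosed Z := isClosed_stab (hsec x₀)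
    obtain ⟨c', hc'0, hc'c, hc't⟩ : ∃ c' : ℝ≥0∞, c' ≠ 0 ∧ c' < c ∧ c' ≠ ∞ := by
      obtain ⟨c', h1, h2⟩ := exists_between (pos_iff_ne_zero.2 hc)
      exact ⟨c', h1.ne', h2, h2.ne_top⟩
    obtain ⟨O, hZO, hOo, hOv⟩ : ∃ O, Z ⊆ O ∧ IsOpen O ∧ K * volume O ≤ c' / 2 := by
      have hr : 0 < c' / 2 / (K + 1) :=
        ENNReal.div_pos (by simp [hc'0]) (by simp [hK])
      obtain ⟨O, h1, h2, h3⟩ := Z.exists_isOpen_lt_of_lt (μ := volume) _ (h0 ▸ hr)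
      refine ⟨O, h1, h2, ?_⟩
      calc K * volume O ≤ (K + 1) * (c' / 2 / (K + 1)) := by gcongr; exact le_self_add
        _ ≤ c' / 2 := ENNReal.mul_div_le
    have hcomp : IsCompact (closedBall (0:V) C \ O) := (isCompact_closedBall _ _).diff hOo
    obtain ⟨s, hs⟩ : ∃ s : Finset {q // ball q ⊆ Zᶜ}, closedBall (0:V) C \ O ⊆
        ⋃ q ∈ s, ball q := by
      obtain ⟨s, hs⟩ := hcomp.elim_finite_subcover (fun q : {q // ball q ⊆ Zᶜ} => interior (ball q))
        (fun _ => isOpen_interior) (fun t ht => by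
          obtain ⟨q, hq1, hq2⟩ := exists_ball t Zᶜ (hZc.isOpen_compl.mem_nhds
            fun h => ht.2 (hZO h))
          exact mem_iUnion.2 ⟨⟨q, hq2⟩, mem_interior_iff_mem_nhds.2 hq1⟩)
      exact ⟨s, hs.trans (iUnion₂_mono fun q _ => interior_subset)⟩
    set M : Set V := ⋃ q ∈ s, ball (q : ℕ × ℕ)
    have hMc : IsCompact M := s.isCompact_biUnion fun q _ => hballc q
    have hMae : ∀ᵐ x ∂ν, ∀ t ∈ M, t ∉ stab volume (Prod.mk x ⁻¹' E) := by
      have : ∀ᵐ x ∂ν, ∀ q : {q // ball q ⊆ Zᶜ}, ∀ t ∈ ball q,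
          t ∉ stab volume (Prod.mk x ⁻¹' E) := by
        rw [ae_all_iff]
        exact fun q => (hx₀ q).1 fun t ht => q.2 ht
      filter_upwards [this] with x hx t ht
      obtain ⟨q, -, hq⟩ := mem_iUnion₂.1 ht
      exact hx q t hq
    obtain ⟨δ, hδ, hsmall⟩ := exists_measure_mem_le hG.toMeasurePreserving hF hEm hE C hMc hMae
      (by simp [hc'0] : c' / 2 ≠ 0)
    obtain ⟨h, D, hD, hcD, hprop, hac⟩ := H δ hδ
    have : c ≤ c' := calc c ≤ ν D := hcD
      _ ≤ ν ((birkhoffSum G F h ⁻¹' O) ∪ (D ∩ {x | birkhoffSum G F h x ∈ M})) := by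
          refine measure_mono fun x hx => ?_
          by_cases hO : birkhoffSum G F h x ∈ O
          · exact Or.inl hO
          · exact Or.inr ⟨hx, hs ⟨by simpa using (hprop x hx).2, hO⟩⟩
      _ ≤ c' / 2 + c' / 2 := (measure_union_le _ _).trans
          (add_le_add ((hac O hOo.measurableSet).trans hOv) (hsmall h D hD hprop))
      _ = c' := ENNReal.add_halves c'
    exact absurd this (not_le.2 hc'c)
  have hZu := stab_eq_univ (hsec x₀) hZ
  have hae : ∀ᵐ x ∂ν, stab volume (Prod.mk x ⁻¹' E) = univ := by
    have h1 : ∀ᵐ x ∂ν, ∀ q, ¬ ∀ t ∈ ball q, t ∉ stab volume (Prod.mk x ⁻¹' E) := by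
      rw [ae_all_iff]
      intro q
      refine (zero_one (ball q) (hballc q)).resolve_left fun h => ?_
      refine (hx₀ q).2 h (TopologicalSpace.denseSeq V q.1) (mem_closedBall_self (by positivity)) ?_
      rw [hZu]; trivial
    filter_upwards [h1] with x hx
    have hcl : IsClosed (stab volume (Prod.mk x ⁻¹' E) : Set V) := isClosed_stab (hsec x)
    rw [← hcl.closure_eq]
    refine eq_univ_of_forall fun t => ?_
    rw [mem_closure_iff_nhds]
    intro O hO
    obtain ⟨q, -, hq⟩ := exists_ball t O hO
    have := hx q
    push Not at this
    obtain ⟨t', ht', ht''⟩ := this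
    exact ⟨t', hq ht', ht''⟩
  have hnull : ∀ᵐ x ∂ν, volume (Prod.mk x ⁻¹' E) = 0 ∨ volume (Prod.mk x ⁻¹' E)ᶜ = 0 :=
    hae.mono fun x hx => null_or_conull_of_stab (hsec x) hx
  have h01 := hG.toPreErgodic.ae_mem_or_ae_notMem (s := {x | volume (Prod.mk x ⁻¹' E) = 0})
    (measurable_measure_prodMk_left hEm (measurableSet_singleton 0)) (by
      ext x
      have : Prod.mk x ⁻¹' E = (fun r => r + F x) ⁻¹' (Prod.mk (G x) ⁻¹' E) := by
        ext r
        simpa using mem_section_iterate hE 1 x r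
      simp only [mem_preimage, mem_ofPred_eq]
      rw [this, measure_preimage_add_right])
  rw [eventuallyConst_set']
  rcases h01 with h | h
  · left
    rw [ae_eq_empty, Measure.measure_prod_null hEm]
    exact h
  · right
    rw [ae_eq_univ, Measure.measure_prod_null hEm.compl]
    filter_upwards [h, hnull] with x h1 h2
    exact h2.resolve_left h1

end Skew

section Powers

lemma pi_apply_le {ι : Type*} [Fintype ι] {σ : Measure ℝ} [SigmaFinite σ] {κ : ℝ≥0}
    (h : ∀ W, MeasurableSet W → σ W ≤ κ * volume W) {W : Set (ι → ℝ)} (hW : MeasurableSet W) :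
    Measure.pi (fun _ : ι => σ) W ≤ (κ : ℝ≥0∞) ^ Fintype.card ι * volume W := by
  have hle : σ ≤ κ • (volume : Measure ℝ) := by
    rw [Measure.le_iff]
    intro s hs
    rw [Measure.coe_nnreal_smul_apply]
    exact h s hs
  have h1 : Measure.pi (fun _ : ι => κ • (volume : Measure ℝ)) =
      (κ ^ Fintype.card ι : ℝ≥0) • (volume : Measure (ι → ℝ)) := by
    refine Measure.pi_eq fun s _ => ?_
    simp only [Measure.coe_nnreal_smul_apply, volume_pi_pi, Finset.prod_mul_distrib,
      Finset.prod_const, Finset.card_univ]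
    push_cast; rfl
  have h2 : (Measure.pi (fun _ : ι => σ)).toOuterMeasure ≤
      OuterMeasure.pi (fun _ : ι => (κ • (volume : Measure ℝ)).toOuterMeasure) := by
    rw [OuterMeasure.le_pi]
    intro s _
    change Measure.pi (fun _ : ι => σ) (univ.pi s) ≤ _
    rw [Measure.pi_pi]
    exact Finset.prod_le_prod' fun i _ => hle (s i)
  calc Measure.pi (fun _ : ι => σ) W ≤ OuterMeasure.pi
        (fun _ : ι => (κ • (volume : Measure ℝ)).toOuterMeasure) W := h2 W
    _ = Measure.pi (fun _ : ι => κ • (volume : Measure ℝ)) W := by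
      rw [Measure.pi_def, toMeasure_apply _ _ hW]
    _ = _ := by
      rw [h1, Measure.coe_nnreal_smul_apply]; push_cast; rfl

/-- The one-dimensional criterion for infinite ergodic index of a skew product. -/
theorem ergodic_pi_skew {lam : Measure ℝ} [IsProbabilityMeasure lam] {T f : ℝ → ℝ}
    (hT : Measurable T) (hf : Measurable f)
    (hWM : Ergodic (fun p : ℝ × ℝ => (T p.1, T p.2)) (lam.prod lam))
    {c : ℝ≥0∞} (hc : c ≠ 0) {C : ℝ} (hC : 0 ≤ C) {κ : ℝ≥0}
    (H : ∀ ε > 0, ∃ (h : ℕ) (D : Set ℝ), MeasurableSet D ∧ c ≤ lam D ∧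
      (∀ x ∈ D, |T^[h] x - x| ≤ ε ∧ |birkhoffSum T f h x| ≤ C) ∧
      ∀ W, MeasurableSet W → lam (birkhoffSum T f h ⁻¹' W) ≤ κ * volume W) (n : ℕ) :
    Ergodic (fun p : Fin n → ℝ × ℝ => fun i => (T (p i).1, (p i).2 + f (p i).1))
      (Measure.pi fun _ : Fin n => lam.prod (volume : Measure ℝ)) := by
  set ν : Measure (Fin n → ℝ) := Measure.pi fun _ => lam
  set G : (Fin n → ℝ) → (Fin n → ℝ) := fun x i => T (x i)
  set F : (Fin n → ℝ) → (Fin n → ℝ) := fun x i => f (x i)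
  have hG : Ergodic G ν := ergodic_pi_of_ergodic_prod hT hWM
  have hF : Measurable F := measurable_pi_lambda _ fun i => hf.comp (measurable_pi_apply i)
  have hit : ∀ k : ℕ, ∀ x i, G^[k] x i = T^[k] (x i) := by
    intro k x i
    induction k with
    | zero => rfl
    | succ k ih => simp only [Function.iterate_succ_apply', G, ih]
  have hbs : ∀ k : ℕ, ∀ x i, birkhoffSum G F k x i = birkhoffSum T f k (x i) := by
    intro k x i
    simp only [birkhoffSum, Finset.sum_apply, F, hit]
  have main : Ergodic (fun p : (Fin n → ℝ) × (Fin n → ℝ) => (G p.1, p.2 + F p.1))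
      (ν.prod volume) := by
    refine ergodic_skew_of_partial_rigidity hG hF (c := c ^ n) (pow_ne_zero _ hc) (C := C)
      (K := (κ : ℝ≥0∞) ^ n) (ENNReal.pow_ne_top ENNReal.coe_ne_top) fun ε hε => ?_
    obtain ⟨h, D, hD, hcD, hprop, hac⟩ := H ε hε
    refine ⟨h, univ.pi fun _ => D, MeasurableSet.univ_pi fun _ => hD, ?_, ?_, ?_⟩
    · rw [Measure.pi_pi]
      simp only [Finset.prod_const, Finset.card_univ, Fintype.card_fin]
      gcongr
    · intro x hx
      constructor
      · rw [dist_pi_le_iff hε.le]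
        intro i
        rw [hit, Real.dist_eq]
        exact (hprop _ (hx i trivial)).1
      · rw [pi_norm_le_iff_of_nonneg hC]
        intro i
        rw [hbs]
        exact (hprop _ (hx i trivial)).2
    · intro W hW
      have hfm : Measurable (birkhoffSum T f h) := by
        have : birkhoffSum T f h = fun x => ∑ k ∈ Finset.range h, f (T^[k] x) := rfl
        rw [this]
        exact Finset.measurable_fun_sum _ fun k _ => hf.comp (hT.iterate k)
      have : IsProbabilityMeasure (lam.map (birkhoffSum T f h)) :=
        Measure.isProbabilityMeasure_map hfm.aemeasurable
      have e : birkhoffSum G F h = fun x i => birkhoffSum T f h (x i) := by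
        ext x i; exact hbs h x i
      have hmap : ν.map (birkhoffSum G F h) = Measure.pi fun _ => lam.map (birkhoffSum T f h) := by
        rw [e]
        exact Measure.pi_map_pi (μ := fun _ : Fin n => lam)
          (f := fun _ : Fin n => birkhoffSum T f h) (hμ := fun _ => inferInstance)
          fun _ => hfm.aemeasurable
      have hFm : Measurable (birkhoffSum G F h) := by
        rw [e]; exact measurable_pi_lambda _ fun i => hfm.comp (measurable_pi_apply i)
      rw [← Measure.map_apply hFm hW, hmap]
      have := pi_apply_le (ι := Fin n) (σ := lam.map (birkhoffSum T f h)) (κ := κ)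
        (fun W hW => by rw [Measure.map_apply hfm hW]; exact hac W hW) hW
      simpa using this
  have hmp := measurePreserving_arrowProdEquivProdArrow ℝ ℝ (Fin n) (fun _ => lam)
    (fun _ => (volume : Measure ℝ))
  rw [← volume_pi] at hmp
  exact hmp.ergodic_conjugate_iff.1 main

end Powers

section Alternating

/-- The `n`-th point of the orbit of `x` under the alternating word `f, g, f, g, …`. -/
noncomputable def alt (f g : ℝ → ℝ) : ℕ → ℝ → ℝ
  | 0, x => x
  | n + 1, x => if Even n then f (alt f g n x) else g (alt f g n x)

variable {X : Set ℝ} {f g : ℝ → ℝ}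

@[simp] lemma alt_zero (x : ℝ) : alt f g 0 x = x := rfl

lemma alt_succ (n : ℕ) (x : ℝ) :
    alt f g (n + 1) x = if Even n then f (alt f g n x) else g (alt f g n x) := rfl

@[simp] lemma alt_one (x : ℝ) : alt f g 1 x = f x := by simp [alt_succ]

lemma alt_add_of_odd {n : ℕ} (hn : Odd n) (m : ℕ) (x : ℝ) :
    alt f g (n + m) x = alt g f m (alt f g n x) := by
  induction m with
  | zero => rfl
  | succ m ih =>
    rw [← add_assoc, alt_succ, alt_succ, ih]
    have : ¬ Even n := by simpa using hn
    by_cases hm : Even m <;> simp [Nat.even_add, this, hm]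

lemma alt_add_of_even {n : ℕ} (hn : Even n) (m : ℕ) (x : ℝ) :
    alt f g (n + m) x = alt f g m (alt f g n x) := by
  induction m with
  | zero => rfl
  | succ m ih =>
    rw [← add_assoc, alt_succ, alt_succ, ih]
    by_cases hm : Even m <;> simp [Nat.even_add, hn, hm]

lemma alt_two_mul (h : ℕ) (x : ℝ) : alt f g (2 * h) x = (g ∘ f)^[h] x := by
  induction h with
  | zero => rfl
  | succ h ih =>
    rw [Function.iterate_succ_apply', ← ih, mul_add, mul_one, alt_add_of_even (by simp)]
    simp [alt_succ]

lemma alt_mem (hf : ∀ x ∈ X, f x ∈ X) (hg : ∀ x ∈ X, g x ∈ X) {x : ℝ} (hx : x ∈ X) (n : ℕ) :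
    alt f g n x ∈ X := by
  induction n with
  | zero => exact hx
  | succ n ih =>
    rw [alt_succ]
    split_ifs
    exacts [hf _ ih, hg _ ih]

lemma alt_reverse (hf : ∀ x ∈ X, f x ∈ X) (hg : ∀ x ∈ X, g x ∈ X)
    (hff : ∀ x ∈ X, f (f x) = x) (hgg : ∀ x ∈ X, g (g x) = x) {x : ℝ} (hx : x ∈ X)
    {l : ℕ} (hl : Odd l) {i : ℕ} (hi : i ≤ l) :
    alt f g i (alt f g l x) = alt f g (l - i) x := by
  induction i with
  | zero => rfl
  | succ i ih =>
    obtain ⟨j, rfl⟩ : ∃ j, l = i + 1 + j := ⟨_, (Nat.add_sub_cancel' hi).symm⟩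
    have e1 : i + 1 + j - i = j + 1 := by omega
    have e2 : i + 1 + j - (i + 1) = j := by omega
    have hj : Even i ↔ Even j := by
      rw [← Nat.not_even_iff_odd] at hl
      simp only [Nat.even_add, Nat.not_even_one] at hl
      tauto
    rw [alt_succ, ih (by omega), e1, e2, alt_succ]
    have := alt_mem hf hg hx j
    by_cases h : Even j <;> simp [hj, h, hff _ this, hgg _ this]

/-- On `(p, q)` the alternating word of length `l` acts by isometries and does not visit
`(y₀, y₁)` strictly between its two ends. -/
def Good (X : Set ℝ) (f g : ℝ → ℝ) (y₀ y₁ p q : ℝ) (l : ℕ) : Prop :=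
  ∀ x ∈ X, x ∈ Ioo p q → (∀ i, 0 < i → i < l → alt f g i x ∉ Ioo y₀ y₁) ∧
    ∀ y ∈ X, y ∈ Ioo p q → ∀ i ≤ l, alt f g i x - alt f g i y = (-1) ^ i * (x - y)

lemma Good.mono {y₀ y₁ p q y₀' y₁' p' q' : ℝ} {l : ℕ} (h : Good X f g y₀ y₁ p q l)
    (h0 : y₀ ≤ y₀') (h1 : y₁' ≤ y₁) (hp : p ≤ p') (hq : q' ≤ q) :
    Good X f g y₀' y₁' p' q' l := by
  intro x hx hxp
  obtain ⟨h2, h3⟩ := h x hx (Ioo_subset_Ioo hp hq hxp)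
  exact ⟨fun i hi hil hm => h2 i hi hil (Ioo_subset_Ioo h0 h1 hm),
    fun y hy hyp => h3 y hy (Ioo_subset_Ioo hp hq hyp)⟩

lemma Good.append {y₀ y₁ p q p' q' : ℝ} {l m : ℕ} (h : Good X f g y₀ y₁ p q l) (hl : Odd l)
    (h' : Good X g f y₀ y₁ p' q' m)
    (hj : ∀ x ∈ X, x ∈ Ioo p q →
      alt f g l x ∈ X ∧ alt f g l x ∈ Ioo p' q' ∧ alt f g l x ∉ Ioo y₀ y₁) :
    Good X f g y₀ y₁ p q (l + m) := by
  intro x hx hxp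
  obtain ⟨h2, h3⟩ := h x hx hxp
  obtain ⟨j1, j2, j3⟩ := hj x hx hxp
  obtain ⟨h4, h5⟩ := h' _ j1 j2
  constructor
  · intro i hi hil
    rcases lt_trichotomy i l with hlt | rfl | hgt
    · exact h2 i hi hlt
    · exact j3
    · obtain ⟨j, rfl⟩ : ∃ j, i = l + j := ⟨_, (Nat.add_sub_cancel' hgt.le).symm⟩
      rw [alt_add_of_odd hl]
      exact h4 j (by omega) (by omega)
  · intro y hy hyp i hil
    rcases le_total i l with hle | hge
    · exact h3 y hy hyp i hle
    · obtain ⟨j, rfl⟩ : ∃ j, i = l + j := ⟨_, (Nat.add_sub_cancel' hge).symm⟩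
      obtain ⟨k1, k2, k3⟩ := hj y hy hyp
      rw [alt_add_of_odd hl, alt_add_of_odd hl, h5 _ k1 k2 j (by omega), h3 y hy hyp l le_rfl,
        pow_add]
      ring

/-- The alternating word of length `l` reflects `(s, s + a)`, as a first return to
`(y₀, y₁)`. -/
structure Refl (X : Set ℝ) (f g : ℝ → ℝ) (y₀ y₁ s a : ℝ) (l : ℕ) : Prop where
  pos : 0 < a
  odd : Odd l
  refl : ∀ x ∈ X, x ∈ Ioo s (s + a) → alt f g l x = 2 * s + a - x
  good : Good X f g y₀ y₁ s (s + a) l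

lemma Refl.mono {y₀ y₁ y₀' y₁' s a : ℝ} {l : ℕ} (h : Refl X f g y₀ y₁ s a l)
    (h0 : y₀ ≤ y₀') (h1 : y₁' ≤ y₁) : Refl X f g y₀' y₁' s a l :=
  ⟨h.pos, h.odd, h.refl, h.good.mono h0 h1 le_rfl le_rfl⟩

/-- A pair of involutions whose alternating compositions are aperiodic with bounded
return times to intervals. -/
structure Sys (X : Set ℝ) (f g : ℝ → ℝ) : Prop where
  f_mem : ∀ x ∈ X, f x ∈ X
  g_mem : ∀ x ∈ X, g x ∈ X
  f_inv : ∀ x ∈ X, f (f x) = x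
  g_inv : ∀ x ∈ X, g (g x) = x
  hap : ∀ p q h, 0 ≤ p → p < q → q ≤ 1 → 0 < h → ∃ x ∈ X, x ∈ Ioo p q ∧ alt f g (2 * h) x ≠ x
  hap' : ∀ p q h, 0 ≤ p → p < q → q ≤ 1 → 0 < h → ∃ x ∈ X, x ∈ Ioo p q ∧ alt g f (2 * h) x ≠ x
  hbd : ∀ p q, 0 ≤ p → p < q → q ≤ 1 → ∃ M : ℕ, ∀ y₀ y₁ s a l, y₀ ≤ p → q ≤ y₁ → 0 ≤ s →
    s + a ≤ 1 → (Refl X f g y₀ y₁ s a l ∨ Refl X g f y₀ y₁ s a l) → l ≤ M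

lemma Sys.swap (h : Sys X f g) : Sys X g f :=
  ⟨h.g_mem, h.f_mem, h.g_inv, h.f_inv, h.hap', h.hap, fun p q hp hpq hq => by
    obtain ⟨M, hM⟩ := h.hbd p q hp hpq hq
    exact ⟨M, fun y₀ y₁ s a l h1 h2 h3 h4 h5 => hM y₀ y₁ s a l h1 h2 h3 h4 h5.symm⟩⟩

/-- Consecutive reflected intervals starting at a given point. -/
def Tiled (X : Set ℝ) (f g : ℝ → ℝ) (y₀ y₁ : ℝ) : ℝ → List (ℝ × ℕ) → Prop
  | _, [] => True
  | s, A :: L => Refl X f g y₀ y₁ s A.1 A.2 ∧ Tiled X f g y₀ y₁ (s + A.1) L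

/-- Total length of a list of pieces. -/
def tlen (L : List (ℝ × ℕ)) : ℝ := (L.map fun A => A.1).sum

/-- Total area of a list of towers. -/
def tarea (L : List (ℝ × ℕ)) : ℝ := (L.map fun A => A.1 * (A.2 : ℝ)).sum

/-- Total height of a list of towers. -/
def theight (L : List (ℝ × ℕ)) : ℕ := (L.map fun A => A.2).sum

@[simp] lemma tlen_nil : tlen [] = 0 := rfl
@[simp] lemma tlen_cons (A : ℝ × ℕ) (L) : tlen (A :: L) = A.1 + tlen L := by simp [tlen]
@[simp] lemma tlen_append (L L') : tlen (L ++ L') = tlen L + tlen L' := by simp [tlen]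
@[simp] lemma tlen_reverse (L) : tlen L.reverse = tlen L := by simp [tlen]
@[simp] lemma tarea_nil : tarea [] = 0 := rfl
@[simp] lemma tarea_cons (A : ℝ × ℕ) (L) : tarea (A :: L) = A.1 * A.2 + tarea L := by
  simp [tarea]
@[simp] lemma tarea_append (L L') : tarea (L ++ L') = tarea L + tarea L' := by simp [tarea]
@[simp] lemma tarea_reverse (L) : tarea L.reverse = tarea L := by simp [tarea]
@[simp] lemma theight_nil : theight [] = 0 := rfl
@[simp] lemma theight_cons (A : ℝ × ℕ) (L) : theight (A :: L) = A.2 + theight L := by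
  simp [theight]
@[simp] lemma theight_append (L L') : theight (L ++ L') = theight L + theight L' := by
  simp [theight]

lemma tiled_append {y₀ y₁ s : ℝ} {L L' : List (ℝ × ℕ)} :
    Tiled X f g y₀ y₁ s (L ++ L') ↔
      Tiled X f g y₀ y₁ s L ∧ Tiled X f g y₀ y₁ (s + tlen L) L' := by
  induction L generalizing s with
  | nil => simp [Tiled]
  | cons A L ih =>
    simp only [List.cons_append, Tiled, ih, tlen_cons, add_assoc, and_assoc]

lemma Tiled.mono {y₀ y₁ y₀' y₁' s : ℝ} {L : List (ℝ × ℕ)} (h : Tiled X f g y₀ y₁ s L)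
    (h0 : y₀ ≤ y₀') (h1 : y₁' ≤ y₁) : Tiled X f g y₀' y₁' s L := by
  induction L generalizing s with
  | nil => trivial
  | cons A L ih => exact ⟨h.1.mono h0 h1, ih h.2⟩

lemma Tiled.tlen_nonneg {y₀ y₁ s : ℝ} {L : List (ℝ × ℕ)} (h : Tiled X f g y₀ y₁ s L) :
    0 ≤ tlen L := by
  induction L generalizing s with
  | nil => simp
  | cons A L ih =>
    rw [tlen_cons]
    exact add_nonneg h.1.pos.le (ih h.2)

lemma Tiled.refl_of_mem {y₀ y₁ s : ℝ} {L : List (ℝ × ℕ)} (h : Tiled X f g y₀ y₁ s L)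
    {A : ℝ × ℕ} (hA : A ∈ L) :
    ∃ t, s ≤ t ∧ t + A.1 ≤ s + tlen L ∧ Refl X f g y₀ y₁ t A.1 A.2 := by
  obtain ⟨L1, L2, rfl⟩ := List.append_of_mem hA
  obtain ⟨h1, h2⟩ := tiled_append.1 h
  refine ⟨s + tlen L1, ?_, ?_, h2.1⟩
  · linarith [h1.tlen_nonneg]
  · have := Tiled.tlen_nonneg h2.2
    simp; linarith

/-- A pair of tilings of `(y₀, y₁)` by first-return reflections. -/
structure State (X : Set ℝ) (f g : ℝ → ℝ) (N : ℕ) (y₀ y₁ : ℝ) (P Q : List (ℝ × ℕ)) : Prop where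
  h0 : 0 ≤ y₀
  h1 : y₁ ≤ 1
  hP : Tiled X f g y₀ y₁ y₀ P
  hQ : Tiled X g f y₀ y₁ y₀ Q
  lenP : tlen P = y₁ - y₀
  lenQ : tlen Q = y₁ - y₀
  area : tarea P + tarea Q = 2
  card : P.length + Q.length ≤ N

lemma State.swap {N : ℕ} {y₀ y₁ : ℝ} {P Q} (h : State X f g N y₀ y₁ P Q) :
    State X g f N y₀ y₁ Q P :=
  ⟨h.h0, h.h1, h.hQ, h.hP, h.lenQ, h.lenP, by rw [add_comm]; exact h.area,
    by rw [add_comm]; exact h.card⟩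

section Mirror

/-- Conjugation of a map by `x ↦ 1 - x`. -/
def mir (f : ℝ → ℝ) (x : ℝ) : ℝ := 1 - f (1 - x)

/-- Image of a set under `x ↦ 1 - x`. -/
def mirS (X : Set ℝ) : Set ℝ := {x | 1 - x ∈ X}

@[simp] lemma mir_mir (f : ℝ → ℝ) : mir (mir f) = f := by ext x; simp [mir]
@[simp] lemma mirS_mirS (X : Set ℝ) : mirS (mirS X) = X := by ext x; simp [mirS]

lemma alt_mir (n : ℕ) (x : ℝ) : alt (mir f) (mir g) n x = 1 - alt f g n (1 - x) := by
  induction n with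
  | zero => simp
  | succ n ih =>
    rw [alt_succ, alt_succ, ih]
    split_ifs <;> simp [mir]

lemma Good.mir {y₀ y₁ p q : ℝ} {l : ℕ} (h : Good X f g y₀ y₁ p q l) :
    Good (mirS X) (mir f) (mir g) (1 - y₁) (1 - y₀) (1 - q) (1 - p) l := by
  intro x hx hxp
  obtain ⟨h1, h2⟩ := h (1 - x) hx ⟨by linarith [hxp.2], by linarith [hxp.1]⟩
  refine ⟨fun i hi hil hm => h1 i hi hil ?_, fun y hy hyp i hil => ?_⟩
  · rw [alt_mir] at hm
    exact ⟨by linarith [hm.2], by linarith [hm.1]⟩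
  · have := h2 (1 - y) hy ⟨by linarith [hyp.2], by linarith [hyp.1]⟩ i hil
    rw [alt_mir, alt_mir]
    linear_combination -this

lemma Refl.mir {y₀ y₁ s a : ℝ} {l : ℕ} (h : Refl X f g y₀ y₁ s a l) :
    Refl (mirS X) (mir f) (mir g) (1 - y₁) (1 - y₀) (1 - (s + a)) a l := by
  refine ⟨h.pos, h.odd, fun x hx hxs => ?_, ?_⟩
  · rw [alt_mir, h.refl (1 - x) hx ⟨by linarith [hxs.2], by linarith [hxs.1]⟩]
    ring
  · have := h.good.mir
    rwa [show 1 - s = 1 - (s + a) + a by ring] at this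

lemma Sys.mir (h : Sys X f g) : Sys (mirS X) (mir f) (mir g) := by
  refine ⟨fun x hx => ?_, fun x hx => ?_, fun x hx => ?_, fun x hx => ?_, ?_, ?_, ?_⟩
  · simpa [mirS, SkewIET.mir] using h.f_mem _ hx
  · simpa [mirS, SkewIET.mir] using h.g_mem _ hx
  · simp [SkewIET.mir, h.f_inv _ hx]
  · simp [SkewIET.mir, h.g_inv _ hx]
  · intro p q n hp hpq hq hn
    obtain ⟨x, hx, hxp, hne⟩ := h.hap (1 - q) (1 - p) n (by linarith) (by linarith) (by linarith) hn
    refine ⟨1 - x, by simpa [mirS] using hx, ⟨by linarith [hxp.2], by linarith [hxp.1]⟩, ?_⟩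
    rw [alt_mir]
    simpa using hne
  · intro p q n hp hpq hq hn
    obtain ⟨x, hx, hxp, hne⟩ :=
      h.hap' (1 - q) (1 - p) n (by linarith) (by linarith) (by linarith) hn
    refine ⟨1 - x, by simpa [mirS] using hx, ⟨by linarith [hxp.2], by linarith [hxp.1]⟩, ?_⟩
    rw [alt_mir]
    simpa using hne
  · intro p q hp hpq hq
    obtain ⟨M, hM⟩ := h.hbd (1 - q) (1 - p) (by linarith) (by linarith) (by linarith)
    refine ⟨M, fun y₀ y₁ s a l h1 h2 h3 h4 h5 => ?_⟩
    refine hM (1 - y₁) (1 - y₀) (1 - (s + a)) a l (by linarith) (by linarith) (by linarith)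
      (by linarith) ?_
    rcases h5 with h5 | h5
    · left; simpa using h5.mir
    · right; simpa using h5.mir

lemma Tiled.mir {y₀ y₁ s : ℝ} {L : List (ℝ × ℕ)} (h : Tiled X f g y₀ y₁ s L) :
    Tiled (mirS X) (mir f) (mir g) (1 - y₁) (1 - y₀) (1 - (s + tlen L)) L.reverse := by
  induction L generalizing s with
  | nil => trivial
  | cons A L ih =>
    rw [List.reverse_cons, tiled_append]
    have h1 := ih h.2
    refine ⟨by rwa [tlen_cons, ← add_assoc], ?_, trivial⟩
    have h2 := h.1.mir
    rwa [show 1 - (s + A.1) = 1 - (s + tlen (A :: L)) + tlen L.reverse by simp; ring] at h2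

lemma State.mir {N : ℕ} {y₀ y₁ : ℝ} {P Q} (h : State X f g N y₀ y₁ P Q) :
    State (mirS X) (mir f) (mir g) N (1 - y₁) (1 - y₀) P.reverse Q.reverse := by
  have hP := h.hP.mir
  have hQ := h.hQ.mir
  rw [h.lenP, show y₀ + (y₁ - y₀) = y₁ by ring] at hP
  rw [h.lenQ, show y₀ + (y₁ - y₀) = y₁ by ring] at hQ
  exact ⟨by linarith [h.h1], by linarith [h.h0], hP, hQ, by simp [h.lenP], by simp [h.lenQ],
    by simpa using h.area, by simpa using h.card⟩

end Mirror

end Alternating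

section Induction

variable {X : Set ℝ} {f g : ℝ → ℝ}

lemma Refl.power (S : Sys X f g) {y₀ y₁ a b : ℝ} {lA lB : ℕ} (hA : Refl X f g y₀ y₁ y₀ a lA)
    (hB : Refl X g f y₀ y₁ y₀ b lB) (hba : b < a) {s c : ℝ} {k : ℕ} (hc : 0 < c)
    (h1 : y₀ + b ≤ s) (h2 : y₀ + k * (a - b) ≤ s) (h3 : s + c ≤ y₀ + a)
    (h4 : 2 * s + c = 2 * y₀ + a + k * (a - b)) :
    Refl X f g (y₀ + b) y₁ s c (lA + k * (lB + lA)) := by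
  have hb := hB.pos
  have e1 : Good X g f (y₀ + b) y₁ y₀ (y₀ + b) (lB + lA) := by
    refine Good.append (hB.good.mono (by linarith) le_rfl le_rfl le_rfl) hB.odd
      (hA.good.mono (by linarith) le_rfl le_rfl (by linarith : y₀ + b ≤ y₀ + a)) ?_
    intro x hx hxp
    refine ⟨alt_mem S.g_mem S.f_mem hx _, ?_, ?_⟩ <;> rw [hB.refl x hx hxp]
    · exact ⟨by linarith [hxp.2], by linarith [hxp.1]⟩
    · intro h; linarith [h.1, hxp.1]
  have e2 : ∀ x ∈ X, x ∈ Ioo y₀ (y₀ + b) → alt g f (lB + lA) x = x + (a - b) := by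
    intro x hx hxp
    have h := hB.refl x hx hxp
    rw [alt_add_of_odd hB.odd, hA.refl _ (alt_mem S.g_mem S.f_mem hx _), h]
    · ring
    · rw [h]; exact ⟨by linarith [hxp.2], by linarith [hxp.1]⟩
  have ev : Even (lB + lA) := hB.odd.add_odd hA.odd
  have key : ∀ j ≤ k, Good X f g (y₀ + b) y₁ s (s + c) (lA + j * (lB + lA)) ∧
      ∀ x ∈ X, x ∈ Ioo s (s + c) →
        alt f g (lA + j * (lB + lA)) x = 2 * y₀ + a - x + j * (a - b) := by
    intro j
    induction j with
    | zero =>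
      intro _
      simp only [zero_mul, add_zero, Nat.cast_zero]
      exact ⟨hA.good.mono (by linarith) le_rfl (by linarith) (by linarith),
        fun x hx hxp => hA.refl x hx ⟨by linarith [hxp.1], by linarith [hxp.2]⟩⟩
    | succ j ih =>
      intro hj
      obtain ⟨i1, i2⟩ := ih (by omega)
      have hodd : Odd (lA + j * (lB + lA)) := hA.odd.add_even (ev.mul_left j)
      have hjk : ((j : ℝ) + 1) * (a - b) ≤ k * (a - b) :=
        mul_le_mul_of_nonneg_right (by exact_mod_cast hj) (by linarith)
      have hj0 : 0 ≤ (j : ℝ) * (a - b) := mul_nonneg (Nat.cast_nonneg _) (by linarith)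
      have hmem : ∀ x ∈ X, x ∈ Ioo s (s + c) →
          alt f g (lA + j * (lB + lA)) x ∈ Ioo y₀ (y₀ + b) := by
        intro x hx hxp
        rw [i2 x hx hxp]
        exact ⟨by linarith [hxp.2], by linarith [hxp.1]⟩
      rw [show lA + (j + 1) * (lB + lA) = lA + j * (lB + lA) + (lB + lA) by ring]
      constructor
      · refine i1.append hodd e1 fun x hx hxp => ⟨alt_mem S.f_mem S.g_mem hx _, hmem x hx hxp, ?_⟩
        intro h
        linarith [h.1, (hmem x hx hxp).2]
      · intro x hx hxp
        rw [alt_add_of_odd hodd, e2 _ (alt_mem S.f_mem S.g_mem hx _) (hmem x hx hxp), i2 x hx hxp]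
        push_cast; ring
  obtain ⟨k1, k2⟩ := key k le_rfl
  refine ⟨hc, hA.odd.add_even (ev.mul_left k), fun x hx hxp => ?_, k1⟩
  rw [k2 x hx hxp]
  linarith

lemma State.step (S : Sys X f g) {N : ℕ} {y₀ y₁ a b : ℝ} {lA lB : ℕ} {P Q}
    (h : State X f g N y₀ y₁ ((a, lA) :: P) ((b, lB) :: Q)) (hba : b < a) :
    ∃ P', State X f g N (y₀ + b) y₁ (P' ++ P) Q ∧ lA + lB < theight P' := by
  have hA : Refl X f g y₀ y₁ y₀ a lA := h.hP.1
  have hB : Refl X g f y₀ y₁ y₀ b lB := h.hQ.1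
  have hP2 : Tiled X f g y₀ y₁ (y₀ + a) P := h.hP.2
  have hQ2 : Tiled X g f y₀ y₁ (y₀ + b) Q := h.hQ.2
  have hb := hB.pos
  have hab : 0 < a - b := by linarith
  have lenP := h.lenP
  have lenQ := h.lenQ
  have area := h.area
  have card := h.card
  have h0 := h.h0
  simp only [tlen_cons, tarea_cons, List.length_cons] at lenP lenQ area card
  set μ : ℕ := ⌊b / (a - b)⌋₊ with hμ
  have hμ1 : (μ : ℝ) * (a - b) ≤ b := by
    have := Nat.floor_le (div_nonneg hb.le hab.le)
    rwa [← hμ, le_div_iff₀ hab] at this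
  have hμ2 : b < (μ + 1 : ℝ) * (a - b) := by
    have := Nat.lt_floor_add_one (b / (a - b))
    rwa [← hμ, div_lt_iff₀ hab] at this
  have hlA : 0 < lA := hA.odd.pos
  have hlB : 0 < lB := hB.odd.pos
  have hPm : Tiled X f g (y₀ + b) y₁ (y₀ + a) P := hP2.mono (by linarith) le_rfl
  have hQm : Tiled X g f (y₀ + b) y₁ (y₀ + b) Q := hQ2.mono (by linarith) le_rfl
  rcases hμ1.eq_or_lt with heq | hlt
  · have hμ0 : 0 < μ := by
      rcases Nat.eq_zero_or_pos μ with h | h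
      · rw [h] at heq; simp at heq; linarith
      · exact h
    refine ⟨[(a - b, lA + μ * (lB + lA))],
      ⟨by linarith, h.h1, ?_, hQm, ?_, by linarith, ?_, ?_⟩, ?_⟩
    · refine ⟨hA.power S hB hba hab le_rfl (by linarith) (by linarith) (by linarith), ?_⟩
      have e : y₀ + b + (a - b) = y₀ + a := by ring
      rw [← e] at hPm
      exact hPm
    · simp; linarith
    · simp
      linear_combination area + (lA + lB : ℝ) * heq
    · simp; omega
    · simp
      nlinarith
  · refine ⟨[(a - b - (b - μ * (a - b)), lA + μ * (lB + lA)),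
      (b - μ * (a - b), lA + (μ + 1) * (lB + lA))],
      ⟨by linarith, h.h1, ?_, hQm, ?_, by linarith, ?_, ?_⟩, ?_⟩
    · refine ⟨hA.power S hB hba (by dsimp only; linarith) le_rfl (by linarith)
        (by dsimp only; linarith) (by dsimp only; linarith), ?_, ?_⟩
      · refine hA.power S hB hba (by dsimp only; linarith) (by dsimp only; linarith)
          (by push_cast; linarith) (by dsimp only; linarith) (by push_cast; linarith)
      · have e : y₀ + b + (a - b - (b - μ * (a - b))) + (b - μ * (a - b)) = y₀ + a := by ring
        rw [← e] at hPm
        exact hPm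
    · simp; linarith
    · simp
      linear_combination area
    · simp; omega
    · simp
      nlinarith

lemma Tiled.theight_le {y₀ y₁ s : ℝ} {L : List (ℝ × ℕ)} (h : Tiled X f g y₀ y₁ s L) {M : ℕ}
    (hM : ∀ s a l, 0 ≤ s → s + a ≤ 1 → Refl X f g y₀ y₁ s a l → l ≤ M) (hs : 0 ≤ s)
    (hs1 : s + tlen L ≤ 1) : theight L ≤ M * L.length := by
  induction L generalizing s with
  | nil => simp
  | cons A L ih =>
    have hA := h.1
    rw [tlen_cons] at hs1
    have hL : 0 ≤ tlen L := Tiled.tlen_nonneg h.2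
    have h1 := hM _ _ _ hs (by linarith) hA
    have h2 := ih h.2 (by linarith [hA.pos]) (by linarith)
    simp only [theight_cons, List.length_cons]
    nlinarith

lemma State.left_induce (S : Sys X f g) {N : ℕ} {y₀ y₁ : ℝ} {P₁ P₂ Q} {A : ℝ × ℕ}
    (h : State X f g N y₀ y₁ (P₁ ++ A :: P₂) Q) :
    ∃ Q', State X f g N (y₀ + tlen P₁) y₁ (A :: P₂) Q' := by
  obtain ⟨s, hs⟩ : ∃ s, y₀ + tlen P₁ = s := ⟨_, rfl⟩
  rw [hs]
  have hApos : 0 < A.1 := (tiled_append.1 h.hP).2.1.pos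
  have hP₂ : 0 ≤ tlen P₂ := Tiled.tlen_nonneg (tiled_append.1 h.hP).2.2
  have hlen := h.lenP
  simp only [tlen_append, tlen_cons] at hlen
  have hP₁ : 0 ≤ tlen P₁ := Tiled.tlen_nonneg (tiled_append.1 h.hP).1
  obtain ⟨M, hM⟩ := S.hbd s (s + A.1) (by linarith [h.h0]) (by linarith) (by linarith [h.h1])
  have hy₁ : s + A.1 ≤ y₁ := by linarith
  clear hlen hP₁
  obtain ⟨n, hn⟩ : ∃ n, M * N < theight (P₁ ++ A :: P₂) + theight Q + n :=
    ⟨M * N + 1, by omega⟩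
  induction n generalizing P₁ Q y₀ with
  | zero =>
    exfalso
    have hP₁ : 0 ≤ tlen P₁ := Tiled.tlen_nonneg (tiled_append.1 h.hP).1
    have h1 := h.hP.theight_le (M := M) (fun s a l h1 h2 h3 =>
      hM _ _ s a l (by linarith) hy₁ h1 h2 (Or.inl h3)) h.h0 (by rw [h.lenP]; linarith [h.h1])
    have h2 := h.hQ.theight_le (M := M) (fun s a l h1 h2 h3 =>
      hM _ _ s a l (by linarith) hy₁ h1 h2 (Or.inr h3)) h.h0 (by rw [h.lenQ]; linarith [h.h1])
    have h3 := Nat.mul_le_mul_left M h.card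
    rw [mul_add] at h3
    omega
  | succ n ih =>
    rcases P₁ with _ | ⟨⟨a, lA⟩, P₁⟩
    · simp at hs; subst hs
      exact ⟨Q, h⟩
    rcases Q with _ | ⟨⟨b, lB⟩, Q⟩
    · exfalso
      have h1 := h.lenP
      have h2 := h.lenQ
      have hP₁ : 0 ≤ tlen ((a, lA) :: P₁) := Tiled.tlen_nonneg (tiled_append.1 h.hP).1
      rw [tlen_append, tlen_cons A] at h1
      simp only [tlen_nil] at h2
      linarith
    have hlen := h.lenP
    simp only [tlen_append, tlen_cons, List.cons_append] at hlen hs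
    simp only [List.cons_append, theight_cons] at hn
    rcases lt_trichotomy b a with hlt | rfl | hgt
    · obtain ⟨P', hP', hh⟩ := State.step S h hlt
      replace hP' : State X f g N (y₀ + b) y₁ (P' ++ (P₁ ++ A :: P₂)) Q := hP'
      rw [← List.append_assoc] at hP'
      have hl := hP'.lenP
      simp only [tlen_append, tlen_cons] at hl
      refine ih hP' (by simp only [tlen_append]; linarith) ?_
      simp only [theight_append, theight_cons] at hn ⊢
      omega
    · exfalso
      have hA : Refl X f g y₀ y₁ y₀ b lA := h.hP.1
      have hB : Refl X g f y₀ y₁ y₀ b lB := h.hQ.1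
      obtain ⟨k, hk⟩ := hA.odd.add_odd hB.odd
      have hkp := hA.odd.pos
      have hP₁ : 0 ≤ tlen P₁ := Tiled.tlen_nonneg (tiled_append.1 h.hP).1.2
      obtain ⟨x, hx, hxp, hne⟩ := S.hap y₀ (y₀ + b) k h.h0 (by linarith [hA.pos])
        (by linarith [h.h1]) (by omega)
      apply hne
      rw [show 2 * k = lA + lB by omega, alt_add_of_odd hA.odd,
        hB.refl _ (alt_mem S.f_mem S.g_mem hx _), hA.refl x hx hxp]
      · ring
      · rw [hA.refl x hx hxp]
        exact ⟨by linarith [hxp.2], by linarith [hxp.1]⟩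
    · obtain ⟨Q', hQ', hh⟩ := State.step S.swap h.swap hgt
      refine ih hQ'.swap (by linarith) ?_
      simp only [theight_append, theight_cons] at hn ⊢
      omega

lemma State.induce (S : Sys X f g) {N : ℕ} {y₀ y₁ : ℝ} {P Q} (h : State X f g N y₀ y₁ P Q)
    {A : ℝ × ℕ} (hA : A ∈ P) :
    ∃ s Q', y₀ ≤ s ∧ s + A.1 ≤ y₁ ∧ State X f g N s (s + A.1) [A] Q' := by
  obtain ⟨P₁, P₂, rfl⟩ := List.append_of_mem hA
  obtain ⟨Q₁, h₁⟩ := State.left_induce S h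
  have h₂ := h₁.mir
  rw [List.reverse_cons] at h₂
  obtain ⟨Q₂, h₃⟩ := State.left_induce S.mir h₂
  have h₄ := h₃.mir
  simp only [mir_mir, mirS_mirS, List.reverse_cons, List.reverse_nil, List.nil_append] at h₄
  have hl := h₁.lenP
  have hP₁ : 0 ≤ tlen P₁ := Tiled.tlen_nonneg (tiled_append.1 h.hP).1
  have hP₂ : 0 ≤ tlen P₂ := Tiled.tlen_nonneg h₁.hP.2
  rw [tlen_cons] at hl
  refine ⟨y₀ + tlen P₁, Q₂.reverse, by linarith, by linarith, ?_⟩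
  convert h₄ using 1
  · ring
  · rw [tlen_reverse]; linarith

lemma State.shrink (S : Sys X f g) {N : ℕ} {s a : ℝ} {l : ℕ} {Q}
    (h : State X f g N s (s + a) [(a, l)] Q) :
    ∃ B ∈ Q, B.1 ≤ a / 2 := by
  have hA : Refl X f g s (s + a) s a l := h.hP.1
  have ha := hA.pos
  have hl := h.lenQ
  rcases Q with _ | ⟨⟨b, m⟩, _ | ⟨⟨b', m'⟩, Q⟩⟩
  · simp at hl; linarith
  · exfalso
    simp at hl
    subst hl
    have hB : Refl X g f s (s + b) s b m := h.hQ.1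
    obtain ⟨k, hk⟩ := hA.odd.add_odd hB.odd
    have hkp := hA.odd.pos
    obtain ⟨x, hx, hxp, hne⟩ := S.hap s (s + b) k h.h0 (by linarith) h.h1 (by omega)
    apply hne
    rw [show 2 * k = l + m by omega, alt_add_of_odd hA.odd,
      hB.refl _ (alt_mem S.f_mem S.g_mem hx _), hA.refl x hx hxp]
    · ring
    · rw [hA.refl x hx hxp]
      exact ⟨by linarith [hxp.2], by linarith [hxp.1]⟩
  · have hQ : 0 ≤ tlen Q := Tiled.tlen_nonneg h.hQ.2.2
    simp only [tlen_cons] at hl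
    rcases le_total b b' with hb | hb
    · exact ⟨(b, m), by simp, by dsimp only; linarith⟩
    · exact ⟨(b', m'), by simp, by dsimp only; linarith⟩

lemma exists_ge_of_sum {α : Type*} (L : List α) (φ : α → ℝ) {N : ℕ} (hN : L.length ≤ N)
    (hpos : 0 < (L.map φ).sum) : ∃ A ∈ L, (L.map φ).sum ≤ φ A * N := by
  by_contra! hcon
  have hN0 : 0 < N := by
    rcases L with _ | ⟨A, L⟩
    · simp at hpos
    · simp at hN; omega
  have h1 : (L.map φ).sum ≤ L.length • ((L.map φ).sum / N) := by
    have := List.sum_le_card_nsmul (L.map φ) ((L.map φ).sum / N) fun x hx => by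
      obtain ⟨A, hA, rfl⟩ := List.mem_map.1 hx
      rw [le_div_iff₀ (by exact_mod_cast hN0)]
      exact (hcon A hA).le
    simpa using this
  obtain ⟨A, hA⟩ : ∃ A, A ∈ L := by
    rcases L with _ | ⟨A, L⟩
    · simp at hpos
    · exact ⟨A, by simp⟩
  have h2 : ∀ A ∈ L, φ A < (L.map φ).sum / N := fun A hA => by
    rw [lt_div_iff₀ (by exact_mod_cast hN0)]; exact hcon A hA
  have h3 : (L.map φ).sum < L.length • ((L.map φ).sum / N) := by
    have : (L.map φ).sum < (L.map fun _ => (L.map φ).sum / N).sum :=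
      List.sum_lt_sum _ _ (fun A hA => (h2 A hA).le) ⟨A, hA, h2 A hA⟩
    simpa using this
  have h4 : (L.length : ℝ) * ((L.map φ).sum / N) ≤ (L.map φ).sum := by
    rw [mul_div_assoc', div_le_iff₀ (by exact_mod_cast hN0), mul_comm]
    exact mul_le_mul_of_nonneg_left (by exact_mod_cast hN) hpos.le
  rw [nsmul_eq_mul] at h3
  linarith

/-- A thin tower over a reflected interval `(s, s + a)` together with a thick subinterval
`(t, t + b)` on which the other alternating word is reflected. -/
structure Pair (X : Set ℝ) (f g : ℝ → ℝ) (N : ℕ) (s a : ℝ) (l : ℕ) (t b : ℝ) (m : ℕ) : Prop where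
  hA : Refl X f g s (s + a) s a l
  hB : Refl X g f s (s + a) t b m
  s_nonneg : 0 ≤ s
  le_one : s + a ≤ 1
  s_le : s ≤ t
  t_le : t + b ≤ s + a
  thick : a ≤ b * N
  area_ge : 2 ≤ a * l * N
  area_le : a * l ≤ 2
  area_le' : b * m ≤ 2

lemma Tiled.tarea_nonneg {y₀ y₁ s : ℝ} {L : List (ℝ × ℕ)} (h : Tiled X f g y₀ y₁ s L) :
    0 ≤ tarea L := by
  induction L generalizing s with
  | nil => simp
  | cons A L ih =>
    rw [tarea_cons]
    exact add_nonneg (mul_nonneg h.1.pos.le (Nat.cast_nonneg _)) (ih h.2)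

lemma Tiled.area_le_of_mem {y₀ y₁ s : ℝ} {L : List (ℝ × ℕ)} (h : Tiled X f g y₀ y₁ s L)
    {A : ℝ × ℕ} (hA : A ∈ L) : A.1 * A.2 ≤ tarea L := by
  obtain ⟨L1, L2, rfl⟩ := List.append_of_mem hA
  obtain ⟨h1, h2⟩ := tiled_append.1 h
  have h3 : 0 ≤ tarea L2 := Tiled.tarea_nonneg h2.2
  have := h1.tarea_nonneg
  simp only [tarea_append, tarea_cons]
  linarith

lemma State.pair {N : ℕ} {s : ℝ} {A : ℝ × ℕ} {Q}
    (h : State X f g N s (s + A.1) [A] Q) (hge : 2 ≤ A.1 * A.2 * N) :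
    ∃ t b m, Pair X f g N s A.1 A.2 t b m := by
  have hA : Refl X f g s (s + A.1) s A.1 A.2 := h.hP.1
  have hl : (Q.map fun B => B.1).sum = A.1 := by simpa [tlen] using h.lenQ
  have hcard := h.card
  simp only [List.length_cons, List.length_nil] at hcard
  obtain ⟨B, hB, hle⟩ := exists_ge_of_sum Q (fun B => B.1) (N := N) (by omega)
    (by rw [hl]; exact hA.pos)
  obtain ⟨t, h1, h2, h3⟩ := h.hQ.refl_of_mem hB
  have har := h.area
  have h4 := h.hQ.tarea_nonneg
  have h5 := h.hQ.area_le_of_mem hB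
  have h6 : 0 ≤ A.1 * (A.2 : ℝ) := mul_nonneg hA.pos.le (Nat.cast_nonneg _)
  simp only [tarea_cons, tarea_nil, add_zero] at har
  refine ⟨t, B.1, B.2, hA, h3, h.h0, h.h1, h1, by rw [h.lenQ] at h2; linarith, by
    rw [← hl]; exact hle, hge, by linarith, by linarith⟩

lemma State.exists_small (S : Sys X f g) {N : ℕ} {y₀ y₁ : ℝ} {P Q}
    (h : State X f g N y₀ y₁ P Q) (hy : y₁ - y₀ ≤ 1) (hy0 : y₀ < y₁) (n : ℕ) :
    ∃ z₀ z₁ P' Q', z₁ - z₀ ≤ (1 / 2) ^ n ∧ z₀ < z₁ ∧ (State X f g N z₀ z₁ P' Q') := by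
  induction n with
  | zero => exact ⟨y₀, y₁, P, Q, by simpa using hy, hy0, h⟩
  | succ n ih =>
    obtain ⟨z₀, z₁, P', Q', h1, h2, h3⟩ := ih
    have hlen := h3.lenP
    rcases P' with _ | ⟨A, P'⟩
    · simp at hlen; linarith
    obtain ⟨s, Q₁, h4, h5, h6⟩ := h3.induce S (A := A) (by simp)
    obtain ⟨B, hB, hB2⟩ := State.shrink S h6
    obtain ⟨t, Q₂, h7, h8, h9⟩ := h6.swap.induce S.swap hB
    have hBp : 0 < B.1 := h9.hP.1.pos
    refine ⟨t, t + B.1, Q₂, [B], ?_, by linarith, h9.swap⟩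
    rw [pow_succ]
    linarith

lemma State.exists_pair (S : Sys X f g) {N : ℕ} {y₀ y₁ : ℝ} {P Q}
    (h : State X f g N y₀ y₁ P Q) (hy0 : y₀ < y₁) {ε : ℝ} (hε : 0 < ε) :
    ∃ s a l t b m, a ≤ ε ∧ (Pair X f g N s a l t b m ∨ Pair X g f N s a l t b m) := by
  obtain ⟨n, hn⟩ := exists_pow_lt_of_lt_one hε (by norm_num : (1 / 2 : ℝ) < 1)
  obtain ⟨z₀, z₁, P', Q', h1, h2, h3⟩ := h.exists_small S (by linarith [h.h0, h.h1]) hy0 n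
  have hsum : ((P' ++ Q').map fun A => A.1 * (A.2 : ℝ)).sum = 2 := by
    have := h3.area
    simpa [tarea] using this
  obtain ⟨A, hA, hle⟩ := exists_ge_of_sum (P' ++ Q') (fun A => A.1 * (A.2 : ℝ)) (N := N)
    (by simpa using h3.card) (by rw [hsum]; norm_num)
  rw [hsum] at hle
  rcases List.mem_append.1 hA with hA | hA
  · obtain ⟨s, Q₁, h4, h5, h6⟩ := h3.induce S hA
    obtain ⟨t, b, m, hp⟩ := h6.pair hle
    exact ⟨s, A.1, A.2, t, b, m, by linarith, Or.inl hp⟩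
  · obtain ⟨s, Q₁, h4, h5, h6⟩ := h3.swap.induce S.swap hA
    obtain ⟨t, b, m, hp⟩ := h6.pair hle
    exact ⟨s, A.1, A.2, t, b, m, by linarith, Or.inr hp⟩

end Induction

section Birkhoff

variable {X : Set ℝ} {f g : ℝ → ℝ}

/-- The alternating sum along an alternating orbit. -/
noncomputable def altSum (f g : ℝ → ℝ) (n : ℕ) (x : ℝ) : ℝ :=
  ∑ i ∈ Finset.range n, (-1) ^ i * alt f g i x

lemma Refl.altSum_eq (S : Sys X f g) {y₀ y₁ s a : ℝ} {l : ℕ} (h : Refl X f g y₀ y₁ s a l) {x : ℝ}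
    (hx : x ∈ X) (hxs : x ∈ Ioo s (s + a)) :
    2 * altSum f g (l + 1) x = (l + 1) * (x - (2 * s + a - x)) := by
  have hx' : alt f g l x ∈ X := alt_mem S.f_mem S.g_mem hx l
  have e := h.refl x hx hxs
  have hm : alt f g l x ∈ Ioo s (s + a) := by
    rw [e]; exact ⟨by linarith [hxs.2], by linarith [hxs.1]⟩
  have h1 : altSum f g (l + 1) x =
      ∑ i ∈ Finset.range (l + 1), -((-1) ^ i * alt f g i (alt f g l x)) := by
    rw [altSum, ← Finset.sum_range_reflect]
    refine Finset.sum_congr rfl fun i hi => ?_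
    have hi : i ≤ l := by simpa [Nat.lt_succ_iff] using hi
    rw [alt_reverse S.f_mem S.g_mem S.f_inv S.g_inv hx h.odd hi, Nat.add_sub_cancel]
    have : (-1 : ℝ) ^ (l - i) = -(-1) ^ i := by
      have h3 : (-1 : ℝ) ^ (l - i) * (-1) ^ i = -1 := by
        rw [← pow_add, Nat.sub_add_cancel hi, h.odd.neg_one_pow]
      have h4 : (-1 : ℝ) ^ i * (-1) ^ i = 1 := by rw [← mul_pow]; simp
      calc (-1 : ℝ) ^ (l - i) = (-1) ^ (l - i) * ((-1) ^ i * (-1) ^ i) := by rw [h4, mul_one]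
        _ = _ := by rw [← mul_assoc, h3]; ring
    rw [this]; ring
  have h2 : 2 * altSum f g (l + 1) x = ∑ i ∈ Finset.range (l + 1), (x - alt f g l x) := by
    rw [two_mul]
    nth_rewrite 2 [h1]
    rw [altSum, ← Finset.sum_add_distrib]
    refine Finset.sum_congr rfl fun i hi => ?_
    have hi : i ≤ l := by simpa [Nat.lt_succ_iff] using hi
    have h3 := (h.good x hx hxs).2 _ hx' hm i hi
    have h4 : (-1 : ℝ) ^ i * (-1) ^ i = 1 := by rw [← mul_pow]; simp
    linear_combination (-1 : ℝ) ^ i * h3 + (x - alt f g l x) * h4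
  rw [h2, e, Finset.sum_const, Finset.card_range, nsmul_eq_mul]
  push_cast
  ring

lemma Refl.abs_altSum_le (S : Sys X f g) {y₀ y₁ s a : ℝ} {l : ℕ} (h : Refl X f g y₀ y₁ s a l)
    (hs : 0 ≤ s) (hs1 : s + a ≤ 1) (hal : a * l ≤ 2) {x : ℝ} (hx : x ∈ X)
    (hxs : x ∈ Ioo s (s + a)) : |altSum f g l x| ≤ 3 := by
  have h1 := h.altSum_eq S hx hxs
  have h2 : altSum f g (l + 1) x = altSum f g l x - (2 * s + a - x) := by
    rw [altSum, Finset.sum_range_succ, ← altSum, h.odd.neg_one_pow, h.refl x hx hxs]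
    ring
  have hl : (1 : ℝ) ≤ l := by exact_mod_cast h.odd.pos
  have h3 : |2 * altSum f g (l + 1) x| ≤ (l + 1) * a := by
    rw [h1, abs_mul, abs_of_nonneg (by linarith : (0 : ℝ) ≤ l + 1)]
    refine mul_le_mul_of_nonneg_left ?_ (by linarith)
    rw [abs_le]; constructor <;> linarith [hxs.1, hxs.2]
  have h4 : (l + 1) * a ≤ 4 := by nlinarith [h.pos]
  rw [h2] at h3
  rw [abs_le] at h3 ⊢
  constructor <;> linarith [hxs.1, hxs.2]

lemma altSum_add_of_odd {m : ℕ} (hm : Odd m) (l : ℕ) (x : ℝ) :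
    altSum g f (m + l) x = altSum g f m x - altSum f g l (alt g f m x) := by
  rw [altSum, Finset.sum_range_add, altSum, altSum, sub_eq_add_neg, ← Finset.sum_neg_distrib]
  congr 1
  refine Finset.sum_congr rfl fun i _ => ?_
  rw [alt_add_of_odd hm, pow_add, hm.neg_one_pow]
  ring

lemma altSum_two_mul_left (S : Sys X f g) (hf : ∀ x ∈ X, f x = 1 - x) {x : ℝ} (hx : x ∈ X)
    (h : ℕ) : altSum g f (2 * h) x =
      2 * ∑ i ∈ Finset.range h, (alt g f (2 * i) x - 1 / 2) + (alt g f (2 * h) x - x) := by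
  induction h with
  | zero => simp [altSum]
  | succ h ih =>
    have h1 : alt g f (2 * h + 1 + 1) x = 1 - alt g f (2 * h + 1) x := by
      rw [alt_succ, if_neg (by simp), hf _ (alt_mem S.g_mem S.f_mem hx _)]
    rw [show 2 * (h + 1) = 2 * h + 1 + 1 by ring, altSum, Finset.sum_range_succ,
      Finset.sum_range_succ, ← altSum, ih, Finset.sum_range_succ, h1]
    simp [pow_succ, pow_mul]
    ring

lemma altSum_two_mul_right (S : Sys X f g) (hg : ∀ x ∈ X, g x = 1 - x) {x : ℝ} (hx : x ∈ X)
    (h : ℕ) : altSum g f (2 * h) x =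
      2 * ∑ i ∈ Finset.range h, (alt g f (2 * i) x - 1 / 2) := by
  induction h with
  | zero => simp [altSum]
  | succ h ih =>
    have h1 : alt g f (2 * h + 1) x = 1 - alt g f (2 * h) x := by
      rw [alt_succ, if_pos (by simp), hg _ (alt_mem S.g_mem S.f_mem hx _)]
    rw [show 2 * (h + 1) = 2 * h + 1 + 1 by ring, altSum, Finset.sum_range_succ,
      Finset.sum_range_succ, ← altSum, ih, Finset.sum_range_succ, h1]
    simp [pow_succ, pow_mul]
    ring

lemma alt_two_mul_inv (S : Sys X f g) {x : ℝ} (hx : x ∈ X) (n : ℕ) :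
    alt f g (2 * n) (alt g f (2 * n) x) = x := by
  induction n with
  | zero => rfl
  | succ n ih =>
    have h1 : alt g f (2 * (n + 1)) x = f (g (alt g f (2 * n) x)) := by
      simp [mul_add, alt_succ]
    have h2 : ∀ y, alt f g (2 * (n + 1)) y = alt f g (2 * n) (g (f y)) := by
      intro y
      rw [mul_add, add_comm, alt_add_of_even (by simp)]
      simp [alt_succ]
    have h3 := alt_mem S.g_mem S.f_mem hx (2 * n)
    rw [h1, h2, S.f_inv _ (S.g_mem _ h3), S.g_inv _ h3, ih]

lemma Pair.disjoint (S : Sys X f g) {N : ℕ} {s a t b : ℝ} {l m : ℕ}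
    (h : Pair X f g N s a l t b m) {i j : ℕ} (hij : i < j) (hjl : 2 * j < l)
    {z : ℝ} (hz : z ∈ X) (hi : alt g f (2 * i) z ∈ Ioo t (t + b))
    (hj' : alt g f (2 * j) z ∈ Ioo t (t + b)) : False := by
  obtain ⟨k, rfl⟩ : ∃ k, j = i + k := ⟨_, (Nat.add_sub_cancel' hij.le).symm⟩
  have hsub : Ioo t (t + b) ⊆ Ioo s (s + a) := Ioo_subset_Ioo h.s_le h.t_le
  have hX := alt_mem S.g_mem S.f_mem hz (2 * i)
  rw [mul_add, alt_add_of_even (by simp)] at hj'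
  refine (h.hA.good _ (alt_mem S.g_mem S.f_mem hX _) (hsub hj')).1 (2 * k) (by omega) (by omega) ?_
  rw [alt_two_mul_inv S hX]
  exact hsub hi

lemma Pair.estimate (S : Sys X f g) {N : ℕ} {s a t b : ℝ} {l m : ℕ}
    (h : Pair X f g N s a l t b m) (hfg : (∀ x ∈ X, f x = 1 - x) ∨ ∀ x ∈ X, g x = 1 - x)
    {j n : ℕ} (hj : 2 * j ≤ l) (hn : l + m = 2 * n) {z : ℝ} (hz : z ∈ X)
    (hzj : alt g f (2 * j) z ∈ Ioo t (t + b)) :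
    |alt g f (2 * n) z - z| ≤ a ∧
      |∑ i ∈ Finset.range n, (alt g f (2 * i) z - 1 / 2)| ≤ 5 := by
  have hsub : Ioo t (t + b) ⊆ Ioo s (s + a) := Ioo_subset_Ioo h.s_le h.t_le
  obtain ⟨x, hxdef⟩ : ∃ x, alt g f (2 * j) z = x := ⟨_, rfl⟩
  have hx : x ∈ X := hxdef ▸ alt_mem S.g_mem S.f_mem hz _
  rw [hxdef] at hzj
  have hxA := hsub hzj
  have hB := h.hB.refl x hx hzj
  have hx'X := alt_mem S.g_mem S.f_mem hx m
  have hx'B : alt g f m x ∈ Ioo t (t + b) := by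
    rw [hB]; exact ⟨by linarith [hzj.2], by linarith [hzj.1]⟩
  have hx'A := hsub hx'B
  obtain ⟨w, hw⟩ : ∃ w, alt g f (2 * n) x = w := ⟨_, rfl⟩
  have hwe : w = alt f g l (alt g f m x) := by
    rw [← hw, ← hn, add_comm, alt_add_of_odd h.hB.odd]
  have hwX : w ∈ X := hwe ▸ alt_mem S.f_mem S.g_mem hx'X l
  have hwA : w ∈ Ioo s (s + a) := by
    rw [hwe, h.hA.refl _ hx'X hx'A]
    exact ⟨by linarith [hx'A.2], by linarith [hx'A.1]⟩
  have hxw : |w - x| ≤ a := by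
    rw [abs_le]; constructor <;> linarith [hxA.1, hxA.2, hwA.1, hwA.2]
  have hadd : ∀ p q : ℕ, ∀ y, alt g f (2 * (p + q)) y = alt g f (2 * q) (alt g f (2 * p) y) := by
    intro p q y
    rw [mul_add, alt_add_of_even (by simp)]
  have hnX := alt_mem S.g_mem S.f_mem hz (2 * n)
  have hw2 : alt g f (2 * j) (alt g f (2 * n) z) = w := by
    rw [← hadd, add_comm, hadd, hxdef, hw]
  have hback : ∀ i ≤ j, alt g f (2 * i) (alt g f (2 * n) z) - alt g f (2 * i) z = w - x := by
    intro i hi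
    obtain ⟨k, rfl⟩ : ∃ k, j = i + k := ⟨_, (Nat.add_sub_cancel' hi).symm⟩
    rw [hadd] at hw2 hxdef
    have e1 := alt_two_mul_inv S (alt_mem S.g_mem S.f_mem hnX (2 * i)) k
    have e2 := alt_two_mul_inv S (alt_mem S.g_mem S.f_mem hz (2 * i)) k
    rw [hw2] at e1
    rw [hxdef] at e2
    rw [← e1, ← e2, (h.hA.good w hwX hwA).2 x hx hxA (2 * k) (by omega)]
    simp [pow_mul]
  refine ⟨by simpa using (by rw [← hback 0 (by omega)] at hxw; exact hxw), ?_⟩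
  have hsum : ∑ i ∈ Finset.range n, (alt g f (2 * i) z - 1 / 2) =
      ∑ i ∈ Finset.range n, (alt g f (2 * i) x - 1 / 2) - j * (w - x) := by
    have e1 := Finset.sum_range_add (fun i => alt g f (2 * i) z - 1 / 2) n j
    have e2 := Finset.sum_range_add (fun i => alt g f (2 * i) z - 1 / 2) j n
    rw [add_comm, e1] at e2
    have e3 : ∑ i ∈ Finset.range j, (alt g f (2 * (n + i)) z - 1 / 2) =
        ∑ i ∈ Finset.range j, (alt g f (2 * i) z - 1 / 2) + j * (w - x) := by
      rw [← nsmul_eq_mul, ← Finset.card_range j, ← Finset.sum_const, Finset.card_range,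
        ← Finset.sum_add_distrib]
      refine Finset.sum_congr rfl fun i hi => ?_
      have := hback i (Finset.mem_range.1 hi).le
      rw [hadd]
      linarith
    have e4 : ∑ i ∈ Finset.range n, (alt g f (2 * (j + i)) z - 1 / 2) =
        ∑ i ∈ Finset.range n, (alt g f (2 * i) x - 1 / 2) := by
      refine Finset.sum_congr rfl fun i _ => ?_
      rw [hadd, hxdef]
    rw [e3, e4] at e2
    linarith
  have hja : |j * (w - x)| ≤ 1 := by
    rw [abs_mul, abs_of_nonneg (Nat.cast_nonneg j)]
    have h1 : (j : ℝ) * |w - x| ≤ j * a := mul_le_mul_of_nonneg_left hxw (Nat.cast_nonneg _)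
    have h2 : 2 * (j : ℝ) ≤ l := by exact_mod_cast hj
    have h3 := mul_le_mul_of_nonneg_left h2 h.hA.pos.le
    linarith [h.area_le]
  have hpsi : |altSum g f (2 * n) x| ≤ 6 := by
    rw [← hn, add_comm, altSum_add_of_odd h.hB.odd]
    have h1 := h.hB.abs_altSum_le S.swap (h.s_nonneg.trans h.s_le) (h.t_le.trans h.le_one)
      h.area_le' hx hzj
    have h2 := h.hA.abs_altSum_le S h.s_nonneg h.le_one h.area_le hx'X hx'A
    rw [abs_le] at h1 h2 ⊢
    constructor <;> linarith
  have ha1 : a ≤ 1 := by linarith [h.s_nonneg, h.le_one]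
  rw [hsum]
  rcases hfg with hf | hg
  · rw [altSum_two_mul_left S hf hx, hw] at hpsi
    rw [abs_le] at hpsi hja hxw ⊢
    constructor <;> linarith
  · rw [altSum_two_mul_right S hg hx] at hpsi
    rw [abs_le] at hpsi hja hxw ⊢
    constructor <;> linarith

end Birkhoff

section Cuts

/-- `τ` is the symmetric exchange of the intervals `[c k, c (k + 1))`, `k < d`, of `[0, 1)`. -/
structure Cut (τ : ℝ → ℝ) (d : ℕ) (c : ℕ → ℝ) : Prop where
  zero : c 0 = 0
  one : c d = 1
  lt : ∀ k < d, c k < c (k + 1)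
  eq : ∀ k < d, ∀ x ∈ Ico (c k) (c (k + 1)), τ x = 1 + x - c k - c (k + 1)

lemma exists_cut (T : IET) (ha0 : T.a = 0) (hb1 : T.b = 1) (hsymm : T.IsSymm) :
    ∃ c, Cut T.toFun T.d c := by
  set c : ℕ → ℝ := fun k => ∑ β ∈ Finset.univ.filter (fun β => (T.perm0 β : ℕ) < k), T.len β
    with hc
  have hsucc : ∀ α, c (T.perm0 α + 1) = c (T.perm0 α) + T.len α := by
    intro α
    have : (Finset.univ.filter fun β => (T.perm0 β : ℕ) < T.perm0 α + 1) =
        insert α (Finset.univ.filter fun β => (T.perm0 β : ℕ) < T.perm0 α) := by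
      ext β
      simp only [Finset.mem_filter, Finset.mem_univ, true_and, Finset.mem_insert]
      rw [Nat.lt_succ_iff_lt_or_eq, Fin.val_inj, T.perm0.injective.eq_iff, or_comm]
    simp only [hc]
    rw [this, Finset.sum_insert (by simp), add_comm]
  have hmono : Monotone c := by
    intro k l hkl
    refine Finset.sum_le_sum_of_subset_of_nonneg ?_ fun β _ _ => (T.len_pos β).le
    intro β
    simp only [Finset.mem_filter, Finset.mem_univ, true_and]
    omega
  have hlep : ∀ α, T.lep α = c (T.perm0 α) := by
    intro α
    rw [IET.lep, ha0, zero_add]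
    rfl
  have hone : c T.d = 1 := by
    have : (Finset.univ.filter fun β => (T.perm0 β : ℕ) < T.d) = Finset.univ := by
      ext β; simp
    simp only [hc]
    rw [this, T.len_sum, ha0, hb1, sub_zero]
  have himg : ∀ α, T.lepImg α = 1 - c (T.perm0 α + 1) := by
    intro α
    rw [IET.lepImg, ha0, zero_add, ← hone]
    have h1 := Finset.sum_filter_add_sum_filter_not (Finset.univ : Finset (Fin T.d))
      (fun β => (T.perm0 β : ℕ) < T.perm0 α + 1) T.len
    have h2 : c T.d = ∑ β, T.len β := by rw [hone, T.len_sum, ha0, hb1, sub_zero]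
    have h3 : (Finset.univ.filter fun β => T.perm1 β < T.perm1 α) =
        Finset.univ.filter fun β => ¬ (T.perm0 β : ℕ) < T.perm0 α + 1 := by
      ext β
      simp only [Finset.mem_filter, Finset.mem_univ, true_and]
      have h4 := hsymm α
      have h5 := hsymm β
      rw [← Fin.val_fin_lt]
      omega
    rw [h3, h2, ← h1]
    simp only [hc]
    ring
  refine ⟨c, by simp [hc], hone, fun k hk => ?_, fun k hk x hx => ?_⟩
  · have := hsucc (T.perm0.symm ⟨k, hk⟩)
    simp only [Equiv.apply_symm_apply] at this
    rw [this]
    linarith [T.len_pos (T.perm0.symm ⟨k, hk⟩)]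
  · obtain ⟨α, hα⟩ : ∃ α, T.perm0 α = ⟨k, hk⟩ := T.perm0.surjective _
    have hαk : (T.perm0 α : ℕ) = k := by rw [hα]
    have hintv : ∀ β, T.interval β = Ico (c (T.perm0 β)) (c (T.perm0 β + 1)) := by
      intro β
      rw [IET.interval, hlep, hsucc]
    rw [IET.toFun, Finset.sum_eq_single α]
    · rw [hintv, hαk, if_pos hx, IET.transl, himg, hlep, hαk]
      ring
    · intro β _ hβ
      rw [if_neg]
      intro hxβ
      rw [hintv] at hxβ
      have hne : (T.perm0 β : ℕ) ≠ k := by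
        rw [← hαk]
        intro h
        exact hβ (T.perm0.injective (Fin.val_injective h))
      rcases lt_or_gt_of_ne hne with h | h
      · have := hmono (show (T.perm0 β : ℕ) + 1 ≤ k by omega)
        linarith [hxβ.2, hx.1]
      · have := hmono (show k + 1 ≤ (T.perm0 β : ℕ) by omega)
        linarith [hxβ.1, hx.2]
    · simp

variable {τ : ℝ → ℝ} {d : ℕ} {c : ℕ → ℝ}

lemma Cut.le (C : Cut τ d c) {k l : ℕ} (hkl : k ≤ l) (hl : l ≤ d) : c k ≤ c l := by
  induction l with
  | zero => simp [Nat.le_zero.1 hkl]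
  | succ l ih =>
    rcases hkl.eq_or_lt with rfl | h
    · rfl
    · exact (ih (by omega) (by omega)).trans (C.lt l (by omega)).le

lemma Cut.exists_index (C : Cut τ d c) {x : ℝ} (hx : x ∈ Ico (0 : ℝ) 1) :
    ∃ k < d, x ∈ Ico (c k) (c (k + 1)) := by
  have hex : ∃ k, k ≤ d ∧ x < c k := ⟨d, le_rfl, by rw [C.one]; exact hx.2⟩
  have h1 := Nat.find_spec hex
  have h0 : Nat.find hex ≠ 0 := by
    intro h
    rw [h, C.zero] at h1
    linarith [h1.2, hx.1]
  obtain ⟨k, hk⟩ := Nat.exists_eq_succ_of_ne_zero h0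
  have h2 := Nat.find_min hex (m := k) (by omega)
  rw [hk] at h1
  simp only [not_and, not_lt] at h2
  exact ⟨k, by omega, h2 (by omega), h1.2⟩

lemma Cut.mapsTo (C : Cut τ d c) {x : ℝ} (hx : x ∈ Ico (0 : ℝ) 1) : τ x ∈ Ico (0 : ℝ) 1 := by
  obtain ⟨k, hk, hxk⟩ := C.exists_index hx
  have h1 := C.le (Nat.zero_le k) hk.le
  have h2 := C.le (show k + 1 ≤ d by omega) le_rfl
  rw [C.zero] at h1
  rw [C.one] at h2
  rw [C.eq k hk x hxk]
  exact ⟨by linarith [hxk.1], by linarith [hxk.2]⟩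

lemma Cut.iterate_mapsTo (C : Cut τ d c) {x : ℝ} (hx : x ∈ Ico (0 : ℝ) 1) (n : ℕ) :
    τ^[n] x ∈ Ico (0 : ℝ) 1 := by
  induction n with
  | zero => exact hx
  | succ n ih => rw [Function.iterate_succ_apply']; exact C.mapsTo ih

lemma Cut.injOn (C : Cut τ d c) : InjOn τ (Ico (0 : ℝ) 1) := by
  intro x hx y hy hxy
  obtain ⟨k, hk, hxk⟩ := C.exists_index hx
  obtain ⟨l, hl, hyl⟩ := C.exists_index hy
  rw [C.eq k hk x hxk, C.eq l hl y hyl] at hxy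
  rcases lt_trichotomy k l with h | rfl | h
  · have := C.le (show k + 1 ≤ l by omega) hl.le
    linarith [hxk.1, hyl.1, hxk.2, hyl.2]
  · linarith
  · have := C.le (show l + 1 ≤ k by omega) hk.le
    linarith [hxk.1, hyl.1, hxk.2, hyl.2]

lemma Cut.iterate_injOn (C : Cut τ d c) (n : ℕ) : InjOn τ^[n] (Ico (0 : ℝ) 1) := by
  induction n with
  | zero => exact injOn_id _
  | succ n ih =>
    intro x hx y hy hxy
    rw [Function.iterate_succ_apply', Function.iterate_succ_apply'] at hxy
    exact ih hx hy (C.injOn (C.iterate_mapsTo hx n) (C.iterate_mapsTo hy n) hxy)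

lemma Cut.sub_eq (C : Cut τ d c) {x y : ℝ} (hx : x ∈ Ico (0 : ℝ) 1) (hy : y < 1) (hxy : x ≤ y)
    (hno : ∀ k < d, 0 < k → c k ∉ Ioc x y) : τ y - τ x = y - x := by
  obtain ⟨k, hk, hxk⟩ := C.exists_index hx
  have hyk : y < c (k + 1) := by
    rcases (show k + 1 ≤ d by omega).eq_or_lt with h | h
    · rw [h, C.one]; exact hy
    · by_contra! hcon
      exact hno (k + 1) h (by omega) ⟨hxk.2, hcon⟩
  rw [C.eq k hk x hxk, C.eq k hk y ⟨hxk.1.trans hxy, hyk⟩]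
  ring

end Cuts

section Density

variable {τ : ℝ → ℝ} {d : ℕ} {c : ℕ → ℝ}

lemma Cut.iterate_sub_eq (C : Cut τ d c) {h : ℕ} {x : ℝ} (hx : x ∈ Ico (0 : ℝ) 1) {i : ℕ}
    (hi : i ≤ h) : ∀ {y : ℝ}, y < 1 → x ≤ y →
    (∀ w ∈ Ioc x y, ∀ j < h, ∀ k < d, 0 < k → τ^[j] w ≠ c k) →
    τ^[i] y - τ^[i] x = y - x := by
  induction i with
  | zero => intros; rfl
  | succ i ih =>
    intro y hy hxy hno
    have h1 := ih (by omega) hy hxy hno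
    rw [Function.iterate_succ_apply', Function.iterate_succ_apply', ← h1]
    refine C.sub_eq (C.iterate_mapsTo hx i)
      (C.iterate_mapsTo ⟨hx.1.trans hxy, hy⟩ i).2 (by linarith) fun k hk hk0 hck => ?_
    have hw : x + (c k - τ^[i] x) ∈ Ioc x y := ⟨by linarith [hck.1], by linarith [hck.2]⟩
    refine hno _ hw i (by omega) k hk hk0 ?_
    have := ih (by omega) (y := x + (c k - τ^[i] x)) (by linarith [hw.2]) (by linarith [hw.1])
      fun w hw' => hno w ⟨hw'.1, hw'.2.trans hw.2⟩
    linarith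

lemma volume_affine_preimage {r : ℝ} (hr : r ≠ 0) (s : ℝ) (W : Set ℝ) :
    volume {x : ℝ | s + r * x ∈ W} = ENNReal.ofReal |r⁻¹| * volume W := by
  have : {x : ℝ | s + r * x ∈ W} = (fun x => r * x) ⁻¹' ((fun x => s + x) ⁻¹' W) := rfl
  rw [this, Real.volume_preimage_mul_left hr, measure_preimage_add]

lemma Cut.measure_birkhoffSum_le (C : Cut τ d c) {a : ℝ} (ha : a ≠ 0) {h : ℕ} (hh : 0 < h)
    (W : Set ℝ) :
    (volume.restrict (Ico (0 : ℝ) 1)) (birkhoffSum τ (fun x => a * (x - 1 / 2)) h ⁻¹' W) ≤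
      ((d + 1) * ‖a⁻¹‖₊ : ℝ≥0) * volume W := by
  have hsub : ∀ i k, ∃ w ∈ Ico (0 : ℝ) 1, ∀ x ∈ Ico (0 : ℝ) 1, τ^[i] x = c k → x = w := by
    intro i k
    by_cases hex : ∃ x ∈ Ico (0 : ℝ) 1, τ^[i] x = c k
    · obtain ⟨w, hw, hwk⟩ := hex
      exact ⟨w, hw, fun x hx hxk => C.iterate_injOn i hx hw (hxk.trans hwk.symm)⟩
    · exact ⟨0, by simp, fun x hx hxk => (hex ⟨x, hx, hxk⟩).elim⟩
  choose w hw hwu using hsub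
  set E : Finset ℝ := insert 0 ((Finset.range h ×ˢ Finset.range d).image fun p => w p.1 p.2)
    with hE
  have hcard : E.card ≤ h * d + 1 := by
    refine (Finset.card_insert_le _ _).trans (Nat.succ_le_succ ?_)
    refine Finset.card_image_le.trans ?_
    rw [Finset.card_product, Finset.card_range, Finset.card_range]
  have hE01 : ∀ p ∈ E, p ∈ Ico (0 : ℝ) 1 := by
    intro p hp
    rcases Finset.mem_insert.1 hp with rfl | hp
    · simp
    · obtain ⟨q, -, rfl⟩ := Finset.mem_image.1 hp
      exact hw _ _
  have hah : a * h ≠ 0 := mul_ne_zero ha (by exact_mod_cast hh.ne')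
  set F := birkhoffSum τ (fun x => a * (x - 1 / 2)) h with hF
  have hcover : F ⁻¹' W ∩ Ico (0 : ℝ) 1 ⊆
      ⋃ p ∈ E, {x : ℝ | (F p - a * h * p) + a * h * x ∈ W} := by
    rintro x ⟨hxW, hx⟩
    have hne : (E.filter (· ≤ x)).Nonempty := ⟨0, by simp [hE, hx.1]⟩
    obtain ⟨p, hp, hmax⟩ := Finset.exists_max_image _ id hne
    rw [Finset.mem_filter] at hp
    have hpE := hE01 p hp.1
    have htr : ∀ i ≤ h, τ^[i] x - τ^[i] p = x - p := by
      intro i hi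
      refine C.iterate_sub_eq (h := h) hpE hi hx.2 hp.2 fun v hv j hj k hk _ hjk => ?_
      have hv01 : v ∈ Ico (0 : ℝ) 1 := ⟨by linarith [hv.1, hpE.1], by linarith [hv.2, hx.2]⟩
      have hvw := hwu j k v hv01 hjk
      have hvE : v ∈ E := Finset.mem_insert_of_mem
        (Finset.mem_image.2 ⟨(j, k), by simp [hj, hk], hvw.symm⟩)
      have := hmax v (Finset.mem_filter.2 ⟨hvE, hv.2⟩)
      simp only [id] at this
      linarith [hv.1]
    have hFx : F x = F p + a * h * (x - p) := by
      have : F x - F p = ∑ i ∈ Finset.range h, a * (x - p) := by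
        simp only [hF, birkhoffSum]
        rw [← Finset.sum_sub_distrib]
        refine Finset.sum_congr rfl fun i hi => ?_
        have := htr i (Finset.mem_range.1 hi).le
        linear_combination a * this
      rw [Finset.sum_const, Finset.card_range, nsmul_eq_mul] at this
      linear_combination this
    refine mem_iUnion₂.2 ⟨p, hp.1, ?_⟩
    change F p - a * h * p + a * h * x ∈ W
    have hxW' : F x ∈ W := hxW
    rw [hFx] at hxW'
    convert hxW' using 1
    ring
  rw [Measure.restrict_apply' measurableSet_Ico]
  calc volume (F ⁻¹' W ∩ Ico (0 : ℝ) 1)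
      ≤ ∑ p ∈ E, volume {x : ℝ | (F p - a * h * p) + a * h * x ∈ W} :=
        (measure_mono hcover).trans (measure_biUnion_finset_le _ _)
    _ = (E.card : ℝ≥0∞) * (ENNReal.ofReal |(a * h)⁻¹| * volume W) := by
        simp_rw [volume_affine_preimage hah]
        rw [Finset.sum_const, nsmul_eq_mul]
    _ ≤ _ := by
        rw [← mul_assoc]
        gcongr
        have e1 : ENNReal.ofReal |(a * h)⁻¹| = ((‖a⁻¹‖₊ * (h : ℝ≥0)⁻¹ : ℝ≥0) : ℝ≥0∞) := by
          rw [ENNReal.ofReal_eq_coe_nnreal (abs_nonneg _)]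
          congr 1
          ext
          simp [abs_mul, mul_comm]
        have e2 : (E.card : ℝ≥0∞) = ((E.card : ℝ≥0) : ℝ≥0∞) := by simp
        rw [e1, e2, ← ENNReal.coe_mul, ENNReal.coe_le_coe]
        have e3 : (E.card : ℝ≥0) ≤ (d + 1) * h := by
          have : E.card ≤ (d + 1) * h := by nlinarith
          exact_mod_cast this
        have hh' : (h : ℝ≥0) ≠ 0 := by exact_mod_cast hh.ne'
        calc (E.card : ℝ≥0) * (‖a⁻¹‖₊ * (h : ℝ≥0)⁻¹)
            ≤ ((d + 1) * h) * (‖a⁻¹‖₊ * (h : ℝ≥0)⁻¹) := by gcongr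
          _ = _ := by field_simp

end Density

section Core

/-- The points all of whose alternating orbits stay in `G`. -/
def core (f g : ℝ → ℝ) (G : Set ℝ) : Set ℝ := {x | ∀ n, alt f g n x ∈ G ∧ alt g f n x ∈ G}

variable {f g : ℝ → ℝ} {G : Set ℝ} {μ : Measure ℝ}

lemma core_comm : core f g G = core g f G := by
  ext x
  exact forall_congr' fun n => and_comm

lemma core_subset : core f g G ⊆ G := fun _ hx => (hx 0).1

lemma map_mem_core (hf : ∀ x ∈ G, f (f x) = x) {x : ℝ} (hx : x ∈ core f g G) :
    f x ∈ core f g G := by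
  have h1 : ∀ m y, alt g f m (f y) = alt f g (1 + m) y := fun m y => by
    rw [alt_add_of_odd odd_one, alt_one]
  intro n
  refine ⟨?_, h1 n x ▸ (hx _).1⟩
  cases n with
  | zero => simpa using (hx 1).1
  | succ m =>
    rw [add_comm, ← h1, hf x (core_subset hx)]
    exact (hx m).2

lemma measurePreserving_alt (hf : MeasurePreserving f μ μ) (hg : MeasurePreserving g μ μ)
    (n : ℕ) : MeasurePreserving (alt f g n) μ μ := by
  induction n with
  | zero => exact MeasurePreserving.id μ
  | succ n ih =>
    by_cases hn : Even n
    · have : alt f g (n + 1) = f ∘ alt f g n := by ext x; simp [alt_succ, hn]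
      rw [this]
      exact hf.comp ih
    · have : alt f g (n + 1) = g ∘ alt f g n := by ext x; simp [alt_succ, hn]
      rw [this]
      exact hg.comp ih

lemma measurableSet_core (hf : MeasurePreserving f μ μ) (hg : MeasurePreserving g μ μ)
    (hG : MeasurableSet G) : MeasurableSet (core f g G) := by
  have : core f g G = ⋂ n, (alt f g n ⁻¹' G ∩ alt g f n ⁻¹' G) := by
    ext x
    simp [core]
  rw [this]
  exact MeasurableSet.iInter fun n => ((measurePreserving_alt hf hg n).measurable hG).inter
    ((measurePreserving_alt hg hf n).measurable hG)

lemma ae_mem_core (hf : MeasurePreserving f μ μ) (hg : MeasurePreserving g μ μ)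
    (hG : ∀ᵐ x ∂μ, x ∈ G) : ∀ᵐ x ∂μ, x ∈ core f g G :=
  ae_all_iff.2 fun n =>
    ((measurePreserving_alt hf hg n).quasiMeasurePreserving.ae hG).and
      ((measurePreserving_alt hg hf n).quasiMeasurePreserving.ae hG)

end Core

section Involutions

/-- Lebesgue measure on `[0, 1)`. -/
noncomputable def lam : Measure ℝ := volume.restrict (Ico (0 : ℝ) 1)

instance : IsProbabilityMeasure lam := ⟨by simp [lam]⟩

lemma ae_lam_mem : ∀ᵐ x ∂lam, x ∈ Ico (0 : ℝ) 1 := ae_restrict_mem measurableSet_Ico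

lemma lam_Ioo {p q : ℝ} (hp : 0 ≤ p) (hq : q ≤ 1) : lam (Ioo p q) = ENNReal.ofReal (q - p) := by
  rw [lam, Measure.restrict_apply measurableSet_Ioo,
    inter_eq_left.2 (show Ioo p q ⊆ Ico 0 1 from
      fun x hx => ⟨hp.trans hx.1.le, hx.2.trans_le hq⟩), Real.volume_Ioo]

/-- The reflection of the unit interval. -/
def rev (x : ℝ) : ℝ := 1 - x

lemma rev_rev (x : ℝ) : rev (rev x) = x := by simp [rev]

lemma measurePreserving_rev : MeasurePreserving rev lam lam := by
  have h1 : MeasurePreserving rev volume volume :=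
    Measure.measurePreserving_sub_left volume 1
  have h2 := h1.restrict_preimage (s := Ico (0 : ℝ) 1) measurableSet_Ico
  have h3 : rev ⁻¹' Ico (0 : ℝ) 1 = Ioc 0 1 := by
    ext x
    simp only [rev, mem_preimage, mem_Ico, mem_Ioc]
    constructor <;> rintro ⟨h, h'⟩ <;> constructor <;> linarith
  rw [h3, ← Measure.restrict_congr_set (Ico_ae_eq_Ioc (μ := volume) (a := (0 : ℝ)) (b := 1))]
    at h2
  exact h2

variable {τ : ℝ → ℝ} {d : ℕ} {c : ℕ → ℝ}

/-- The union of the interiors of the exchanged intervals. -/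
def gaps (d : ℕ) (c : ℕ → ℝ) : Set ℝ := ⋃ k ∈ Finset.range d, Ioo (c k) (c (k + 1))

lemma mem_gaps {x : ℝ} : x ∈ gaps d c ↔ ∃ k < d, x ∈ Ioo (c k) (c (k + 1)) := by
  simp only [gaps, mem_iUnion, Finset.mem_range, exists_prop]

lemma measurableSet_gaps : MeasurableSet (gaps d c) :=
  Finset.measurableSet_biUnion _ fun _ _ => measurableSet_Ioo

lemma Cut.ae_mem_gaps (C : Cut τ d c) : ∀ᵐ x ∂lam, x ∈ gaps d c := by
  have h1 : ∀ᵐ x ∂lam, ∀ k, x ≠ c k := by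
    refine ae_all_iff.2 fun k => ?_
    exact ae_restrict_of_ae (measure_eq_zero_iff_ae_notMem.1 (measure_singleton (c k)))
  filter_upwards [h1, ae_lam_mem] with x hx hx'
  obtain ⟨k, hk, hxk⟩ := C.exists_index hx'
  exact mem_gaps.2 ⟨k, hk, lt_of_le_of_ne hxk.1 (hx k).symm, hxk.2⟩

lemma Cut.rev_comp (C : Cut τ d c) {k : ℕ} (hk : k < d) {x : ℝ}
    (hx : x ∈ Ioo (c k) (c (k + 1))) : (rev ∘ τ) x = c k + c (k + 1) - x := by
  simp only [Function.comp, rev]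
  rw [C.eq k hk x (Ioo_subset_Ico_self hx)]
  ring

lemma Cut.rev_comp_inv (C : Cut τ d c) {x : ℝ} (hx : x ∈ gaps d c) :
    (rev ∘ τ) ((rev ∘ τ) x) = x := by
  obtain ⟨k, hk, hx⟩ := mem_gaps.1 hx
  rw [C.rev_comp hk hx, C.rev_comp hk ⟨by linarith [hx.2], by linarith [hx.1]⟩]
  ring

/-- The conull invariant set on which `rev` and `rev ∘ τ` are involutions. -/
def base (τ : ℝ → ℝ) (d : ℕ) (c : ℕ → ℝ) : Set ℝ := core rev (rev ∘ τ) (gaps d c)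

lemma rev_mem_base {x : ℝ} (hx : x ∈ base τ d c) : rev x ∈ base τ d c :=
  map_mem_core (fun x _ => rev_rev x) hx

lemma Cut.rev_comp_mem_base (C : Cut τ d c) {x : ℝ} (hx : x ∈ base τ d c) :
    (rev ∘ τ) x ∈ base τ d c := by
  rw [base, core_comm] at hx ⊢
  exact map_mem_core (fun x hx => C.rev_comp_inv hx) hx

lemma measurePreserving_rev_comp (hτ : MeasurePreserving τ lam lam) :
    MeasurePreserving (rev ∘ τ) lam lam := measurePreserving_rev.comp hτ

lemma measurableSet_base (hτ : MeasurePreserving τ lam lam) : MeasurableSet (base τ d c) :=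
  measurableSet_core measurePreserving_rev (measurePreserving_rev_comp hτ) measurableSet_gaps

lemma Cut.ae_mem_base (C : Cut τ d c) (hτ : MeasurePreserving τ lam lam) :
    ∀ᵐ x ∂lam, x ∈ base τ d c :=
  ae_mem_core measurePreserving_rev (measurePreserving_rev_comp hτ) C.ae_mem_gaps

lemma exists_mem_Ioo_of_ae {P : ℝ → Prop} (hP : ∀ᵐ x ∂lam, P x) {p q : ℝ} (hp : 0 ≤ p)
    (hpq : p < q) (hq : q ≤ 1) : ∃ x ∈ Ioo p q, P x := by
  by_contra! hno
  have : lam (Ioo p q) = 0 := measure_mono_null hno (ae_iff.1 hP)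
  rw [lam_Ioo hp hq, ENNReal.ofReal_eq_zero] at this
  linarith

lemma alt_rev_comp (j : ℕ) (x : ℝ) : alt (rev ∘ τ) rev (2 * j) x = τ^[j] x := by
  rw [alt_two_mul]
  have : rev ∘ rev ∘ τ = τ := by ext y; exact rev_rev _
  rw [this]

lemma alt_rev_comp' (j : ℕ) (x : ℝ) : alt rev (rev ∘ τ) (2 * j + 1) x = τ^[j] (rev x) := by
  rw [add_comm, alt_add_of_odd odd_one, alt_one, alt_rev_comp]

end Involutions

section Recurrence

variable {τ : ℝ → ℝ} {d : ℕ} {c : ℕ → ℝ}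

lemma not_ae_periodic (hE : Ergodic τ lam) {p q : ℝ} {h : ℕ} (hp : 0 ≤ p) (hpq : p < q)
    (hq : q ≤ 1) (hh : 0 < h) : ¬ ∀ᵐ x ∂lam, x ∈ Ioo p q → τ^[h] x = x := by
  intro hper
  have hhR : (0 : ℝ) < h := by exact_mod_cast hh
  set q' := min q (p + 1 / (2 * h)) with hq'
  have hpq' : p < q' := lt_min hpq (by linarith [show 0 < 1 / (2 * (h : ℝ)) by positivity])
  have hq'q : q' ≤ q := min_le_left _ _
  set V := Ioo p q' with hV
  have hVm : lam V = ENNReal.ofReal (q' - p) := lam_Ioo hp (hq'q.trans hq)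
  set W : Set ℝ := ⋃ i ∈ Finset.range h, τ^[i] ⁻¹' V with hW
  have hWm : MeasurableSet W := Finset.measurableSet_biUnion _ fun i _ =>
    (hE.measurable.iterate i) measurableSet_Ioo
  have hVW : V ⊆ W := by
    intro x hx
    simp only [hW, mem_iUnion, Finset.mem_range, exists_prop]
    exact ⟨0, hh, hx⟩
  have hinv : W ≤ᵐ[lam] τ ⁻¹' W := by
    filter_upwards [hper] with x hx hxW
    change x ∈ W at hxW
    change τ x ∈ W
    simp only [hW, mem_iUnion, Finset.mem_range, exists_prop, mem_preimage] at hxW ⊢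
    obtain ⟨i, hi, hxi⟩ := hxW
    cases i with
    | zero =>
      have hxV : x ∈ V := hxi
      refine ⟨h - 1, by omega, ?_⟩
      rw [← Function.iterate_succ_apply, Nat.succ_eq_add_one, Nat.sub_add_cancel hh,
        hx (Ioo_subset_Ioo_right hq'q hxV)]
      exact hxV
    | succ i => exact ⟨i, by omega, by rwa [← Function.iterate_succ_apply]⟩
  have hle : lam W ≤ ENNReal.ofReal (1 / 2) := by
    calc lam W ≤ ∑ i ∈ Finset.range h, lam (τ^[i] ⁻¹' V) := measure_biUnion_finset_le _ _
      _ = ∑ i ∈ Finset.range h, ENNReal.ofReal (q' - p) :=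
        Finset.sum_congr rfl fun i _ => by
          rw [(hE.toMeasurePreserving.iterate i).measure_preimage
            measurableSet_Ioo.nullMeasurableSet, hVm]
      _ = ENNReal.ofReal (h * (q' - p)) := by
        rw [Finset.sum_const, Finset.card_range, nsmul_eq_mul, ENNReal.ofReal_mul hhR.le,
          ENNReal.ofReal_natCast]
      _ ≤ ENNReal.ofReal (1 / 2) := by
        refine ENNReal.ofReal_le_ofReal ?_
        have : q' - p ≤ 1 / (2 * h) := by linarith [min_le_right q (p + 1 / (2 * (h : ℝ)))]
        calc h * (q' - p) ≤ h * (1 / (2 * h)) := by gcongr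
          _ = 1 / 2 := by field_simp
  rcases hE.ae_empty_or_univ_of_ae_le_preimage hWm.nullMeasurableSet hinv
    with h0 | h1
  · have := measure_mono_null hVW (ae_eq_empty.1 h0)
    rw [hVm, ENNReal.ofReal_eq_zero] at this
    linarith
  · have := measure_congr h1
    rw [measure_univ] at this
    rw [this, ENNReal.one_le_ofReal] at hle
    norm_num at hle

/-- The points of `A` whose orbit hits `z` before returning to `A` form a finite set. -/
lemma Cut.finite_hitting (C : Cut τ d c) {A : Set ℝ} (hA : A ⊆ Ico 0 1) (z : ℝ) :
    {v | v ∈ A ∧ ∃ n, τ^[n] v = z ∧ ∀ j, 1 ≤ j → j < n → τ^[j] v ∉ A}.Finite := by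
  have hsub : {v | v ∈ A ∧ ∃ n, 1 ≤ n ∧ τ^[n] v = z ∧
      ∀ j, 1 ≤ j → j < n → τ^[j] v ∉ A}.Subsingleton := by
    have key : ∀ v ∈ A, ∀ w ∈ A, ∀ n m : ℕ, 1 ≤ n → n ≤ m → τ^[n] v = z → τ^[m] w = z →
        (∀ j, 1 ≤ j → j < m → τ^[j] w ∉ A) → v = w := by
      intro v hv w hw n m hn hnm hvz hwz hno
      obtain ⟨k, rfl⟩ := Nat.exists_eq_add_of_le hnm
      rw [Function.iterate_add_apply] at hwz
      have h1 := C.iterate_injOn n (hA hv) (C.iterate_mapsTo (hA hw) k) (hvz.trans hwz.symm)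
      rcases Nat.eq_zero_or_pos k with rfl | hk
      · exact h1
      · exact (hno k hk (by omega) (h1 ▸ hv)).elim
    rintro v ⟨hv, n, hn, hvz, hvn⟩ w ⟨hw, m, hm, hwz, hwm⟩
    rcases le_total n m with h | h
    · exact key v hv w hw n m hn h hvz hwz hwm
    · exact (key w hw v hv m n hm h hwz hvz hvn).symm
  refine (hsub.finite.insert z).subset ?_
  rintro v ⟨hv, n, hn, hvn⟩
  rcases Nat.eq_zero_or_pos n with rfl | hn0
  · exact Or.inl hn
  · exact Or.inr ⟨hv, n, hn0, hn, hvn⟩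

/-- The left endpoints of the intervals exchanged by the first return to `[p, q)`. -/
def breaks (τ : ℝ → ℝ) (d : ℕ) (c : ℕ → ℝ) (p q : ℝ) : Set ℝ :=
  {v | v ∈ Ico p q ∧ ∃ n, (τ^[n] v = p ∨ τ^[n] v = q ∨ ∃ k < d, τ^[n] v = c k) ∧
    ∀ j, 1 ≤ j → j < n → τ^[j] v ∉ Ico p q}

lemma Cut.finite_breaks (C : Cut τ d c) {p q : ℝ} (hp : 0 ≤ p) (hq : q ≤ 1) :
    (breaks τ d c p q).Finite := by
  have hA : Ico p q ⊆ Ico 0 1 := Ico_subset_Ico hp hq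
  refine ((C.finite_hitting hA p).union ((C.finite_hitting hA q).union
    ((Finset.range d).finite_toSet.biUnion fun k _ => C.finite_hitting hA (c k)))).subset ?_
  rintro v ⟨hv, n, h | h | ⟨k, hk, h⟩, hno⟩
  · exact Or.inl ⟨hv, n, h, hno⟩
  · exact Or.inr (Or.inl ⟨hv, n, h, hno⟩)
  · exact Or.inr (Or.inr (mem_biUnion (by simpa using hk) ⟨hv, n, h, hno⟩))

lemma Cut.return_dichotomy (C : Cut τ d c) {p q : ℝ} (hp : 0 ≤ p) (hq : q ≤ 1) {w x : ℝ}
    (hw : w ∈ Ico p q) (hx : x ∈ Ico p q)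
    (hno : ∀ v ∈ Ioc w x, v ∉ breaks τ d c p q) (n : ℕ) :
    (∃ j, 1 ≤ j ∧ j ≤ n ∧ ∀ v ∈ Icc w x, τ^[j] v ∈ Ico p q) ∨
      ∀ v ∈ Icc w x, τ^[n + 1] v - τ^[n + 1] w = v - w ∧
        ∀ j, 1 ≤ j → j ≤ n → τ^[j] v ∉ Ico p q := by
  have hsubA : Icc w x ⊆ Ico p q := fun v hv => ⟨hw.1.trans hv.1, hv.2.trans_lt hx.2⟩
  have hA : Ico p q ⊆ Ico 0 1 := Ico_subset_Ico hp hq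
  have hit : ∀ n : ℕ, (∀ v ∈ Icc w x, τ^[n] v - τ^[n] w = v - w ∧
      ∀ j, 1 ≤ j → j < n → τ^[j] v ∉ Ico p q) → ∀ v ∈ Icc w x, ∀ z,
      (z = p ∨ z = q ∨ ∃ k < d, z = c k) → z ∉ Ioc (τ^[n] w) (τ^[n] v) := by
    intro n hn v hv z hz hzm
    have h1 := (hn v hv).1
    have hu : w + (z - τ^[n] w) ∈ Ioc w x :=
      ⟨by linarith [hzm.1], by linarith [hzm.2, hv.2]⟩
    have hu' := hn _ (Ioc_subset_Icc_self hu)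
    have huz : τ^[n] (w + (z - τ^[n] w)) = z := by linarith [hu'.1]
    exact hno _ hu ⟨hsubA (Ioc_subset_Icc_self hu), n, by rwa [huz], hu'.2⟩
  have step : ∀ n : ℕ, (∀ v ∈ Icc w x, τ^[n] v - τ^[n] w = v - w ∧
      ∀ j, 1 ≤ j → j < n → τ^[j] v ∉ Ico p q) → ∀ v ∈ Icc w x,
      τ^[n + 1] v - τ^[n + 1] w = v - w := by
    intro n hn v hv
    have h1 := (hn v hv).1
    rw [Function.iterate_succ_apply', Function.iterate_succ_apply', ← h1]
    refine C.sub_eq (C.iterate_mapsTo (hA hw) n) (C.iterate_mapsTo (hA (hsubA hv)) n).2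
      (by linarith [hv.1]) fun k hk _ => hit n hn v hv _ (Or.inr (Or.inr ⟨k, hk, rfl⟩))
  induction n with
  | zero =>
    refine Or.inr fun v hv => ⟨step 0 (fun v _ => ⟨rfl, fun j hj hj' => by omega⟩) v hv,
      fun j hj hj' => by omega⟩
  | succ n ih =>
    rcases ih with ⟨j, hj, hjn, h⟩ | ih
    · exact Or.inl ⟨j, hj, by omega, h⟩
    have ih' : ∀ v ∈ Icc w x, τ^[n + 1] v - τ^[n + 1] w = v - w ∧
        ∀ j, 1 ≤ j → j < n + 1 → τ^[j] v ∉ Ico p q :=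
      fun v hv => ⟨(ih v hv).1, fun j hj hjn => (ih v hv).2 j hj (by omega)⟩
    have hconst : ∀ v ∈ Icc w x, τ^[n + 1] v ∈ Ico p q ↔ τ^[n + 1] w ∈ Ico p q := by
      intro v hv
      have h1 := (ih v hv).1
      have h2 := hit _ ih' v hv p (Or.inl rfl)
      have h3 := hit _ ih' v hv q (Or.inr (Or.inl rfl))
      simp only [mem_Ioc, not_and_or, not_lt, not_le] at h2 h3
      have hv1 := hv.1
      constructor
      · rintro ⟨h4, h5⟩
        refine ⟨?_, by linarith⟩
        rcases h2 with h2 | h2 <;> linarith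
      · rintro ⟨h4, h5⟩
        refine ⟨by linarith, ?_⟩
        rcases h3 with h3 | h3 <;> linarith
    by_cases hwA : τ^[n + 1] w ∈ Ico p q
    · exact Or.inl ⟨n + 1, by omega, le_rfl, fun v hv => (hconst v hv).2 hwA⟩
    · refine Or.inr fun v hv => ⟨step _ ih' v hv, fun j hj hjn => ?_⟩
      rcases Nat.lt_or_ge n j with h | h
      · obtain rfl : j = n + 1 := by omega
        exact fun hvA => hwA ((hconst v hv).1 hvA)
      · exact (ih v hv).2 j hj h

lemma Cut.exists_common_return (C : Cut τ d c) {p q : ℝ} (hp : 0 ≤ p) (hq : q ≤ 1) {w x : ℝ}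
    (hw : w ∈ Ico p q) (hx : x ∈ Ico p q)
    (hno : ∀ v ∈ Ioc w x, v ∉ breaks τ d c p q) {v : ℝ} (hv : v ∈ Icc w x) {n : ℕ} (hn : 1 ≤ n)
    (hvn : τ^[n] v ∈ Ico p q) : ∃ j, 1 ≤ j ∧ j ≤ n ∧ ∀ v ∈ Icc w x, τ^[j] v ∈ Ico p q :=
  (C.return_dichotomy hp hq hw hx hno n).resolve_right fun h => (h v hv).2 n hn le_rfl hvn

lemma Cut.exists_return_bound (C : Cut τ d c) (hτ : MeasurePreserving τ lam lam) {p q : ℝ}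
    (hp : 0 ≤ p) (hpq : p < q) (hq : q ≤ 1) :
    ∃ H : ℕ, ∀ x ∈ Ico p q, ∃ j, 1 ≤ j ∧ j ≤ H ∧ τ^[j] x ∈ Ico p q := by
  have hfin := C.finite_breaks hp hq
  have hpF : p ∈ breaks τ d c p q := ⟨by simpa using hpq, 0, Or.inl rfl, by omega⟩
  have hret : ∀ w ∈ breaks τ d c p q, ∃ n, 1 ≤ n ∧ τ^[n] w ∈ Ico p q := by
    intro w hw
    obtain ⟨e, hwe, heq, he⟩ : ∃ e, w < e ∧ e ≤ q ∧ ∀ v ∈ Ioo w e, v ∉ breaks τ d c p q := by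
      have hopen : (breaks τ d c p q \ {w})ᶜ ∈ 𝓝 w :=
        ((hfin.subset sdiff_subset).isClosed.isOpen_compl).mem_nhds (by simp)
      obtain ⟨e, he, hsub⟩ := (mem_nhdsGE_iff_exists_Ico_subset' hw.1.2).1
        (mem_nhdsWithin_of_mem_nhds hopen)
      refine ⟨min e q, lt_min he hw.1.2, min_le_right _ _, fun v hv hvF => ?_⟩
      exact hsub ⟨hv.1.le, hv.2.trans_le (min_le_left _ _)⟩ ⟨hvF, hv.1.ne'⟩
    have hrec := hτ.conservative.ae_mem_imp_frequently_image_mem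
      (measurableSet_Ico (a := p) (b := q)).nullMeasurableSet
    obtain ⟨y, hy, hyr⟩ := exists_mem_Ioo_of_ae hrec (hp.trans hw.1.1) hwe (heq.trans hq)
    have hyA : y ∈ Ico p q := ⟨hw.1.1.trans hy.1.le, hy.2.trans_le heq⟩
    obtain ⟨n, hn, hyn⟩ := frequently_atTop.1 (hyr hyA) 1
    obtain ⟨j, hj, -, hall⟩ := C.exists_common_return hp hq hw.1 hyA
      (fun v hv => he v ⟨hv.1, hv.2.trans_lt hy.2⟩) (right_mem_Icc.2 hy.1.le) hn hyn
    exact ⟨j, hj, hall w (left_mem_Icc.2 hy.1.le)⟩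
  choose! r hr1 hr using hret
  obtain ⟨H, hH⟩ := (hfin.image r).bddAbove
  refine ⟨H, fun x hx => ?_⟩
  obtain ⟨w, ⟨hw, hwx⟩, hmax⟩ := (hfin.inter_of_left (Iic x)).exists_maximalFor id _
    ⟨p, hpF, hx.1⟩
  obtain ⟨j, hj, hjn, hall⟩ := C.exists_common_return hp hq hw.1 hx
    (fun v hv hvF => absurd (hmax ⟨hvF, hv.2⟩ hv.1.le) (not_le.2 hv.1))
    (left_mem_Icc.2 hwx) (hr1 w hw) (hr w hw)
  exact ⟨j, hj, hjn.trans (hH (mem_image_of_mem r hw)), hall x (right_mem_Icc.2 hwx)⟩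

lemma Cut.exists_hitting_bound (C : Cut τ d c) (hE : Ergodic τ lam) {p q : ℝ}
    (hp : 0 ≤ p) (hpq : p < q) (hq : q ≤ 1) :
    ∃ H : ℕ, ∀ᵐ x ∂lam, ∃ j ≤ H, τ^[j] x ∈ Ico p q := by
  obtain ⟨H, hH⟩ := C.exists_return_bound hE.toMeasurePreserving hp hpq hq
  refine ⟨H, ?_⟩
  set W : Set ℝ := ⋃ i ∈ Finset.range (H + 1), τ^[i] ⁻¹' Ico p q with hW
  have hmem : ∀ x, x ∈ W ↔ ∃ j ≤ H, τ^[j] x ∈ Ico p q := by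
    intro x
    simp only [hW, mem_iUnion, Finset.mem_range, exists_prop, mem_preimage, Nat.lt_succ_iff]
  have hWm : MeasurableSet W := Finset.measurableSet_biUnion _ fun i _ =>
    (hE.measurable.iterate i) measurableSet_Ico
  have hinv : W ⊆ τ ⁻¹' W := by
    intro x hx
    rw [mem_preimage, hmem]
    obtain ⟨j, hj, hxj⟩ := (hmem x).1 hx
    have : ∃ i, 1 ≤ i ∧ i ≤ H ∧ τ^[i] x ∈ Ico p q := by
      rcases Nat.eq_zero_or_pos j with rfl | hj0
      · exact hH x hxj
      · exact ⟨j, hj0, hj, hxj⟩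
    obtain ⟨i, hi1, hi, hxi⟩ := this
    refine ⟨i - 1, by omega, ?_⟩
    rwa [← Function.iterate_succ_apply, Nat.succ_eq_add_one, Nat.sub_add_cancel hi1]
  rcases hE.ae_empty_or_univ_of_ae_le_preimage hWm.nullMeasurableSet hinv.eventuallyLE
    with h0 | h1
  · have : Ioo p q ⊆ W := fun x hx => (hmem x).2 ⟨0, Nat.zero_le _, Ioo_subset_Ico_self hx⟩
    have := measure_mono_null this (ae_eq_empty.1 h0)
    rw [lam_Ioo hp hq, ENNReal.ofReal_eq_zero] at this
    linarith
  · filter_upwards [h1.mem_iff] with x hx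
    exact (hmem x).1 (hx.2 (mem_univ x))

end Recurrence

section Dynamics

variable {τ : ℝ → ℝ} {d : ℕ} {c : ℕ → ℝ}

lemma Cut.sys (C : Cut τ d c) (hE : Ergodic τ lam) : Sys (base τ d c) rev (rev ∘ τ) := by
  have hτ := hE.toMeasurePreserving
  have hap : ∀ p q h, 0 ≤ p → p < q → q ≤ 1 → 0 < h →
      ∃ x ∈ base τ d c, x ∈ Ioo p q ∧ τ^[h] x ≠ x := by
    intro p q h hp hpq hq hh
    by_contra! hno
    refine not_ae_periodic hE hp hpq hq hh ?_
    filter_upwards [C.ae_mem_base hτ] with x hx using hno x hx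
  refine ⟨fun x => rev_mem_base, fun x => C.rev_comp_mem_base, fun x _ => rev_rev x,
    fun x hx => C.rev_comp_inv (core_subset hx), fun p q h hp hpq hq hh => ?_,
    fun p q h hp hpq hq hh => ?_, fun p q hp hpq hq => ?_⟩
  · obtain ⟨z, hz, hzI, hne⟩ := hap (1 - q) (1 - p) h (by linarith) (by linarith) (by linarith) hh
    refine ⟨rev z, rev_mem_base hz, ⟨?_, ?_⟩, fun heq => hne ?_⟩
    · simp only [rev]; linarith [hzI.2]
    · simp only [rev]; linarith [hzI.1]
    · have h1 := alt_rev_comp' (τ := τ) h (rev z)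
      rw [alt_succ, if_pos (by simp), heq, rev_rev] at h1
      exact h1.symm
  · obtain ⟨z, hz, hzI, hne⟩ := hap p q h hp hpq hq hh
    exact ⟨z, hz, hzI, by rwa [alt_rev_comp]⟩
  · obtain ⟨H, hH⟩ := C.exists_hitting_bound hE (p := (p + q) / 2) (q := q) (by linarith)
      (by linarith) hq
    have hsub : ∀ y₀ y₁ x : ℝ, y₀ ≤ p → q ≤ y₁ → x ∈ Ico ((p + q) / 2) q → x ∈ Ioo y₀ y₁ :=
      fun y₀ y₁ x h0 h1 hx => ⟨by linarith [hx.1], by linarith [hx.2]⟩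
    refine ⟨2 * H + 2, fun y₀ y₁ s a l h0 h1 hs hsa hR => ?_⟩
    by_contra! hl
    rcases hR with hR | hR
    · obtain ⟨z, hzI, hz, j, hj, hzj⟩ := exists_mem_Ioo_of_ae ((C.ae_mem_base hτ).and hH)
        (p := 1 - (s + a)) (q := 1 - s) (by linarith) (by linarith [hR.pos]) (by linarith)
      refine (hR.good (rev z) (rev_mem_base hz) ⟨?_, ?_⟩).1 (2 * j + 1) (by omega) (by omega) ?_
      · simp only [rev]; linarith [hzI.2]
      · simp only [rev]; linarith [hzI.1]
      · rw [alt_rev_comp', rev_rev]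
        exact hsub _ _ _ h0 h1 hzj
    · obtain ⟨z, hzI, hz, j, hj, hzj⟩ := exists_mem_Ioo_of_ae
        ((C.ae_mem_base hτ).and (hτ.quasiMeasurePreserving.ae hH)) hs
        (by linarith [hR.pos] : s < s + a) hsa
      refine (hR.good z hz hzI).1 (2 * (j + 1)) (by omega) (by omega) ?_
      rw [alt_rev_comp, Function.iterate_succ_apply]
      exact hsub _ _ _ h0 h1 hzj

lemma Cut.exists_state (C : Cut τ d c) :
    ∃ P Q, State (base τ d c) rev (rev ∘ τ) (d + 1) 0 1 P Q := by
  have hQ : ∀ k ≤ d, Tiled (base τ d c) (rev ∘ τ) rev 0 1 0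
        ((List.range k).map fun i => (c (i + 1) - c i, 1)) ∧
      tlen ((List.range k).map fun i => (c (i + 1) - c i, 1)) = c k ∧
      tarea ((List.range k).map fun i => (c (i + 1) - c i, 1)) = c k := by
    intro k hk
    induction k with
    | zero => simp [Tiled, C.zero]
    | succ k ih =>
      obtain ⟨h1, h2, h3⟩ := ih (by omega)
      have hR : Refl (base τ d c) (rev ∘ τ) rev 0 1 (c k) (c (k + 1) - c k) 1 := by
        have heq : ∀ x, x ∈ Ioo (c k) (c k + (c (k + 1) - c k)) →
            (rev ∘ τ) x = c k + c (k + 1) - x := fun x hx => by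
          rw [add_sub_cancel] at hx
          exact C.rev_comp (by omega) hx
        refine ⟨by linarith [C.lt k (by omega)], odd_one, fun x _ hx => ?_, fun x _ hx =>
          ⟨fun i _ _ => by omega, fun y _ hy i hi => ?_⟩⟩
        · rw [alt_one, heq x hx]; ring
        · obtain rfl | rfl : i = 0 ∨ i = 1 := by omega
          · simp
          · rw [alt_one, alt_one, heq x hx, heq y hy]; ring
      rw [List.range_succ, List.map_append, tiled_append, tlen_append, tarea_append, h2, h3]
      refine ⟨⟨h1, ?_⟩, ?_, ?_⟩
      · simpa [Tiled] using hR
      · simp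
      · simp
  obtain ⟨h1, h2, h3⟩ := hQ d le_rfl
  refine ⟨[(1, 1)], (List.range d).map fun i => (c (i + 1) - c i, 1), le_rfl, le_rfl, ?_, h1, ?_,
    ?_, ?_, ?_⟩
  · refine ⟨⟨one_pos, odd_one, fun x _ _ => ?_, fun x _ _ =>
      ⟨fun i _ _ => by omega, fun y _ _ i hi => ?_⟩⟩, trivial⟩
    · simp [rev]
    · have hi : i ≤ 1 := hi
      obtain rfl | rfl : i = 0 ∨ i = 1 := by omega
      · simp
      · simp [rev]
  · simp
  · rw [h2, C.one, sub_zero]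
  · rw [h3, C.one]; norm_num
  · simp [add_comm]

end Dynamics

section Towers

lemma Pair.exists_tower {X : Set ℝ} {f g : ℝ → ℝ} (S : Sys X f g)
    (hf : MeasurePreserving f lam lam) (hg : MeasurePreserving g lam lam)
    (hX : MeasurableSet X) (hXae : ∀ᵐ x ∂lam, x ∈ X) {N : ℕ} {s a t b : ℝ} {l m : ℕ}
    (h : Pair X f g N s a l t b m) (hfg : (∀ x ∈ X, f x = 1 - x) ∨ ∀ x ∈ X, g x = 1 - x) :
    ∃ (n : ℕ) (D : Set ℝ), 0 < n ∧ MeasurableSet D ∧ ENNReal.ofReal (1 / N ^ 2) ≤ lam D ∧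
      ∀ z ∈ D, |alt g f (2 * n) z - z| ≤ a ∧
        |∑ i ∈ Finset.range n, (alt g f (2 * i) z - 1 / 2)| ≤ 5 := by
  obtain ⟨J, hJ⟩ := h.hA.odd
  obtain ⟨K, hK⟩ := h.hB.odd
  have hmeas : ∀ i, MeasurableSet (X ∩ alt g f (2 * i) ⁻¹' Ioo t (t + b)) := fun i =>
    hX.inter ((measurePreserving_alt hg hf _).measurable measurableSet_Ioo)
  refine ⟨J + K + 1, ⋃ i ∈ Finset.range (J + 1), X ∩ alt g f (2 * i) ⁻¹' Ioo t (t + b),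
    by omega, Finset.measurableSet_biUnion _ fun i _ => hmeas i, ?_, fun z hz => ?_⟩
  · rw [measure_biUnion_finset]
    · have hlevel : ∀ i, lam (X ∩ alt g f (2 * i) ⁻¹' Ioo t (t + b)) = ENNReal.ofReal b := by
        intro i
        have h1 : (X ∩ alt g f (2 * i) ⁻¹' Ioo t (t + b) : Set ℝ) =ᵐ[lam]
            alt g f (2 * i) ⁻¹' Ioo t (t + b) := by
          filter_upwards [hXae] with x hx
          exact propext ⟨fun h => h.2, fun h => ⟨hx, h⟩⟩
        rw [measure_congr h1, (measurePreserving_alt hg hf _).measure_preimage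
          measurableSet_Ioo.nullMeasurableSet,
          lam_Ioo (h.s_nonneg.trans h.s_le) (h.t_le.trans h.le_one), add_sub_cancel_left]
      simp_rw [hlevel]
      rw [Finset.sum_const, Finset.card_range, nsmul_eq_mul, ← ENNReal.ofReal_natCast,
        ← ENNReal.ofReal_mul (Nat.cast_nonneg _)]
      refine ENNReal.ofReal_le_ofReal ?_
      have hN : (0 : ℝ) < N := by
        rcases Nat.eq_zero_or_pos N with rfl | hN
        · have := h.thick
          have := h.hA.pos
          simp at *
          linarith
        · exact_mod_cast hN
      have hlJ : (l : ℝ) ≤ 2 * ((J + 1 : ℕ) : ℝ) := by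
        rw [hJ]; push_cast; linarith
      rw [div_le_iff₀ (by positivity)]
      have h1 := h.area_ge
      have h2 : a * l * N ≤ (b * N) * (2 * ((J + 1 : ℕ) : ℝ)) * N := by
        have := h.thick
        have := h.hB.pos
        gcongr
      nlinarith
    · intro i hi j hj hij
      rw [Finset.mem_coe, Finset.mem_range] at hi hj
      refine Set.disjoint_left.2 fun z hzi hzj => ?_
      rcases lt_or_gt_of_ne hij with hlt | hlt
      · exact h.disjoint S hlt (by omega) hzi.1 hzi.2 hzj.2
      · exact h.disjoint S hlt (by omega) hzi.1 hzj.2 hzi.2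
    · exact fun i _ => hmeas i
  · simp only [mem_iUnion, Finset.mem_range, exists_prop] at hz
    obtain ⟨j, hj, hzX, hzj⟩ := hz
    exact h.estimate S hfg (by omega) (by omega) hzX hzj

variable {τ : ℝ → ℝ} {d : ℕ} {c : ℕ → ℝ}

/-- Partial rigidity with bounded Birkhoff sums of the centred coordinate. -/
lemma Cut.exists_rigid (C : Cut τ d c) (hE : Ergodic τ lam) {ε : ℝ} (hε : 0 < ε) :
    ∃ (n : ℕ) (D : Set ℝ), 0 < n ∧ MeasurableSet D ∧
      ENNReal.ofReal (1 / ((d + 1 : ℕ) : ℝ) ^ 2) ≤ lam D ∧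
      ∀ z ∈ D, |τ^[n] z - z| ≤ ε ∧ |∑ i ∈ Finset.range n, (τ^[i] z - 1 / 2)| ≤ 5 := by
  have hτ := hE.toMeasurePreserving
  have hR := measurePreserving_rev
  have hS := measurePreserving_rev_comp hτ
  obtain ⟨P, Q, hPQ⟩ := C.exists_state
  obtain ⟨s, a, l, t, b, m, ha, h | h⟩ := hPQ.exists_pair (C.sys hE) one_pos hε
  · obtain ⟨n, D, hn, hD, hDc, hest⟩ := h.exists_tower (C.sys hE) hR hS (measurableSet_base hτ)
      (C.ae_mem_base hτ) (Or.inl fun _ _ => rfl)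
    simp only [alt_rev_comp] at hest
    exact ⟨n, D, hn, hD, hDc, fun z hz => ⟨(hest z hz).1.trans ha, (hest z hz).2⟩⟩
  · obtain ⟨n, D, hn, hD, hDc, hest⟩ := h.exists_tower (C.sys hE).swap hS hR
      (measurableSet_base hτ) (C.ae_mem_base hτ) (Or.inr fun _ _ => rfl)
    have hconj : ∀ i x, τ^[i] x = 1 - alt rev (rev ∘ τ) (2 * i) (rev x) := by
      intro i x
      have h1 := alt_rev_comp' (τ := τ) i (rev x)
      rw [alt_succ, if_pos (by simp), rev_rev] at h1
      exact h1.symm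
    refine ⟨n, rev ⁻¹' D, hn, hR.measurable hD, ?_, fun z hz => ?_⟩
    · rwa [hR.measure_preimage hD.nullMeasurableSet]
    · obtain ⟨h1, h2⟩ := hest _ hz
      constructor
      · rw [abs_sub_comm, hconj n z]
        refine le_trans (le_of_eq ?_) (h1.trans ha)
        congr 1
        simp only [rev]
        ring
      · rw [← abs_neg, ← Finset.sum_neg_distrib]
        refine le_trans (le_of_eq ?_) h2
        congr 1
        refine Finset.sum_congr rfl fun i _ => ?_
        rw [hconj i z]
        ring

end Towers

end SkewIET

/-- the skew product over a weakly mixing symmetric IET of `[0,1)` with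
cocycle `f(x) = a (x - 1/2)`, `a ≠ 0`, has infinite ergodic index. -/
theorem stmt2 (T : IET) (ha0 : T.a = 0) (hb1 : T.b = 1) (hsymm : T.IsSymm)
    (hWM : Ergodic (fun p : ℝ × ℝ => (T.toFun p.1, T.toFun p.2))
      ((volume.restrict (Set.Ico (0:ℝ) 1)).prod (volume.restrict (Set.Ico (0:ℝ) 1))))
    (a : ℝ) (ha : a ≠ 0) (n : ℕ) (hn : 1 ≤ n) :
    Ergodic
      (fun p : Fin n → ℝ × ℝ => fun i => (T.toFun (p i).1, (p i).2 + a * ((p i).1 - 1/2)))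
      (Measure.pi fun _ : Fin n =>
        (volume.restrict (Set.Ico (0:ℝ) 1)).prod (volume : Measure ℝ)) := by
  obtain ⟨c, C⟩ := SkewIET.exists_cut T ha0 hb1 hsymm
  have hT : Measurable T.toFun :=
    measurable_fst.comp (hWM.measurable.comp (measurable_id.prodMk measurable_id))
  have hE : Ergodic T.toFun SkewIET.lam := SkewIET.ergodic_of_ergodic_prod hT hWM
  refine SkewIET.ergodic_pi_skew (lam := SkewIET.lam) (f := fun x => a * (x - 1 / 2))
    (c := ENNReal.ofReal (1 / ((T.d + 1 : ℕ) : ℝ) ^ 2)) (C := |a| * 5)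
    (κ := (T.d + 1) * ‖a⁻¹‖₊) hT (by fun_prop) hWM ?_ (by positivity) (fun ε hε => ?_) n
  · rw [Ne, ENNReal.ofReal_eq_zero, not_le]
    positivity
  · obtain ⟨h, D, hh, hD, hDc, hest⟩ := C.exists_rigid hE hε
    refine ⟨h, D, hD, hDc, fun x hx => ⟨(hest x hx).1, ?_⟩,
      fun W _ => C.measure_birkhoffSum_le ha hh W⟩
    rw [birkhoffSum, ← Finset.mul_sum, abs_mul]
    exact mul_le_mul_of_nonneg_left (hest x hx).2 (abs_nonneg a)
end

section
/- Let T : I → I be an ergodic symmetric interval exchange transformation such that the point c_{1/2} lies inside a connection of T. Then −1 is an eigenvalue of the Koopman operator of T: there exists a measurable function f : I → {−1, 1} such that f ∘ T = −f Lebesgue-almost everywhere. In particular, T is not weakly mixing. -/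
open MeasureTheory Set
open scoped Classical

open IET

namespace IET

/-- Left endpoint of the `α`-th block when blocks of lengths `len` are laid out from `a` in the
order given by `σ`. -/
noncomputable def blockStart {d : ℕ} (a : ℝ) (len : Fin d → ℝ) (σ : Fin d ≃ Fin d)
    (α : Fin d) : ℝ :=
  a + ∑ β ∈ Finset.univ.filter (fun β => σ β < σ α), len β

section Block

variable {d : ℕ} {a : ℝ} {len : Fin d → ℝ} {σ : Fin d ≃ Fin d}

lemma le_blockStart (hlen : ∀ α, 0 < len α) (α : Fin d) : a ≤ blockStart a len σ α :=
  le_add_of_nonneg_right (Finset.sum_nonneg fun β _ => (hlen β).le)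

lemma blockStart_add_len (α : Fin d) :
    blockStart a len σ α + len α = a + ∑ β ∈ Finset.univ.filter (fun β => σ β ≤ σ α), len β := by
  have h : Finset.univ.filter (fun β => σ β ≤ σ α) =
      insert α (Finset.univ.filter (fun β => σ β < σ α)) := by
    ext β
    simp [le_iff_eq_or_lt]
  rw [h, Finset.sum_insert (by simp), blockStart]
  ring

lemma blockStart_add_len_le_of_lt (hlen : ∀ α, 0 < len α) {α β : Fin d} (h : σ α < σ β) :
    blockStart a len σ α + len α ≤ blockStart a len σ β := by
  rw [blockStart_add_len, blockStart]
  refine add_le_add_right (Finset.sum_le_sum_of_subset_of_nonneg (fun γ hγ => ?_) fun γ _ _ => (hlen γ).le) _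
  simp only [Finset.mem_filter, Finset.mem_univ, true_and] at hγ ⊢
  exact hγ.trans_lt h

lemma blockStart_add_len_le (hlen : ∀ α, 0 < len α) (α : Fin d) :
    blockStart a len σ α + len α ≤ a + ∑ β, len β := by
  rw [blockStart_add_len]
  exact add_le_add_right (Finset.sum_le_sum_of_subset_of_nonneg (Finset.subset_univ _)
    fun γ _ _ => (hlen γ).le) _

lemma block_unique (hlen : ∀ α, 0 < len α) {α β : Fin d} {x : ℝ}
    (hα : x ∈ Ico (blockStart a len σ α) (blockStart a len σ α + len α))
    (hβ : x ∈ Ico (blockStart a len σ β) (blockStart a len σ β + len β)) : α = β := by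
  rcases lt_trichotomy (σ α) (σ β) with h | h | h
  · linarith [blockStart_add_len_le_of_lt (a := a) hlen h, hα.2, hβ.1]
  · exact σ.injective h
  · linarith [blockStart_add_len_le_of_lt (a := a) hlen h, hβ.2, hα.1]

lemma exists_mem_block {x : ℝ} (hx : x ∈ Ico a (a + ∑ β, len β)) :
    ∃ α, x ∈ Ico (blockStart a len σ α) (blockStart a len σ α + len α) := by
  have key : ∀ m : ℕ, m ≤ d →
      x < a + ∑ β ∈ Finset.univ.filter (fun β => (σ β : ℕ) < m), len β →
      ∃ α, x ∈ Ico (blockStart a len σ α) (blockStart a len σ α + len α) := by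
    intro m
    induction m with
    | zero => intro _ h; simp at h; linarith [hx.1]
    | succ m ih =>
      intro hm h
      by_cases h' : x < a + ∑ β ∈ Finset.univ.filter (fun β => (σ β : ℕ) < m), len β
      · exact ih (by omega) h'
      · have hσ : (σ (σ.symm ⟨m, hm⟩) : ℕ) = m := by simp
        refine ⟨σ.symm ⟨m, hm⟩, ?_, ?_⟩
        · simpa [blockStart, Fin.lt_def] using h'
        · rw [blockStart_add_len]
          simpa [Fin.le_def, Nat.lt_succ_iff] using h
  exact key d le_rfl (by simpa using hx.2)

end Block

variable {T : IET}

lemma lep_eq (α : Fin T.d) : T.lep α = blockStart T.a T.len T.perm0 α := rfl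

lemma lepImg_eq (α : Fin T.d) : T.lepImg α = blockStart T.a T.len T.perm1 α := rfl

lemma a_add_sum : T.a + ∑ β, T.len β = T.b := by rw [T.len_sum]; ring

lemma interval_unique {α β : Fin T.d} {x : ℝ} (hα : x ∈ T.interval α) (hβ : x ∈ T.interval β) :
    α = β :=
  block_unique T.len_pos hα hβ

lemma exists_mem_interval {x : ℝ} (hx : x ∈ Ico T.a T.b) : ∃ α, x ∈ T.interval α :=
  exists_mem_block (by rwa [a_add_sum])

lemma exists_mem_intervalImg {x : ℝ} (hx : x ∈ Ico T.a T.b) : ∃ α, x ∈ T.intervalImg α :=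
  exists_mem_block (by rwa [a_add_sum])

lemma interval_subset (α : Fin T.d) : T.interval α ⊆ Ico T.a T.b := fun _ hx =>
  ⟨(le_blockStart T.len_pos α).trans hx.1,
    hx.2.trans_le ((blockStart_add_len_le T.len_pos α).trans_eq a_add_sum)⟩

lemma intervalImg_subset (α : Fin T.d) : T.intervalImg α ⊆ Ico T.a T.b := fun _ hx =>
  ⟨(le_blockStart T.len_pos α).trans hx.1,
    hx.2.trans_le ((blockStart_add_len_le T.len_pos α).trans_eq a_add_sum)⟩

lemma toFun_of_mem {α : Fin T.d} {x : ℝ} (hx : x ∈ T.interval α) :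
    T.toFun x = x + T.transl α := by
  rw [toFun, Finset.sum_eq_single α, if_pos hx]
  · exact fun β _ hβ => if_neg fun h => hβ (interval_unique h hx)
  · simp

lemma invFun_of_mem {α : Fin T.d} {x : ℝ} (hx : x ∈ T.intervalImg α) :
    T.invFun x = x - T.transl α := by
  rw [invFun, Finset.sum_eq_single α, if_pos hx, sub_eq_add_neg]
  · exact fun β _ hβ => if_neg fun h => hβ (block_unique T.len_pos h hx)
  · simp

lemma toFun_mem_Ico {x : ℝ} (hx : x ∈ Ico T.a T.b) : T.toFun x ∈ Ico T.a T.b := by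
  obtain ⟨α, hα⟩ := exists_mem_interval hx
  refine intervalImg_subset α ?_
  rw [toFun_of_mem hα]
  simp only [interval, intervalImg, transl, mem_Ico] at hα ⊢
  constructor <;> linarith

lemma invFun_mem_Ico_and_toFun_invFun {x : ℝ} (hx : x ∈ Ico T.a T.b) :
    T.invFun x ∈ Ico T.a T.b ∧ T.toFun (T.invFun x) = x := by
  obtain ⟨α, hα⟩ := exists_mem_intervalImg hx
  have h : T.invFun x ∈ T.interval α := by
    rw [invFun_of_mem hα]
    simp only [interval, intervalImg, transl, mem_Ico] at hα ⊢
    constructor <;> linarith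
  exact ⟨interval_subset α h, by rw [toFun_of_mem h, invFun_of_mem hα]; ring⟩

lemma toFun_iterate_invFun_iterate (n : ℕ) {x : ℝ} (hx : x ∈ Ico T.a T.b) :
    T.toFun^[n] (T.invFun^[n] x) = x := by
  induction n generalizing x with
  | zero => rfl
  | succ n ih =>
    obtain ⟨h1, h2⟩ := invFun_mem_Ico_and_toFun_invFun hx
    rw [Function.iterate_succ_apply', Function.iterate_succ_apply, ih h1, h2]

lemma lep_mem_Ico (α : Fin T.d) : T.lep α ∈ Ico T.a T.b :=
  interval_subset α ⟨le_rfl, by linarith [T.len_pos α]⟩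

/-- The reflection of the exchanged interval `I_α` about its midpoint. -/
noncomputable def reflInterval (T : IET) (α : Fin T.d) (x : ℝ) : ℝ :=
  2 * T.lep α + T.len α - x

lemma reflInterval_mem_Ioo {α : Fin T.d} {x : ℝ}
    (hx : x ∈ Ioo (T.lep α) (T.lep α + T.len α)) :
    T.reflInterval α x ∈ Ioo (T.lep α) (T.lep α + T.len α) := by
  simp only [reflInterval, mem_Ioo] at hx ⊢
  constructor <;> linarith

lemma IsSymm.lepImg_eq_refl (h : T.IsSymm) (α : Fin T.d) :
    T.lepImg α = T.refl (T.lep α + T.len α) := by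
  have h1 : Finset.univ.filter (fun β => T.perm1 β < T.perm1 α) =
      Finset.univ.filter (fun β => ¬ T.perm0 β ≤ T.perm0 α) := by
    ext β
    have := h α
    have := h β
    simp only [Finset.mem_filter, Finset.mem_univ, true_and, Fin.lt_def, Fin.le_def]
    omega
  rw [lepImg, h1, lep_eq, blockStart_add_len, refl]
  have := Finset.sum_filter_add_sum_filter_not Finset.univ
    (fun β => T.perm0 β ≤ T.perm0 α) T.len
  have := T.len_sum
  linarith

lemma IsSymm.refl_toFun (h : T.IsSymm) {α : Fin T.d} {x : ℝ} (hx : x ∈ T.interval α) :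
    T.refl (T.toFun x) = T.reflInterval α x := by
  rw [toFun_of_mem hx, transl, h.lepImg_eq_refl, refl, refl, reflInterval]
  ring

/-- The function equal to `1` to the right of `x` and to `-1` to the left of `x`. -/
noncomputable def side (x y : ℝ) : ℝ := if x ≤ y then 1 else -1

lemma measurable_side (x : ℝ) : Measurable (side x) :=
  Measurable.ite measurableSet_Ici measurable_const measurable_const

lemma side_eq_or (x y : ℝ) : side x y = 1 ∨ side x y = -1 := ite_eq_or_eq _ _ _

lemma side_sub_sub {c x y : ℝ} (h : x ≠ y) : side (c - x) (c - y) = - side x y := by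
  rcases h.lt_or_gt with h | h
  · rw [side, side, if_neg (by linarith), if_pos h.le]
  · rw [side, side, if_pos (by linarith), if_neg (by linarith), neg_neg]

lemma side_congr {l r x y y' : ℝ} (hy : y ∈ Ioo l r) (hy' : y' ∈ Ioo l r) (hx : x ∉ Ioo l r) :
    side x y = side x y' := by
  have h : x ≤ l ∨ r ≤ x := by
    by_contra! h
    exact hx h
  rcases h with h | h
  · rw [side, side, if_pos (h.trans hy.1.le), if_pos (h.trans hy'.1.le)]
  · rw [side, side, if_neg (by linarith [hy.2]), if_neg (by linarith [hy'.2])]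

/-- The sign at `y` determined by the points `z 0, …, z k` and the reflections of
`z 1, …, z k`. -/
noncomputable def orbitSign (T : IET) (z : ℕ → ℝ) (k : ℕ) (y : ℝ) : ℝ :=
  side (z 0) y * ∏ i ∈ Finset.range k, side (z (i + 1)) y * side (T.refl (z (i + 1))) y

lemma measurable_orbitSign (z : ℕ → ℝ) (k : ℕ) : Measurable (T.orbitSign z k) :=
  (measurable_side _).mul (Finset.measurable_fun_prod _ fun _ _ =>
    (measurable_side _).mul (measurable_side _))

lemma orbitSign_eq_or (z : ℕ → ℝ) (k : ℕ) (y : ℝ) :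
    T.orbitSign z k y = 1 ∨ T.orbitSign z k y = -1 := by
  have hmul : ∀ {u v : ℝ}, (u = 1 ∨ u = -1) → (v = 1 ∨ v = -1) → (u * v = 1 ∨ u * v = -1) := by
    rintro u v (rfl | rfl) (rfl | rfl) <;> norm_num
  exact hmul (side_eq_or _ _) (Finset.prod_induction _ (fun u => u = 1 ∨ u = -1)
    (fun _ _ => hmul) (Or.inl rfl) fun _ _ => hmul (side_eq_or _ _) (side_eq_or _ _))

lemma orbitSign_eq (z : ℕ → ℝ) (k : ℕ) (y : ℝ) :
    T.orbitSign z k y =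
      side (z k) y * ∏ i ∈ Finset.range k, side (z i) y * side (T.refl (z (i + 1))) y := by
  rw [orbitSign, Finset.prod_mul_distrib, Finset.prod_mul_distrib, ← mul_assoc, ← mul_assoc,
    mul_comm (side (z 0) y), mul_comm (side (z k) y), ← Finset.prod_range_succ,
    ← Finset.prod_range_succ' (fun i => side (z i) y)]

lemma refl_refl (x : ℝ) : T.refl (T.refl x) = x := sub_sub_cancel _ _

lemma orbitSign_refl {z : ℕ → ℝ} {k : ℕ} {y : ℝ} (h0 : T.refl (z 0) = z 0)
    (h1 : ∀ i ≤ k, z i ≠ y) (h2 : ∀ i ≤ k, T.refl (z i) ≠ y) :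
    T.orbitSign z k (T.refl y) = - T.orbitSign z k y := by
  have hs : ∀ x, T.refl x ≠ y → side x (T.refl y) = - side (T.refl x) y := by
    intro x hx
    rw [← side_sub_sub (c := T.a + T.b) hx]
    change _ = side (T.refl (T.refl x)) _
    rw [refl_refl]
    rfl
  rw [orbitSign, orbitSign, hs _ (h2 0 k.zero_le), h0, neg_mul]
  congr 2
  refine Finset.prod_congr rfl fun i hi => ?_
  have hi' : i + 1 ≤ k := Finset.mem_range.1 hi
  rw [hs _ (h2 _ hi'), hs _ (by rw [refl_refl]; exact h1 _ hi'), refl_refl]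
  ring

lemma orbitSign_reflInterval {z : ℕ → ℝ} {k : ℕ} {y : ℝ} {γ : Fin T.d}
    (hy : y ∈ Ioo (T.lep γ) (T.lep γ + T.len γ))
    (hend : ∃ β, z k = T.lep β)
    (hmid : ∀ i < k, ∃ δ, z i ∈ Ioo (T.lep δ) (T.lep δ + T.len δ) ∧
      T.refl (z (i + 1)) = T.reflInterval δ (z i))
    (h1 : ∀ i ≤ k, z i ≠ y) (h2 : ∀ i ≤ k, z i ≠ T.reflInterval γ y) :
    T.orbitSign z k (T.reflInterval γ y) = T.orbitSign z k y := by
  have hw := reflInterval_mem_Ioo hy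
  have hdisj : ∀ {δ x}, δ ≠ γ → x ∈ T.interval δ → x ∉ Ioo (T.lep γ) (T.lep γ + T.len γ) :=
    fun hne hx hx' => hne (interval_unique hx (Ioo_subset_Ico_self hx'))
  have hk : z k ∉ Ioo (T.lep γ) (T.lep γ + T.len γ) := by
    obtain ⟨β, hβ⟩ := hend
    rw [hβ]
    rcases eq_or_ne β γ with rfl | hne
    · simp
    · exact hdisj hne ⟨le_rfl, by linarith [T.len_pos β]⟩
  rw [orbitSign_eq, orbitSign_eq, side_congr hw hy hk]
  congr 1
  refine Finset.prod_congr rfl fun i hi => ?_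
  have hi' : i < k := Finset.mem_range.1 hi
  obtain ⟨δ, hδ, hr⟩ := hmid i hi'
  rw [hr]
  rcases eq_or_ne δ γ with rfl | hne
  · have e1 := side_sub_sub (c := 2 * T.lep δ + T.len δ) (h1 i hi'.le)
    have e2 := side_sub_sub (c := 2 * T.lep δ + T.len δ) (h2 i hi'.le)
    rw [reflInterval, sub_sub_cancel] at e2
    simp only [reflInterval]
    rw [e1, e2]
    ring
  · rw [side_congr hw hy (hdisj hne (Ioo_subset_Ico_self hδ)),
      side_congr hw hy (hdisj hne (Ioo_subset_Ico_self (reflInterval_mem_Ioo hδ)))]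

lemma refl_centerHalf : T.refl T.centerHalf = T.centerHalf := by
  rw [refl, centerHalf]
  ring

lemma centerHalf_mem_Ioo : T.centerHalf ∈ Ioo T.a T.b := by
  have := T.hab
  constructor <;> rw [centerHalf] <;> linarith

lemma lep_of_perm0_eq_zero {α : Fin T.d} (h : (T.perm0 α : ℕ) = 0) : T.lep α = T.a := by
  have : Finset.univ.filter (fun β => T.perm0 β < T.perm0 α) = ∅ :=
    Finset.filter_eq_empty_iff.2 fun β _ => by rw [Fin.lt_def]; omega
  rw [lep, this, Finset.sum_empty, add_zero]

lemma a_lt_toFun {α : Fin T.d} {x : ℝ} (hx : x ∈ Ioo (T.lep α) (T.lep α + T.len α)) :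
    T.a < T.toFun x := by
  have h : T.a ≤ T.lepImg α := le_blockStart T.len_pos α
  rw [toFun_of_mem (Ioo_subset_Ico_self hx), transl]
  linarith [hx.1]

/-- Before its first visit to a discontinuity, the orbit of a point in the interior of `[a, b)`
stays in the interiors of the exchanged intervals. -/
lemma exists_mem_Ioo_of_lt {x : ℝ} (hx : x ∈ Ioo T.a T.b) {k : ℕ}
    (hk : ∀ i < k, ∀ β, (T.perm0 β : ℕ) ≠ 0 → T.toFun^[i] x ≠ T.lep β) :
    ∀ i < k, ∃ δ, T.toFun^[i] x ∈ Ioo (T.lep δ) (T.lep δ + T.len δ) := by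
  have hmem : ∀ i, T.toFun^[i] x ∈ Ico T.a T.b := fun i => by
    induction i with
    | zero => exact Ioo_subset_Ico_self hx
    | succ i ih => rw [Function.iterate_succ_apply']; exact toFun_mem_Ico ih
  have hstep : ∀ i < k, T.a < T.toFun^[i] x →
      ∃ δ, T.toFun^[i] x ∈ Ioo (T.lep δ) (T.lep δ + T.len δ) := by
    intro i hi ha
    obtain ⟨δ, hδ⟩ := exists_mem_interval (hmem i)
    refine ⟨δ, lt_of_le_of_ne hδ.1 fun h => ?_, hδ.2⟩
    by_cases h0 : (T.perm0 δ : ℕ) = 0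
    · rw [← h, lep_of_perm0_eq_zero h0] at ha
      exact lt_irrefl _ ha
    · exact hk i hi δ h0 h.symm
  intro i
  induction i with
  | zero => exact fun h => hstep 0 h hx.1
  | succ i ih =>
    intro h
    obtain ⟨δ, hδ⟩ := ih (by omega)
    exact hstep _ h (by rw [Function.iterate_succ_apply']; exact a_lt_toFun hδ)

/-- If the midpoint of a symmetric IET is eventually mapped to a discontinuity, then some
measurable sign function is reversed by the IET almost everywhere. -/
lemma IsSymm.exists_sign_comp_eq_neg (hsymm : T.IsSymm)
    (hc : ∃ k : ℕ, ∃ β, (T.perm0 β : ℕ) ≠ 0 ∧ T.toFun^[k] T.centerHalf = T.lep β) :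
    ∃ f : ℝ → ℝ, Measurable f ∧ (∀ x, f x = 1 ∨ f x = -1) ∧
      ∀ᵐ x ∂(volume.restrict (Ico T.a T.b)), f (T.toFun x) = - f x := by
  let k := Nat.find hc
  let z : ℕ → ℝ := fun i => T.toFun^[i] T.centerHalf
  have hend : ∃ β, z k = T.lep β := (Nat.find_spec hc).imp fun _ h => h.2
  have hmid : ∀ i < k, ∃ δ, z i ∈ Ioo (T.lep δ) (T.lep δ + T.len δ) ∧
      T.refl (z (i + 1)) = T.reflInterval δ (z i) := by
    intro i hi
    obtain ⟨δ, hδ⟩ := exists_mem_Ioo_of_lt centerHalf_mem_Ioo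
      (fun j hj β h0 h => Nat.find_min hc hj ⟨β, h0, h⟩) i hi
    refine ⟨δ, hδ, ?_⟩
    rw [← hsymm.refl_toFun (Ioo_subset_Ico_self hδ)]
    simp only [z, Function.iterate_succ_apply']
  refine ⟨T.orbitSign z k, measurable_orbitSign z k, orbitSign_eq_or z k, ?_⟩
  let F : Set ℝ := range z ∪ range (fun i => T.refl (z i))
  let E : Set ℝ := F ∪ range T.lep ∪ ⋃ γ, T.reflInterval γ '' F
  have hF : F.Countable := (countable_range _).union (countable_range _)
  have hE : E.Countable := (hF.union (countable_range _)).union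
    (countable_iUnion fun γ => hF.image _)
  have hEae : ∀ᵐ x ∂(volume.restrict (Ico T.a T.b)), x ∉ E :=
    ae_restrict_of_ae (hE.ae_notMem _)
  filter_upwards [hEae, ae_restrict_mem measurableSet_Ico] with y hyE hy
  obtain ⟨γ, hγ⟩ := exists_mem_interval hy
  have hyF : y ∉ F := fun h => hyE (Or.inl (Or.inl h))
  have hwF : T.reflInterval γ y ∉ F := fun h =>
    hyE (Or.inr (mem_iUnion.2 ⟨γ, _, h, sub_sub_cancel _ _⟩))
  have hyγ : y ∈ Ioo (T.lep γ) (T.lep γ + T.len γ) :=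
    ⟨lt_of_le_of_ne hγ.1 fun h => hyE (Or.inl (Or.inr ⟨γ, h⟩)), hγ.2⟩
  have hz : ∀ {x}, x ∉ F → ∀ i ≤ k, z i ≠ x := fun hx i _ h => hx (Or.inl ⟨i, h⟩)
  have hz' : ∀ {x}, x ∉ F → ∀ i ≤ k, T.refl (z i) ≠ x := fun hx i _ h => hx (Or.inr ⟨i, h⟩)
  rw [← refl_refl (T.toFun y), hsymm.refl_toFun hγ,
    orbitSign_refl refl_centerHalf (hz hwF) (hz' hwF),
    orbitSign_reflInterval hyγ hend hmid (hz hyF) (hz hwF)]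

end IET

/-- A finite measure preserving map reversing a measurable sign function almost everywhere has
non-ergodic square. -/
lemma not_ergodic_prodMap_of_comp_eq_neg {α : Type*} [MeasurableSpace α] {μ : Measure α}
    [IsFiniteMeasure μ] [NeZero μ] {g : α → α} (hg : MeasurePreserving g μ μ) {f : α → ℝ}
    (hf : Measurable f) (hf1 : ∀ x, f x = 1 ∨ f x = -1) (hfg : ∀ᵐ x ∂μ, f (g x) = - f x) :
    ¬ Ergodic (fun p : α × α => (g p.1, g p.2)) (μ.prod μ) := by
  intro h
  let A : Set α := {x | f x = 1}
  let B : Set α := {x | f x = -1}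
  have hA : MeasurableSet A := hf (measurableSet_singleton 1)
  have hB : MeasurableSet B := hf (measurableSet_singleton (-1))
  have hAB : μ A = μ B := by
    rw [← hg.measure_preimage hA.nullMeasurableSet]
    refine measure_congr ?_
    filter_upwards [hfg] with x hx
    refine propext ?_
    change f (g x) = 1 ↔ f x = -1
    rw [hx, neg_eq_iff_eq_neg]
  have hA0 : μ A ≠ 0 := by
    intro h0
    have hu : (univ : Set α) ⊆ A ∪ B := fun x _ => hf1 x
    have := measure_mono_null hu (measure_union_null h0 (hAB ▸ h0))
    exact NeZero.ne μ (Measure.measure_univ_eq_zero.1 this)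
  let S : Set (α × α) := {p | f p.1 * f p.2 = 1}
  have hS : MeasurableSet S :=
    ((hf.comp measurable_fst).mul (hf.comp measurable_snd)) (measurableSet_singleton 1)
  have hinv : (fun p : α × α => (g p.1, g p.2)) ⁻¹' S =ᵐ[μ.prod μ] S := by
    filter_upwards [Measure.quasiMeasurePreserving_fst.ae hfg,
      Measure.quasiMeasurePreserving_snd.ae hfg] with p h1 h2
    refine propext ?_
    change f (g p.1) * f (g p.2) = 1 ↔ f p.1 * f p.2 = 1
    rw [h1, h2, neg_mul_neg]
  rcases h.quasiErgodic.ae_empty_or_univ₀ hS.nullMeasurableSet hinv with h0 | h0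
  · have hsub : A ×ˢ A ⊆ S := fun p hp => by
      change f p.1 * f p.2 = 1
      rw [show f p.1 = 1 from hp.1, show f p.2 = 1 from hp.2, one_mul]
    have := measure_mono_null hsub (ae_eq_empty.1 h0)
    rw [Measure.prod_prod, mul_self_eq_zero] at this
    exact hA0 this
  · have hsub : A ×ˢ B ⊆ Sᶜ := fun p hp => by
      change ¬ f p.1 * f p.2 = 1
      rw [show f p.1 = 1 from hp.1, show f p.2 = -1 from hp.2]
      norm_num
    have := measure_mono_null hsub (ae_eq_univ.1 h0)
    rw [Measure.prod_prod, ← hAB, mul_self_eq_zero] at this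
    exact hA0 this

/-- if `c_{1/2}` of an ergodic symmetric IET lies inside a connection, then
`-1` is an eigenvalue of the Koopman operator: there is a measurable `±1`-valued `f` with
`f ∘ T = -f` a.e.; in particular `T` is not weakly mixing. -/
theorem stmt18 (T : IET) (hsymm : T.IsSymm)
    (hErg : Ergodic T.toFun (volume.restrict (Set.Ico T.a T.b)))
    (hc : ∃ s, T.IsConnection s ∧ T.centerHalf ∈ s) :
    (∃ f : ℝ → ℝ, Measurable f ∧ (∀ x, f x = 1 ∨ f x = -1) ∧
      (∀ᵐ x ∂(volume.restrict (Set.Ico T.a T.b)), f (T.toFun x) = - f x)) ∧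
    ¬ Ergodic (fun p : ℝ × ℝ => (T.toFun p.1, T.toFun p.2))
      ((volume.restrict (Set.Ico T.a T.b)).prod
        (volume.restrict (Set.Ico T.a T.b))) := by
  obtain ⟨_, ⟨β, _, _, hβ, _, _, _, rfl⟩, k, _, hk⟩ := hc
  have hsign := hsymm.exists_sign_comp_eq_neg ⟨k, β, hβ, by
    rw [← hk]
    exact toFun_iterate_invFun_iterate k (lep_mem_Ico β)⟩
  refine ⟨hsign, ?_⟩
  obtain ⟨f, hf, hf1, hfT⟩ := hsign
  have : NeZero (volume.restrict (Ico T.a T.b)) :=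
    ⟨by simpa [Measure.restrict_eq_zero] using T.hab⟩
  exact not_ergodic_prodMap_of_comp_eq_neg hErg.toMeasurePreserving hf hf1 hfT
end
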